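/- arXiv:1009.0045 — 2 statements merged into one kernel-verified Lean document; each statement's English description precedes it below -/
import Mathlib

section
/- Every finite simple graph G on n vertices with maximum degree at most 4 has a non-crossing polyline drawing in ℝ³ such that: every vertex is placed at a point with integer coordinates; the entire drawing (all vertices, bends and edge segments) is contained in an axis-parallel box whose side lengths are at most 16n/3, 16n/3 and 16n; every edge is drawn with at most 3 bends; every segment of every edge's path is parallel to one of the vectors (±1,±1,±1) (the long diagonals of the grid cubes); and the drawing has angular resolution at least arccos(−1/3) (≈ 109.5°). -/
open InnerProductGeometry

noncomputable section

/-- Points of three-dimensional Euclidean space. -/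
abbrev Pt : Type := EuclideanSpace ℝ (Fin 3)

/-- The image of a polyline given by a list of points: the union of the closed
segments between consecutive points. -/
def polyImage (l : List Pt) : Set Pt :=
  ⋃ q ∈ l.zip l.tail, segment ℝ q.1 q.2

/-- A polyline is simple (its image is a simple arc): consecutive points are distinct,
two consecutive segments meet exactly in their shared endpoint, and two
non-consecutive segments are disjoint. -/
def SimplePolyline (l : List Pt) : Prop :=
  l.Chain' (· ≠ ·) ∧
  ∀ i j : ℕ, ∀ hi : i + 1 < l.length, ∀ hj : j + 1 < l.length, i < j →
    segment ℝ (l.get ⟨i, by omega⟩) (l.get ⟨i + 1, hi⟩) ∩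
      segment ℝ (l.get ⟨j, by omega⟩) (l.get ⟨j + 1, hj⟩) =
      if j = i + 1 then {l.get ⟨j, by omega⟩} else ∅

/-- A polyline drawing of a (finite simple) graph `G` in ℝ³: an injective placement
`p` of the vertices, and for each (oriented) edge `uv` a list of points, starting at
`p u` and ending at `p v`, giving the polygonal path of the edge; the path of `vu`
is the reverse of the path of `uv`.  The interior points of the list are the bends
of the edge. -/
structure PolylineDrawing {V : Type*} (G : SimpleGraph V) where
  p : V → Pt
  p_inj : Function.Injective p
  seq : ∀ u v : V, G.Adj u v → List Pt
  seq_head : ∀ u v h, (seq u v h).head? = some (p u)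
  seq_last : ∀ u v h, (seq u v h).getLast? = some (p v)
  seq_symm : ∀ u v h, seq v u h.symm = (seq u v h).reverse

variable {V : Type*} {G : SimpleGraph V}

/-- Every edge is drawn with at most `k` bends, i.e. its point list has at most
`k + 2` points. -/
def MaxBends (D : PolylineDrawing G) (k : ℕ) : Prop :=
  ∀ u v h, (D.seq u v h).length ≤ k + 2

/-- The image of the whole drawing: all vertex points and all edge paths. -/
def drawingImage (D : PolylineDrawing G) : Set Pt :=
  Set.range D.p ∪ ⋃ (u) (v) (h : G.Adj u v), polyImage (D.seq u v h)

/-- The drawing has angular resolution at least `θ`: the angle at every bend of every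
edge, and the angle at a common vertex between the initial segments of any two
distinct edges, is at least `θ`. -/
def AngularResAtLeast (D : PolylineDrawing G) (θ : ℝ) : Prop :=
  (∀ u v h, ∀ a q b : Pt, [a, q, b] <:+: D.seq u v h →
    θ ≤ angle (a - q) (b - q)) ∧
  (∀ v u w : V, ∀ hu : G.Adj v u, ∀ hw : G.Adj v w, u ≠ w →
    ∀ a b : Pt, (D.seq v u hu)[1]? = some a → (D.seq v w hw)[1]? = some b →
      θ ≤ angle (a - D.p v) (b - D.p v))

/-- The drawing is non-crossing: every edge path is a simple arc meeting the vertex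
points only in its endpoints, and the paths of two distinct edges intersect exactly
in the images of their common endpoints. -/
def NonCrossing (D : PolylineDrawing G) : Prop :=
  (∀ u v h, SimplePolyline (D.seq u v h)) ∧
  (∀ u v h, polyImage (D.seq u v h) ∩ Set.range D.p = {D.p u, D.p v}) ∧
  (∀ u v u' v' : V, ∀ h : G.Adj u v, ∀ h' : G.Adj u' v', s(u, v) ≠ s(u', v') →
    polyImage (D.seq u v h) ∩ polyImage (D.seq u' v' h') =
      D.p '' (({u, v} : Set V) ∩ {u', v'}))


open Finset in
/-- A 4-regular multigraph can be oriented and 2-coloured so that every vertex has at most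
one outgoing and one incoming edge of each colour. -/
theorem exists_two_factor_of_regular {E W : Type} [Fintype E] [Fintype W] [DecidableEq W]
    (a b : E → W)
    (h : ∀ w, #{e | a e = w} + #{e | b e = w} = 4) :
    ∃ (s t : E → W) (c : E → Bool),
      (∀ e, (s e = a e ∧ t e = b e) ∨ (s e = b e ∧ t e = a e)) ∧
      Function.Injective (fun e => (s e, c e)) ∧ Function.Injective (fun e => (t e, c e)) := by
  classical
  have hall₁ : ∀ S : Finset E,
      #S ≤ #(S.biUnion fun e => ({a e, b e} : Finset W) ×ˢ (univ : Finset Bool)) := by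
    intro S
    have hN : (S.biUnion fun e => ({a e, b e} : Finset W) ×ˢ (univ : Finset Bool)) =
        (S.image a ∪ S.image b) ×ˢ (univ : Finset Bool) := by
      ext ⟨w, i⟩
      simp only [mem_biUnion, mem_product, mem_insert, mem_singleton, mem_univ, and_true,
        mem_union, mem_image]
      grind
    rw [hN, card_product]
    have ha := card_eq_sum_card_fiberwise (s := S) (t := S.image a ∪ S.image b) (f := a)
      (by intro e he; simp; grind)
    have hb := card_eq_sum_card_fiberwise (s := S) (t := S.image a ∪ S.image b) (f := b)
      (by intro e he; simp; grind)
    have hs : ∑ w ∈ S.image a ∪ S.image b,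
        (#{e ∈ S | a e = w} + #{e ∈ S | b e = w}) ≤ ∑ w ∈ S.image a ∪ S.image b, 4 := by
      refine sum_le_sum fun w _ => ?_
      rw [← h w]
      gcongr <;> exact subset_univ S
    rw [sum_add_distrib, ← ha, ← hb, sum_const, smul_eq_mul] at hs
    simp only [card_univ, Fintype.card_bool]
    omega
  obtain ⟨g, hg, hgm⟩ := (all_card_le_biUnion_card_iff_exists_injective _).1 hall₁
  have hcard : Fintype.card E = Fintype.card (W × Bool) := by
    have ha := card_eq_sum_card_fiberwise (s := univ) (t := univ) (f := a) (by simp)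
    have hb := card_eq_sum_card_fiberwise (s := univ) (t := univ) (f := b) (by simp)
    have hs := sum_congr (rfl : (univ : Finset W) = univ) fun w _ => h w
    rw [sum_add_distrib, ← ha, ← hb] at hs
    simp at hs ⊢
    omega
  have hgb : Function.Bijective g := (Fintype.bijective_iff_injective_and_card g).2 ⟨hg, hcard⟩
  let s : E → W := fun e => (g e).1
  let t : E → W := fun e => if s e = a e then b e else a e
  have hst : ∀ e, (s e = a e ∧ t e = b e) ∨ (s e = b e ∧ t e = a e) := by
    intro e
    have := hgm e
    simp only [mem_product, mem_insert, mem_singleton, mem_univ, and_true] at this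
    by_cases hs : s e = a e
    · simp [t, hs]
    · right
      exact ⟨this.resolve_left hs, by simp [t, hs]⟩
  have hs2 : ∀ w, #{e | s e = w} = 2 := by
    intro w
    have : #{e | s e = w} = #(({w} : Finset W) ×ˢ (univ : Finset Bool)) := by
      refine card_bij (fun e _ => g e) ?_ (fun _ _ _ _ hee => hg hee) ?_
      · intro e he
        have := (mem_filter.1 he).2
        exact mem_product.2 ⟨mem_singleton.2 this, mem_univ _⟩
      · rintro ⟨w', i⟩ hw
        obtain ⟨e, he⟩ := hgb.2 (w', i)
        have hw' : w' = w := mem_singleton.1 (mem_product.1 hw).1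
        exact ⟨e, mem_filter.2 ⟨mem_univ _, by simp only [s, he, hw']⟩, he⟩
    simpa using this
  have ht2 : ∀ w, #{e | t e = w} = 2 := by
    intro w
    have : #{e | s e = w} + #{e | t e = w} = #{e | a e = w} + #{e | b e = w} := by
      simp only [card_filter, ← sum_add_distrib]
      refine sum_congr rfl fun e _ => ?_
      rcases hst e with ⟨h1, h2⟩ | ⟨h1, h2⟩ <;> rw [h1, h2]
      exact add_comm _ _
    have := h w
    have := hs2 w
    omega
  have hall₂ : ∀ S : Finset W, #S ≤ #(S.biUnion fun w => image t {e | s e = w}) := by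
    intro S
    have h1 : #{e | s e ∈ S} = ∑ w ∈ S, 2 := by
      rw [card_eq_sum_card_fiberwise (s := ({e | s e ∈ S} : Finset E)) (t := S) (f := s)
        (by intro e he; simpa using he)]
      refine sum_congr rfl fun w hw => ?_
      rw [← hs2 w]
      congr 1
      ext e
      simp
      grind
    have h2 : #{e | s e ∈ S} ≤ 2 * #(image t {e | s e ∈ S}) := by
      refine card_le_mul_card_image _ 2 fun w _ => ?_
      rw [← ht2 w]
      gcongr
      exact subset_univ _
    have h3 : (S.biUnion fun w => image t {e | s e = w}) = image t {e | s e ∈ S} := by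
      ext w
      simp
    rw [h3]
    simp at h1
    omega
  obtain ⟨τ, hτ, hτm⟩ := (all_card_le_biUnion_card_iff_exists_injective _).1 hall₂
  have hτm' : ∀ w, ∃ e, s e = w ∧ t e = τ w := by
    intro w
    simpa using hτm w
  choose m hms hmt using hτm'
  have two : ∀ (f : E → W), (∀ w, #{e | f e = w} = 2) → ∀ e₀ e₁ e₂ : E, f e₁ = f e₀ →
      f e₂ = f e₀ → e₁ ≠ e₀ → e₂ ≠ e₀ → e₁ = e₂ := by
    intro f hf e₀ e₁ e₂ h1 h2 n1 n2
    by_contra hne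
    have : #({e₀, e₁, e₂} : Finset E) ≤ #{e | f e = f e₀} := by
      apply card_le_card
      intro e he
      simp at he ⊢
      rcases he with rfl | rfl | rfl <;> simp [h1, h2]
    rw [hf, card_insert_of_notMem (by simp [n1.symm, n2.symm]), card_pair hne] at this
    omega
  refine ⟨s, t, fun e => decide (e = m (s e)), hst, ?_, ?_⟩
  · intro e₁ e₂ he
    simp only [Prod.mk.injEq, decide_eq_decide] at he
    obtain ⟨hs, hc⟩ := he
    by_cases h1 : e₁ = m (s e₁)
    · rw [h1, hc.1 h1, hs]
    · exact two s hs2 (m (s e₁)) e₁ e₂ (hms _).symm (by rw [hms, hs]) h1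
        (fun h2 => h1 (hc.2 (by rw [← hs]; exact h2)))
  · intro e₁ e₂ he
    simp only [Prod.mk.injEq, decide_eq_decide] at he
    obtain ⟨ht, hc⟩ := he
    by_cases h1 : e₁ = m (s e₁)
    · have h2 := hc.1 h1
      have : τ (s e₁) = τ (s e₂) := by rw [← hmt, ← hmt, ← h1, ← h2, ht]
      rw [h1, h2, hτ this]
    · have h2 : ¬ e₂ = m (s e₂) := fun h2 => h1 (hc.2 h2)
      obtain ⟨w, hw⟩ := (Finite.injective_iff_surjective.1 hτ) (t e₁)
      refine two t ht2 (m w) e₁ e₂ (by rw [hmt, hw]) (by rw [hmt, hw, ht]) ?_ ?_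
      · intro h3
        apply h1
        rw [h3, hms]
      · intro h3
        apply h2
        rw [h3, hms]

open Finset in
/-- A multigraph of maximum degree at most 4 can be oriented and 2-coloured so that every
vertex has at most one outgoing and one incoming edge of each colour. -/
theorem exists_two_factor {E W : Type} [Fintype E] [Fintype W] [DecidableEq W]
    (a b : E → W)
    (h : ∀ w, #{e | a e = w} + #{e | b e = w} ≤ 4) :
    ∃ (s t : E → W) (c : E → Bool),
      (∀ e, (s e = a e ∧ t e = b e) ∨ (s e = b e ∧ t e = a e)) ∧
      Function.Injective (fun e => (s e, c e)) ∧ Function.Injective (fun e => (t e, c e)) := by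
  let cnt : W → ℕ := fun w => #{e | a e = w} + #{e | b e = w}
  let a' : (E × Bool) ⊕ (Σ w : W, Fin (4 - cnt w)) → W × Bool :=
    Sum.elim (fun x => (a x.1, x.2)) (fun x => (x.1, false))
  let b' : (E × Bool) ⊕ (Σ w : W, Fin (4 - cnt w)) → W × Bool :=
    Sum.elim (fun x => (b x.1, x.2)) (fun x => (x.1, true))
  obtain ⟨s, t, c, hst, hs, ht⟩ := exists_two_factor_of_regular a' b' (by
    rintro ⟨w, i⟩
    have h4 : #{e | a e = w} + #{e | b e = w} + (4 - cnt w) = 4 := by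
      have := h w
      simp only [cnt]
      omega
    have key : ∀ (f : E → W) (j : Bool), #{x | Sum.elim (fun x : E × Bool => (f x.1, x.2))
          (fun x : (Σ w : W, Fin (4 - cnt w)) => (x.1, j)) x = (w, i)} =
        #{e | f e = w} + if j = i then 4 - cnt w else 0 := by
      intro f j
      simp only [card_filter, Fintype.sum_sum_type, Fintype.sum_prod_type, Fintype.sum_sigma,
        Sum.elim_inl, Sum.elim_inr, Prod.mk.injEq]
      congr 1
      · refine sum_congr rfl fun e _ => ?_
        rw [Fintype.sum_bool]
        cases i <;> simp
      · by_cases hj : j = i <;> simp [hj]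
    rw [key, key]
    cases i <;> simp <;> omega)
  refine ⟨fun e => (s (.inl (e, false))).1, fun e => (t (.inl (e, false))).1,
    fun e => c (.inl (e, false)), ?_, ?_, ?_⟩
  · intro e
    rcases hst (.inl (e, false)) with ⟨h1, h2⟩ | ⟨h1, h2⟩ <;> simp [h1, h2, a', b']
  · intro e₁ e₂ he
    have h2 : ∀ e, (s (.inl (e, false))).2 = false := by
      intro e
      rcases hst (.inl (e, false)) with ⟨h1, h2⟩ | ⟨h1, h2⟩ <;> simp [h1, a', b']
    simp only [Prod.mk.injEq] at he
    have := @hs (.inl (e₁, false)) (.inl (e₂, false))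
      (Prod.ext (Prod.ext he.1 ((h2 e₁).trans (h2 e₂).symm)) he.2)
    simpa using this
  · intro e₁ e₂ he
    have h2 : ∀ e, (t (.inl (e, false))).2 = false := by
      intro e
      rcases hst (.inl (e, false)) with ⟨h1, h2⟩ | ⟨h1, h2⟩ <;> simp [h2, a', b']
    simp only [Prod.mk.injEq] at he
    have := @ht (.inl (e₁, false)) (.inl (e₂, false))
      (Prod.ext (Prod.ext he.1 ((h2 e₁).trans (h2 e₂).symm)) he.2)
    simpa using this

open Finset in
/-- Port assignment. At each vertex the incident edges get distinct ports, a port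
being a colour together with a bit telling whether it points up. Both ends of an edge
have the same colour, and if the ports differ then the lower end points up. -/
theorem exists_port_assignment {V : Type} [Fintype V] [DecidableEq V] [LinearOrder V]
    (G : SimpleGraph V) [DecidableRel G.Adj] (hdeg : ∀ v, G.degree v ≤ 4) :
    ∃ port : V → V → Bool × Bool,
      (∀ w v v', G.Adj w v → G.Adj w v' → port w v = port w v' → v = v') ∧
      (∀ u v, G.Adj u v → (port u v).1 = (port v u).1) ∧
      (∀ u v, G.Adj u v → u < v → (port u v).2 = false → (port v u).2 = false) := by
  classical
  let E := {x : V × V // G.Adj x.1 x.2 ∧ x.1 < x.2}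
  obtain ⟨s, t, c, hst, hs, ht⟩ := exists_two_factor (E := E) (W := V)
    (fun e => e.1.1) (fun e => e.1.2) (by
      intro w
      refine le_trans (le_of_eq ?_) (hdeg w)
      have h1 : #{e : E | e.1.1 = w} = #{v ∈ G.neighborFinset w | w < v} := by
        refine card_bij (fun e _ => e.1.2) ?_ ?_ ?_
        · rintro ⟨⟨u, v⟩, huv, hlt⟩ he
          simp at he huv hlt ⊢
          subst he
          exact ⟨huv, hlt⟩
        · rintro ⟨⟨u, v⟩, huv, hlt⟩ he ⟨⟨u', v'⟩, huv', hlt'⟩ he' h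
          simp_all
        · intro v hv
          simp at hv
          exact ⟨⟨(w, v), hv⟩, by simp, rfl⟩
      have h2 : #{e : E | e.1.2 = w} = #{v ∈ G.neighborFinset w | ¬ w < v} := by
        refine card_bij (fun e _ => e.1.1) ?_ ?_ ?_
        · rintro ⟨⟨u, v⟩, huv, hlt⟩ he
          simp at he huv hlt ⊢
          subst he
          exact ⟨huv.symm, hlt.le⟩
        · rintro ⟨⟨u, v⟩, huv, hlt⟩ he ⟨⟨u', v'⟩, huv', hlt'⟩ he' h
          simp_all
        · intro v hv
          simp at hv
          exact ⟨⟨(v, w), hv.1.symm, lt_of_le_of_ne hv.2 hv.1.ne'⟩, by simp, rfl⟩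
      rw [h1, h2, card_filter_add_card_filter_not, G.card_neighborFinset_eq_degree])
  let β : V → Bool → Bool := fun v i => decide (∃ e : E, s e = v ∧ c e = i ∧ v < t e)
  let P : E → V → Bool × Bool := fun e w => (c e, if s e = w then β w (c e) else !(β w (c e)))
  let mk : ∀ u v, G.Adj u v → E := fun u v h =>
    if hlt : u < v then ⟨(u, v), h, hlt⟩
      else ⟨(v, u), h.symm, lt_of_le_of_ne (not_lt.1 hlt) h.ne'⟩
  have mk_symm : ∀ u v (h : G.Adj u v), mk u v h = mk v u h.symm := by
    intro u v h
    rcases lt_or_gt_of_ne h.ne with hlt | hlt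
    · simp [mk, hlt, hlt.not_gt]
    · simp [mk, hlt, hlt.not_gt]
  have mk_st : ∀ u v (h : G.Adj u v), (s (mk u v h) = u ∧ t (mk u v h) = v) ∨
      (s (mk u v h) = v ∧ t (mk u v h) = u) := by
    intro u v h
    rcases hst (mk u v h) with ⟨h1, h2⟩ | ⟨h1, h2⟩ <;> rw [h1, h2] <;> simp only [mk] <;>
      split_ifs <;> simp
  have hβ : ∀ e, β (s e) (c e) = decide (s e < t e) := by
    intro e
    simp only [β, decide_eq_decide]
    constructor
    · rintro ⟨e', h1, h2, h3⟩
      have : e' = e := hs (Prod.ext h1 h2)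
      rwa [this] at h3
    · intro h
      exact ⟨e, rfl, rfl, h⟩
  refine ⟨fun u v => if h : G.Adj u v then P (mk u v h) u else (false, false), ?_, ?_, ?_⟩
  · intro w v v' h h' hp
    simp only [h, h', dif_pos, P, Prod.mk.injEq] at hp
    obtain ⟨hc, hb⟩ := hp
    rcases mk_st w v h with ⟨h1, h2⟩ | ⟨h1, h2⟩ <;>
      rcases mk_st w v' h' with ⟨h3, h4⟩ | ⟨h3, h4⟩
    · have : mk w v h = mk w v' h' := hs (Prod.ext (h1.trans h3.symm) hc)
      rw [← h2, ← h4, this]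
    · rw [if_pos h1, if_neg (by rw [h3]; exact h'.ne'), hc] at hb
      simp at hb
    · rw [if_neg (by rw [h1]; exact h.ne'), if_pos h3, hc] at hb
      simp at hb
    · have : mk w v h = mk w v' h' := ht (Prod.ext (h2.trans h4.symm) hc)
      rw [← h1, ← h3, this]
  · intro u v h
    simp only [h, h.symm, dif_pos, P, mk_symm u v h]
  · intro u v h hlt
    simp only [h, h.symm, dif_pos, P]
    rw [← mk_symm u v h]
    have hb := hβ (mk u v h)
    rcases mk_st u v h with ⟨h1, h2⟩ | ⟨h1, h2⟩
    · rw [h1, h2] at hb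
      simp [h1, hb, hlt]
    · rw [h1, h2] at hb
      simp [h1, hb, hlt.le]

/-- A Boolean read as a sign. -/
def sg (b : Bool) : ℝ := if b then 1 else -1

@[simp] lemma sg_true : sg true = 1 := rfl
@[simp] lemma sg_false : sg false = -1 := rfl
@[simp] lemma sg_not (b : Bool) : sg (!b) = -sg b := by cases b <;> simp
lemma sg_eq (b : Bool) : sg b = 1 ∨ sg b = -1 := by cases b <;> simp

/-- A direction `(±1, ±1, ±1)`, recorded by its signs. -/
abbrev Dir : Type := Fin 3 → Bool

/-- The opposite direction. -/
def Dir.opp (D : Dir) : Dir := fun i => !D i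

/-- Two directions are parallel when they are equal or opposite. -/
def Dir.Parallel (D N : Dir) : Prop := N = D ∨ N = D.opp

instance (D N : Dir) : Decidable (D.Parallel N) := by unfold Dir.Parallel; infer_instance

/-- Two directions that differ in exactly one sign. -/
def Dir.Flip (D N : Dir) : Prop := ∃ j, ∀ i, N i = D i ↔ i ≠ j

instance (D N : Dir) : Decidable (D.Flip N) := by unfold Dir.Flip; infer_instance

lemma Dir.exists_sg_of_parallel {D N : Dir} (h : D.Parallel N) :
    ∃ r : ℝ, ∀ i, sg (N i) = r * sg (D i) := by
  rcases h with rfl | rfl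
  · exact ⟨1, by simp⟩
  · exact ⟨-1, by simp [Dir.opp]⟩

lemma Dir.parallel_of_smul_eq {D N : Dir} {α β : ℝ} (hα : α ≠ 0)
    (h : ∀ i, α * sg (D i) = β * sg (N i)) : D.Parallel N := by
  have hβ : β = α ∨ β = -α := by
    have h0 := h 0
    rcases sg_eq (D 0) with h1 | h1 <;> rcases sg_eq (N 0) with h2 | h2 <;> rw [h1, h2] at h0
    · left; linarith
    · right; linarith
    · right; linarith
    · left; linarith
  have hsg : ∀ a b : Bool, sg a = sg b → a = b := by
    intro a b hab
    cases a <;> cases b <;> simp at hab ⊢ <;> norm_num at hab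
  rcases hβ with rfl | rfl
  · left
    ext1 i
    exact hsg _ _ (mul_left_cancel₀ hα (h i).symm)
  · right
    ext1 i
    refine hsg _ _ (mul_left_cancel₀ hα ?_)
    simp only [Dir.opp, sg_not]
    linarith [h i]

/-- Three pairwise non-parallel directions are linearly independent. -/
lemma Dir.parallel_of_dependent {D M N : Dir} {α β γ : ℝ} (hα : α ≠ 0)
    (h : ∀ i, α * sg (D i) + β * sg (M i) + γ * sg (N i) = 0) (hDM : ¬ D.Parallel M) :
    D.Parallel N := by
  by_contra hDN
  by_cases hMN : M.Parallel N
  · obtain ⟨r, hr⟩ := exists_sg_of_parallel hMN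
    refine hDM (parallel_of_smul_eq (β := -β - γ * r) hα fun i => ?_)
    have := h i
    rw [hr] at this
    linarith
  · have key : ∀ d₀ d₁ d₂ m₀ m₁ m₂ n₀ n₁ n₂ : Bool,
        ¬ Dir.Parallel ![d₀, d₁, d₂] ![m₀, m₁, m₂] → ¬ Dir.Parallel ![d₀, d₁, d₂] ![n₀, n₁, n₂] →
        ¬ Dir.Parallel ![m₀, m₁, m₂] ![n₀, n₁, n₂] →
        let z : Bool → ℤ := fun b => if b then 1 else -1
        z d₀ * (z m₁ * z n₂ - z m₂ * z n₁) - z d₁ * (z m₀ * z n₂ - z m₂ * z n₀) +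
          z d₂ * (z m₀ * z n₁ - z m₁ * z n₀) ≠ 0 := by
      decide
    have eta : ∀ A : Dir, ![A 0, A 1, A 2] = A := by
      intro A
      ext i
      fin_cases i <;> rfl
    have hz : ∀ b : Bool, (((if b then 1 else -1 : ℤ)) : ℝ) = sg b := by
      intro b
      cases b <;> simp
    have hk := key (D 0) (D 1) (D 2) (M 0) (M 1) (M 2) (N 0) (N 1) (N 2)
      (by rwa [eta, eta]) (by rwa [eta, eta]) (by rwa [eta, eta])
    have hk' := (Int.cast_ne_zero (α := ℝ)).2 hk
    push_cast only [hz, Int.cast_add, Int.cast_sub, Int.cast_mul] at hk'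
    apply hk'
    apply mul_left_cancel₀ hα
    have h0 := h 0
    have h1 := h 1
    have h2 := h 2
    linear_combination (sg (M 1) * sg (N 2) - sg (M 2) * sg (N 1)) * h0 -
      (sg (M 0) * sg (N 2) - sg (M 2) * sg (N 0)) * h1 +
      (sg (M 0) * sg (N 1) - sg (M 1) * sg (N 0)) * h2

lemma Dir.not_parallel_of_flip {D M : Dir} (h : D.Flip M) : ¬ D.Parallel M := by
  obtain ⟨j, hj⟩ := h
  rintro (rfl | rfl)
  · exact ((hj j).1 rfl) rfl
  · obtain ⟨i, hi⟩ := exists_ne j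
    have := (hj i).2 hi
    simp [Dir.opp] at this

/-- Coordinates of the vertex with parameter `k`. -/
def site (k : ℝ) : Fin 3 → ℝ := ![0, k, 2 * k]

/-- Lines in diagonal directions through distinct vertices never meet. -/
lemma site_skew {k k' : ℝ} (hk : k ≠ k') (D N : Dir) (α β : ℝ) :
    ¬ ∀ i, site k i + α * sg (D i) = site k' i + β * sg (N i) := by
  intro h
  apply hk
  have h0 := h 0
  have h1 := h 1
  have h2 := h 2
  simp only [site, Matrix.cons_val_zero, Matrix.cons_val_one, Matrix.cons_val] at h0 h1 h2
  rcases sg_eq (D 0) with a0 | a0 <;> rcases sg_eq (D 1) with a1 | a1 <;>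
  rcases sg_eq (D 2) with a2 | a2 <;> rcases sg_eq (N 0) with b0 | b0 <;>
  rcases sg_eq (N 1) with b1 | b1 <;> rcases sg_eq (N 2) with b2 | b2 <;>
  rw [a0, b0] at h0 <;> rw [a1, b1] at h1 <;> rw [a2, b2] at h2 <;> linarith

/-- The direction of a port, given by its colour and whether it points up. -/
def portDir (c b : Bool) : Dir := ![!c, xor c b, b]

/-- The second segment of an edge, seen from an endpoint with port `(c, b)`, when the other
endpoint has port `(c, b')`; `low` tells whether this endpoint is the lower one. -/
def midDir : (c b b' low : Bool) → Dir
  | false, true, true, true => ![false, true, true]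
  | false, true, true, false => ![true, true, false]
  | true, true, true, true => ![false, true, true]
  | true, true, true, false => ![false, false, false]
  | false, false, false, true => ![true, false, true]
  | false, false, false, false => ![false, false, false]
  | true, false, false, true => ![false, true, true]
  | true, false, false, false => ![false, false, false]
  | false, true, false, _ => ![true, false, true]
  | false, false, true, _ => ![true, true, false]
  | true, true, false, _ => ![false, true, true]
  | true, false, true, _ => ![false, false, false]

/-- The length of the first segment of an edge seen from an endpoint, for vertices at
distance `k`, depending on a free parameter `x`. -/
def armLen : (c b b' low : Bool) → (k x : ℝ) → ℝ
  | false, true, true, true, k, x => k + x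
  | false, true, true, false, _, x => x
  | true, true, true, true, k, x => k / 2 + x
  | true, true, true, false, _, x => x
  | false, false, false, true, _, x => x
  | false, false, false, false, k, x => k + x
  | true, false, false, true, _, x => x
  | true, false, false, false, k, x => k / 2 + x
  | false, true, false, _, k, x => k / 2 + x
  | false, false, true, _, k, x => k - x
  | true, true, false, _, _, x => x
  | true, false, true, _, k, x => k / 2 - x

/-- The length of the second segment of an edge seen from an endpoint. -/
def midLen : (c b b' low : Bool) → (k x : ℝ) → ℝ
  | false, true, true, true, k, _ => k / 2
  | false, true, true, false, k, _ => k / 2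
  | true, true, true, true, k, _ => k / 2
  | true, true, true, false, k, _ => k
  | false, false, false, true, k, _ => k / 2
  | false, false, false, false, k, _ => k / 2
  | true, false, false, true, k, _ => k
  | true, false, false, false, k, _ => k / 2
  | false, true, false, _, k, x => k / 2 - x
  | false, false, true, _, _, x => x
  | true, true, false, _, k, x => k - x
  | true, false, true, _, k, x => k / 2 + x

lemma flip_midDir : ∀ c b b' low, (portDir c b).Flip (midDir c b b' low) := by decide

lemma flip_midDir_opp : ∀ c b b' low, (if low then b = false → b' = false
    else b' = false → b = false) →
    (midDir c b b' low).Flip (midDir c b' b (!low)).opp := by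
  decide

lemma portDir_injective : ∀ c b c' b', portDir c b = portDir c' b' → (c, b) = (c', b') := by
  decide

lemma portDir_not_parallel : ∀ c b c' b',
    (portDir c b).Parallel (portDir c' b') → portDir c b = portDir c' b' := by
  decide

lemma not_flip_portDir : ∀ c b c' b', ¬ (portDir c b).Flip (portDir c' b') := by decide

lemma armLen_pos (c b b' low : Bool) {k x : ℝ} (hk : 1 ≤ k) (h0 : 0 < x) (h1 : x < 1 / 2) :
    0 < armLen c b b' low k x := by
  cases c <;> cases b <;> cases b' <;> cases low <;> simp only [armLen] <;> linarith

lemma midLen_pos (c b b' low : Bool) {k x : ℝ} (hk : 1 ≤ k) (h0 : 0 < x) (h1 : x < 1 / 2) :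
    0 < midLen c b b' low k x := by
  cases c <;> cases b <;> cases b' <;> cases low <;> simp only [midLen] <;> linarith

lemma armLen_injective (c b b' low : Bool) (k : ℝ) :
    Function.Injective (armLen c b b' low k) := by
  intro x y h
  cases c <;> cases b <;> cases b' <;> cases low <;> simp only [armLen] at h <;> linarith

/-- The two halves of an edge meet. -/
lemma halves_meet (c b b' : Bool) (hb : b = false → b' = false) (k₁ k₂ x : ℝ) (i : Fin 3) :
    site k₁ i + armLen c b b' true (k₂ - k₁) x * sg (portDir c b i) +
        midLen c b b' true (k₂ - k₁) x * sg (midDir c b b' true i) =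
      site k₂ i + armLen c b' b false (k₂ - k₁) x * sg (portDir c b' i) +
        midLen c b' b false (k₂ - k₁) x * sg (midDir c b' b false i) := by
  cases c <;> cases b <;> cases b' <;> simp at hb <;> fin_cases i <;>
    simp [site, armLen, midLen, portDir, midDir] <;> ring

/-- Some linear functional increases along an edge. -/
lemma exists_monotone_functional (c b b' : Bool) (hb : b = false → b' = false) :
    ∃ f : Fin 3 → ℝ, 0 ≤ ∑ i, f i * sg (portDir c b i) ∧
      0 < ∑ i, f i * sg (midDir c b b' true i) ∧
      ∑ i, f i * sg (midDir c b' b false i) < 0 ∧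
      ∑ i, f i * sg (portDir c b' i) ≤ 0 := by
  cases c <;> cases b <;> cases b' <;> simp at hb
  · exact ⟨![1, 0, 1], by simp [Fin.sum_univ_three, portDir, midDir]⟩
  · exact ⟨![0, 0, 1], by simp [Fin.sum_univ_three, portDir, midDir]⟩
  · exact ⟨![-1, 0, 1], by simp [Fin.sum_univ_three, portDir, midDir]⟩
  · exact ⟨![0, 1, 1], by simp [Fin.sum_univ_three, portDir, midDir]⟩
  · exact ⟨![0, 0, 1], by simp [Fin.sum_univ_three, portDir, midDir]⟩
  · exact ⟨![0, 1, 1], by simp [Fin.sum_univ_three, portDir, midDir]⟩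

/-- Lower corner of the bounding box for vertex parameters in `[0, K]`. -/
def boxLo (K : ℝ) : Fin 3 → ℝ := ![-(2 * K + 1), -(2 * K + 1), -(2 * K + 1)]

/-- Upper corner of the bounding box for vertex parameters in `[0, K]`. -/
def boxHi (K : ℝ) : Fin 3 → ℝ := ![2 * K + 1, 2 * K + 1, 4 * K + 1]

lemma half_low_mem_box (c b b' : Bool) (hb : b = false → b' = false) {k₁ k₂ x K : ℝ}
    (hk₁ : 0 ≤ k₁) (hk : k₁ ≤ k₂) (hk₂ : k₂ ≤ K) (h0 : 0 < x) (h1 : x < 1 / 2) {m : ℝ}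
    (hm : m = 0 ∨ m = midLen c b b' true (k₂ - k₁) x) (i : Fin 3) :
    site k₁ i + armLen c b b' true (k₂ - k₁) x * sg (portDir c b i) +
        m * sg (midDir c b b' true i) ∈ Set.Icc (boxLo K i) (boxHi K i) := by
  rcases hm with rfl | rfl <;> cases c <;> cases b <;> cases b' <;> simp at hb <;> fin_cases i <;>
    simp [site, armLen, midLen, portDir, midDir, boxLo, boxHi] <;> constructor <;> linarith

lemma half_high_mem_box (c b b' : Bool) (hb : b' = false → b = false) {k₁ k₂ x K : ℝ}
    (hk₁ : 0 ≤ k₁) (hk : k₁ ≤ k₂) (hk₂ : k₂ ≤ K) (h0 : 0 < x) (h1 : x < 1 / 2) {m : ℝ}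
    (hm : m = 0 ∨ m = midLen c b b' false (k₂ - k₁) x) (i : Fin 3) :
    site k₂ i + armLen c b b' false (k₂ - k₁) x * sg (portDir c b i) +
        m * sg (midDir c b b' false i) ∈ Set.Icc (boxLo K i) (boxHi K i) := by
  rcases hm with rfl | rfl <;> cases c <;> cases b <;> cases b' <;> simp at hb <;> fin_cases i <;>
    simp [site, armLen, midLen, portDir, midDir, boxLo, boxHi] <;> constructor <;> linarith

/-- Compatible data for routing the edges of `G`: ordered pairs of adjacent vertices get a first
and a second direction, and lengths of the first and second segment depending on a parameter
in `(0, 1/2)`. -/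
structure RouteSystem {V : Type} (G : SimpleGraph V) where
  height : V → ℝ
  height_injective : Function.Injective height
  dir : V → V → Dir
  mid : V → V → Dir
  arm : V → V → ℝ → ℝ
  len : V → V → ℝ → ℝ
  isPort : ∀ u v, ∃ c b, dir u v = portDir c b
  dir_ne : ∀ u v v', G.Adj u v → G.Adj u v' → v ≠ v' → dir u v ≠ dir u v'
  dir_flip : ∀ u v, (dir u v).Flip (mid u v)
  arm_injective : ∀ u v, Function.Injective (arm u v)
  arm_pos : ∀ u v x, G.Adj u v → x ∈ Set.Ioo (0 : ℝ) (1 / 2) → 0 < arm u v x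
  len_pos : ∀ u v x, G.Adj u v → x ∈ Set.Ioo (0 : ℝ) (1 / 2) → 0 < len u v x
  meet : ∀ u v x, G.Adj u v → ∀ i,
    site (height u) i + arm u v x * sg (dir u v i) + len u v x * sg (mid u v i) =
      site (height v) i + arm v u x * sg (dir v u i) + len v u x * sg (mid v u i)
  mono : ∀ u v, G.Adj u v → ∃ f : Fin 3 → ℝ, 0 ≤ ∑ i, f i * sg (dir u v i) ∧
    0 < ∑ i, f i * sg (mid u v i) ∧ ∑ i, f i * sg (mid v u i) < 0 ∧
    ∑ i, f i * sg (dir v u i) ≤ 0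
  mid_flip : ∀ u v, G.Adj u v → (mid u v).Flip (mid v u).opp
  bound : ℝ
  site_mem_box : ∀ v i, site (height v) i ∈ Set.Icc (boxLo bound i) (boxHi bound i)
  mem_box : ∀ u v x, G.Adj u v → x ∈ Set.Ioo (0 : ℝ) (1 / 2) → ∀ m, m = 0 ∨ m = len u v x →
    ∀ i, site (height u) i + arm u v x * sg (dir u v i) + m * sg (mid u v i) ∈
      Set.Icc (boxLo bound i) (boxHi bound i)

namespace RouteSystem

variable {V : Type} {G : SimpleGraph V} (R : RouteSystem G)

lemma not_parallel_dir {u v v' : V} (h : G.Adj u v) (h' : G.Adj u v') (hv : v ≠ v') :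
    ¬ (R.dir u v).Parallel (R.dir u v') := by
  have hne := R.dir_ne u v v' h h' hv
  obtain ⟨c, b, hD⟩ := R.isPort u v
  obtain ⟨c', b', hD'⟩ := R.isPort u v'
  intro hp
  rw [hD, hD'] at hp hne
  exact hne (portDir_not_parallel _ _ _ _ hp)

lemma eq_opp_of_parallel {u v u' v' : V} (hp : (R.dir u' v').Parallel (R.mid u v)) :
    R.mid u v = (R.dir u' v').opp := by
  refine hp.resolve_left fun h => ?_
  obtain ⟨c, b, hD⟩ := R.isPort u v
  obtain ⟨c', b', hD'⟩ := R.isPort u' v'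
  have := R.dir_flip u v
  rw [h, hD, hD'] at this
  exact not_flip_portDir _ _ _ _ this

/-- The line carrying the second segment from `u` to `v` avoids all diagonal lines through the
other vertices. -/
def Clear (u v : V) (x : ℝ) : Prop :=
  ∀ w, w ≠ u → ∀ (N : Dir) (a m : ℝ), ¬ ∀ i, site (R.height w) i + a * sg (N i) =
    site (R.height u) i + R.arm u v x * sg (R.dir u v i) + m * sg (R.mid u v i)

/-- The second segment from `u` to `v` and the second segment from `u'` to `v'`, extended to
rays, meet. -/
def Clash (u v u' v' : V) (x y : ℝ) : Prop :=
  ∃ m m' : ℝ, 0 ≤ m ∧ 0 ≤ m' ∧ ∀ i,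
    site (R.height u) i + R.arm u v x * sg (R.dir u v i) + m * sg (R.mid u v i) =
      site (R.height u') i + R.arm u' v' y * sg (R.dir u' v' i) + m' * sg (R.mid u' v' i)

lemma Clash.symm {u v u' v' : V} {x y : ℝ} (h : R.Clash u v u' v' x y) :
    R.Clash u' v' u v y x := by
  obtain ⟨m, m', hm, hm', h⟩ := h
  exact ⟨m', m, hm', hm, fun i => (h i).symm⟩

lemma finite_not_clear [Finite V] (u v : V) : {x | ¬ R.Clear u v x}.Finite := by
  have hsub : {x | ¬ R.Clear u v x} ⊆ ⋃ q : V × Dir, {x | q.1 ≠ u ∧ ∃ a m : ℝ, ∀ i,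
      site (R.height q.1) i + a * sg (q.2 i) =
        site (R.height u) i + R.arm u v x * sg (R.dir u v i) + m * sg (R.mid u v i)} := by
    intro x hx
    simp only [Set.mem_ofPred_eq, Clear] at hx
    push Not at hx
    obtain ⟨w, hw, N, a, m, h⟩ := hx
    exact Set.mem_iUnion.2 ⟨(w, N), hw, a, m, h⟩
  refine Set.Finite.subset (Set.finite_iUnion fun q => Set.Subsingleton.finite ?_) hsub
  rintro x ⟨hw, a, m, h⟩ x' ⟨-, a', m', h'⟩
  by_contra hne
  have harm : R.arm u v x - R.arm u v x' ≠ 0 :=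
    sub_ne_zero.2 fun h => hne (R.arm_injective u v h)
  have hpar := Dir.parallel_of_dependent (D := R.dir u v) (M := R.mid u v) (N := q.2)
    (β := m - m') (γ := a' - a) harm
    (fun i => by linear_combination h' i - h i) (Dir.not_parallel_of_flip (R.dir_flip u v))
  obtain ⟨r, hr⟩ := Dir.exists_sg_of_parallel hpar
  refine site_skew (fun h => hw (R.height_injective h)) (R.dir u v) (R.mid u v)
    (a * r - R.arm u v x) m fun i => ?_
  have := h i
  rw [hr] at this
  linarith

lemma finite_clash {u v u' v' : V} (h : G.Adj u v) (h' : G.Adj u' v')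
    (hne : s(u, v) ≠ s(u', v')) {y : ℝ} (hy : y ∈ Set.Ioo (0 : ℝ) (1 / 2))
    (hclear : R.Clear u' v' y) :
    {x | x ∈ Set.Ioo (0 : ℝ) (1 / 2) ∧ R.Clash u v u' v' x y}.Finite := by
  refine Set.Subsingleton.finite ?_
  rintro x ⟨hx, m, m', hm, hm', he⟩ x₁ ⟨-, m₁, m₁', -, -, he₁⟩
  by_contra hxx
  have harm : R.arm u v x - R.arm u v x₁ ≠ 0 :=
    sub_ne_zero.2 fun h => hxx (R.arm_injective u v h)
  have hpar : (R.dir u v).Parallel (R.mid u' v') :=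
    Dir.parallel_of_dependent (M := R.mid u v) (β := m - m₁) (γ := m₁' - m') harm
      (fun i => by linear_combination he i - he₁ i) (Dir.not_parallel_of_flip (R.dir_flip u v))
  have hM' := R.eq_opp_of_parallel hpar
  have hsg' : ∀ i, sg (R.mid u' v' i) = - sg (R.dir u v i) := by
    intro i
    rw [hM', Dir.opp, sg_not]
  by_cases hu : u = u'
  · subst hu
    have hv : v ≠ v' := by
      rintro rfl
      exact hne rfl
    have hy' := R.arm_pos u v' y h' hy
    have hx' := R.arm_pos u v x h hx
    have hpar' : (R.dir u v').Parallel (R.mid u v) :=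
      Dir.parallel_of_dependent (M := R.mid u v') (β := m' + R.arm u v x) (γ := -m) hy'.ne'
        (fun i => by
          have := he i
          rw [hsg'] at this ⊢
          linarith)
        (Dir.not_parallel_of_flip (R.dir_flip u v'))
    have hM := R.eq_opp_of_parallel hpar'
    have hsg : ∀ i, sg (R.mid u v i) = - sg (R.dir u v' i) := by
      intro i
      rw [hM, Dir.opp, sg_not]
    refine R.not_parallel_dir h h' hv (Dir.parallel_of_smul_eq
      (α := R.arm u v x + m') (β := R.arm u v' y + m) (by positivity) fun i => ?_)
    have := he i
    rw [hsg, hsg'] at this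
    linarith
  · refine hclear u hu (R.mid u v) m (m' + R.arm u v x) fun i => ?_
    have := he i
    rw [hsg'] at this ⊢
    linarith

end RouteSystem

/-- One can choose parameters from infinite sets avoiding pairwise constraints each of which
excludes finitely many values. -/
lemma exists_generic {E : Type} [Finite E] (I : E → Set ℝ) (Bad : E → E → ℝ → ℝ → Prop)
    (hsymm : ∀ e e' x y, Bad e e' x y → Bad e' e y x) (hI : ∀ e, (I e).Infinite)
    (hfin : ∀ e e', e ≠ e' → ∀ y ∈ I e', {x | x ∈ I e ∧ Bad e e' x y}.Finite) :
    ∃ τ : E → ℝ, (∀ e, τ e ∈ I e) ∧ ∀ e e', e ≠ e' → ¬ Bad e e' (τ e) (τ e') := by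
  classical
  have := Fintype.ofFinite E
  suffices H : ∀ S : Finset E, ∃ τ : E → ℝ, (∀ e, τ e ∈ I e) ∧
      ∀ e ∈ S, ∀ e' ∈ S, e ≠ e' → ¬ Bad e e' (τ e) (τ e') by
    obtain ⟨τ, h1, h2⟩ := H Finset.univ
    exact ⟨τ, h1, fun e e' => h2 e (Finset.mem_univ _) e' (Finset.mem_univ _)⟩
  intro S
  induction S using Finset.induction_on with
  | empty =>
    choose τ hτ using fun e => (hI e).nonempty
    exact ⟨τ, hτ, by simp⟩
  | insert a S ha ih =>
    obtain ⟨τ, h1, h2⟩ := ih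
    have hf : (⋃ e ∈ S, {x | x ∈ I a ∧ Bad a e x (τ e)}).Finite :=
      S.finite_toSet.biUnion fun e he => hfin a e (fun h => ha (h ▸ he)) _ (h1 e)
    obtain ⟨x, hxI, hx⟩ := ((hI a).sdiff hf).nonempty
    have hx' : ∀ e ∈ S, ¬ Bad a e x (τ e) := fun e he hb =>
      hx (Set.mem_biUnion he ⟨hxI, hb⟩)
    have hne : ∀ e ∈ S, e ≠ a := fun e he h => ha (h ▸ he)
    refine ⟨Function.update τ a x, ?_, ?_⟩
    · intro e
      by_cases he : e = a
      · subst he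
        simpa using hxI
      · simpa [he] using h1 e
    · intro e he e' he' hee
      rcases Finset.mem_insert.1 he with rfl | heS <;>
        rcases Finset.mem_insert.1 he' with rfl | heS'
      · exact absurd rfl hee
      · simpa [hne e' heS'] using hx' e' heS'
      · intro hb
        simp only [Function.update_self, Function.update_of_ne (hne e heS)] at hb
        exact hx' e heS (hsymm _ _ _ _ hb)
      · simpa [hne e heS, hne e' heS'] using h2 e heS e' heS' hee

namespace RouteSystem

variable {V : Type} {G : SimpleGraph V} (R : RouteSystem G)

/-- Generic parameters exist. -/
lemma exists_parameters [Finite V] : ∃ τ : Sym2 V → ℝ,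
    (∀ e, τ e ∈ Set.Ioo (0 : ℝ) (1 / 2)) ∧
    (∀ u v, G.Adj u v → R.Clear u v (τ s(u, v))) ∧
    ∀ u v u' v', G.Adj u v → G.Adj u' v' → s(u, v) ≠ s(u', v') →
      ¬ R.Clash u v u' v' (τ s(u, v)) (τ s(u', v')) := by
  obtain ⟨τ, hτ, hτ'⟩ := exists_generic
    (fun e => Set.Ioo (0 : ℝ) (1 / 2) \ ⋃ q : V × V, {x | ¬ R.Clear q.1 q.2 x})
    (fun e e' x y => ∃ u v u' v', G.Adj u v ∧ G.Adj u' v' ∧ s(u, v) = e ∧ s(u', v') = e' ∧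
      R.Clash u v u' v' x y)
    (by
      rintro e e' x y ⟨u, v, u', v', h, h', he, he', hc⟩
      exact ⟨u', v', u, v, h', h, he', he, hc.symm⟩)
    (fun e => (Set.Ioo_infinite (by norm_num)).sdiff
      (Set.finite_iUnion fun q => R.finite_not_clear q.1 q.2))
    (by
      intro e e' hee y hy
      have hcl : ∀ u v, R.Clear u v y := by
        intro u v
        by_contra hc
        exact hy.2 (Set.mem_iUnion.2 ⟨(u, v), hc⟩)
      have hfin : ∀ q : (V × V) × (V × V), {x | x ∈ Set.Ioo (0 : ℝ) (1 / 2) ∧ G.Adj q.1.1 q.1.2 ∧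
          G.Adj q.2.1 q.2.2 ∧ s(q.1.1, q.1.2) ≠ s(q.2.1, q.2.2) ∧
          R.Clash q.1.1 q.1.2 q.2.1 q.2.2 x y}.Finite := by
        intro q
        by_cases hq : G.Adj q.1.1 q.1.2 ∧ G.Adj q.2.1 q.2.2 ∧
            s(q.1.1, q.1.2) ≠ s(q.2.1, q.2.2)
        · refine (R.finite_clash hq.1 hq.2.1 hq.2.2 hy.1 (hcl _ _)).subset ?_
          rintro x ⟨h1, -, -, -, h2⟩
          exact ⟨h1, h2⟩
        · convert Set.finite_empty
          ext x
          simp only [Set.mem_ofPred_eq, Set.mem_empty_iff_false, iff_false]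
          tauto
      refine (Set.finite_iUnion hfin).subset ?_
      rintro x ⟨hx, u, v, u', v', h, h', he, he', hc⟩
      exact Set.mem_iUnion.2 ⟨((u, v), (u', v')), hx.1, h, h', by rwa [he, he'], hc⟩)
  refine ⟨τ, fun e => (hτ e).1, ?_, ?_⟩
  · intro u v _
    by_contra hc
    exact (hτ s(u, v)).2 (Set.mem_iUnion.2 ⟨(u, v), hc⟩)
  · intro u v u' v' h h' hne hc
    exact hτ' _ _ hne ⟨u, v, u', v', h, h', rfl, rfl, hc⟩

end RouteSystem

/-- A direction as a vector. -/
def dvec (D : Dir) : Pt := WithLp.toLp 2 fun i => sg (D i)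

/-- The position of the vertex with parameter `k`. -/
def sitePt (k : ℝ) : Pt := WithLp.toLp 2 (site k)

@[simp] lemma dvec_apply (D : Dir) (i : Fin 3) : dvec D i = sg (D i) := rfl

@[simp] lemma sitePt_apply (k : ℝ) (i : Fin 3) : sitePt k i = site k i := rfl

lemma dvec_opp (D : Dir) : dvec D.opp = -dvec D := by
  ext i
  simp [Dir.opp]

lemma inner_dvec (D N : Dir) : inner ℝ (dvec D) (dvec N) = ∑ i, sg (D i) * sg (N i) := by
  simp [dvec, PiLp.inner_apply, mul_comm]

lemma norm_dvec_mul_norm_dvec (D N : Dir) : ‖dvec D‖ * ‖dvec N‖ = 3 := by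
  have h : ∀ D : Dir, ‖dvec D‖ = √3 := by
    intro D
    have hsq : ∀ i, sg (D i) ^ 2 = 1 := by
      intro i
      rcases sg_eq (D i) with h | h <;> simp [h]
    rw [EuclideanSpace.norm_eq]
    simp [hsq]
  rw [h, h, Real.mul_self_sqrt (by norm_num)]

lemma dvec_ne_zero (D : Dir) : dvec D ≠ 0 := by
  intro h
  have := norm_dvec_mul_norm_dvec D D
  simp [h] at this

/-- Directions with scalar product at most `-1` form an angle of at least `arccos (-1/3)`. -/
lemma arccos_le_angle {D N : Dir} (h : ∑ i, sg (D i) * sg (N i) ≤ -1) {s t : ℝ} (hs : 0 < s)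
    (ht : 0 < t) : Real.arccos (-(1 / 3)) ≤ angle (s • dvec D) (t • dvec N) := by
  rw [angle_smul_left_of_pos _ _ hs, angle_smul_right_of_pos _ _ ht, angle,
    norm_dvec_mul_norm_dvec, inner_dvec]
  apply Real.arccos_le_arccos
  linarith

lemma Dir.Flip.sum_opp {D M : Dir} (h : D.Flip M) : ∑ i, sg (D.opp i) * sg (M i) ≤ -1 := by
  obtain ⟨j, hj⟩ := h
  have key : ∀ i, sg (D.opp i) * sg (M i) = if i = j then 1 else -1 := by
    intro i
    by_cases hi : i = j
    · have : M i = !D i := Bool.eq_not.2 fun h => (hj i).1 h hi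
      rw [this, if_pos hi]
      cases h : D i <;> simp [Dir.opp, h]
    · rw [(hj i).2 hi, if_neg hi]
      cases h : D i <;> simp [Dir.opp, h]
  simp only [key, Fin.sum_univ_three]
  fin_cases j <;> simp

lemma sum_portDir : ∀ c b c' b', portDir c b ≠ portDir c' b' →
    ∑ i, sg (portDir c b i) * sg (portDir c' b' i) ≤ -1 := by
  intro c b c' b' h
  cases c <;> cases b <;> cases c' <;> cases b' <;>
    first
    | exact absurd rfl h
    | simp [Fin.sum_univ_three, portDir]

lemma exists_of_mem_segment {a d z : Pt} {t : ℝ} (ht : 0 ≤ t) (hz : z ∈ segment ℝ a (a + t • d)) :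
    ∃ s : ℝ, 0 ≤ s ∧ z = a + s • d := by
  rw [segment_eq_image'] at hz
  obtain ⟨θ, hθ, rfl⟩ := hz
  exact ⟨θ * t, mul_nonneg hθ.1 ht, by simp [smul_smul]⟩

section Polyline

variable (F : Pt →ₗ[ℝ] ℝ)

lemma map_mem_Icc_of_mem_segment {x y z : Pt} (hz : z ∈ segment ℝ x y) (h : F x ≤ F y) :
    F x ≤ F z ∧ F z ≤ F y := by
  rw [segment_eq_image'] at hz
  obtain ⟨θ, hθ, rfl⟩ := hz
  simp only [map_add, map_smul, map_sub, smul_eq_mul]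
  constructor <;> nlinarith [hθ.1, hθ.2]

lemma eq_left_of_mem_segment {x y z : Pt} (hz : z ∈ segment ℝ x y) (h : F x < F y)
    (hzx : F z ≤ F x) : z = x := by
  rw [segment_eq_image'] at hz
  obtain ⟨θ, hθ, rfl⟩ := hz
  simp only [map_add, map_smul, map_sub, smul_eq_mul] at hzx
  have : θ = 0 := by nlinarith [hθ.1, hθ.2]
  simp [this]

lemma eq_right_of_mem_segment {x y z : Pt} (hz : z ∈ segment ℝ x y) (h : F x < F y)
    (hzy : F y ≤ F z) : z = y := by
  rw [segment_eq_image'] at hz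
  obtain ⟨θ, hθ, rfl⟩ := hz
  simp only [map_add, map_smul, map_sub, smul_eq_mul] at hzy
  have : θ = 1 := by nlinarith [hθ.1, hθ.2]
  simp [this]

/-- A four-segment polyline along which a linear functional increases, strictly so on the two
middle segments, is simple. -/
lemma simplePolyline_of_monotone {a b c d e : Pt} (hab : a ≠ b) (hde : d ≠ e)
    (h₁ : F a ≤ F b) (h₂ : F b < F c) (h₃ : F c < F d) (h₄ : F d ≤ F e) :
    SimplePolyline [a, b, c, d, e] := by
  have hbc : b ≠ c := fun h => h₂.ne (h ▸ rfl)
  have hcd : c ≠ d := fun h => h₃.ne (h ▸ rfl)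
  refine ⟨show List.IsChain _ _ by simp [hab, hbc, hcd, hde], ?_⟩
  have e01 : segment ℝ a b ∩ segment ℝ b c = {b} := by
    refine Set.Subset.antisymm ?_ (Set.singleton_subset_iff.2
      ⟨right_mem_segment ℝ a b, left_mem_segment ℝ b c⟩)
    rintro z ⟨hz, hz'⟩
    exact eq_left_of_mem_segment F hz' h₂ (map_mem_Icc_of_mem_segment F hz h₁).2
  have e12 : segment ℝ b c ∩ segment ℝ c d = {c} := by
    refine Set.Subset.antisymm ?_ (Set.singleton_subset_iff.2
      ⟨right_mem_segment ℝ b c, left_mem_segment ℝ c d⟩)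
    rintro z ⟨hz, hz'⟩
    exact eq_left_of_mem_segment F hz' h₃ (map_mem_Icc_of_mem_segment F hz h₂.le).2
  have e23 : segment ℝ c d ∩ segment ℝ d e = {d} := by
    refine Set.Subset.antisymm ?_ (Set.singleton_subset_iff.2
      ⟨right_mem_segment ℝ c d, left_mem_segment ℝ d e⟩)
    rintro z ⟨hz, hz'⟩
    exact eq_right_of_mem_segment F hz h₃ (map_mem_Icc_of_mem_segment F hz' h₄).1
  have disj : ∀ x y x' y' : Pt, F x ≤ F y → F y < F x' → F x' ≤ F y' →
      segment ℝ x y ∩ segment ℝ x' y' = ∅ := by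
    intro x y x' y' h h' h''
    refine Set.eq_empty_iff_forall_notMem.2 ?_
    rintro z ⟨hz, hz'⟩
    have h5 := (map_mem_Icc_of_mem_segment F hz h).2
    have h6 := (map_mem_Icc_of_mem_segment F hz' h'').1
    linarith
  have e02 := disj a b c d h₁ h₂ h₃.le
  have e03 := disj a b d e h₁ (h₂.trans h₃) h₄
  have e13 := disj b c d e h₂.le h₃ h₄
  intro i j hi hj hij
  simp only [List.length_cons, List.length_nil] at hi hj
  have hi' : i < 3 := by omega
  have hj' : j < 4 := by omega
  interval_cases i <;> interval_cases j <;> first | omega | simpa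

lemma polyImage_five (a b c d e : Pt) : polyImage [a, b, c, d, e] =
    (segment ℝ a b ∪ segment ℝ b c) ∪ (segment ℝ e d ∪ segment ℝ d c) := by
  rw [segment_symm ℝ e d, segment_symm ℝ d c]
  ext z
  simp [polyImage]
  tauto

end Polyline

lemma pair_infix_five {a b p₀ p₁ p₂ p₃ p₄ : Pt} (h : [a, b] <:+: [p₀, p₁, p₂, p₃, p₄]) :
    (a = p₀ ∧ b = p₁) ∨ (a = p₁ ∧ b = p₂) ∨ (a = p₂ ∧ b = p₃) ∨ (a = p₃ ∧ b = p₄) := by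
  obtain ⟨s, t, h⟩ := h
  rcases s with _ | ⟨s₀, _ | ⟨s₁, _ | ⟨s₂, _ | ⟨s₃, s⟩⟩⟩⟩
  · simp at h; tauto
  · simp at h; tauto
  · simp at h; tauto
  · simp at h; tauto
  · have := congrArg List.length h
    simp at this
    omega

lemma triple_infix_five {a q b p₀ p₁ p₂ p₃ p₄ : Pt}
    (h : [a, q, b] <:+: [p₀, p₁, p₂, p₃, p₄]) :
    (a = p₀ ∧ q = p₁ ∧ b = p₂) ∨ (a = p₁ ∧ q = p₂ ∧ b = p₃) ∨
      (a = p₂ ∧ q = p₃ ∧ b = p₄) := by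
  obtain ⟨s, t, h⟩ := h
  rcases s with _ | ⟨s₀, _ | ⟨s₁, _ | ⟨s₂, s⟩⟩⟩
  · simp at h; tauto
  · simp at h; tauto
  · simp at h; tauto
  · have := congrArg List.length h
    simp at this
    omega

namespace RouteSystem

variable {V : Type} {G : SimpleGraph V} (R : RouteSystem G) (τ : Sym2 V → ℝ)

/-- The position of a vertex. -/
def vertex (v : V) : Pt := sitePt (R.height v)

/-- The bend next to `u` on the edge `uv`. -/
def bend (u v : V) : Pt := R.vertex u + R.arm u v (τ s(u, v)) • dvec (R.dir u v)

/-- The middle bend of the edge `uv`. -/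
def middle (u v : V) : Pt := R.bend τ u v + R.len u v (τ s(u, v)) • dvec (R.mid u v)

/-- The part of the edge `uv` between `u` and the middle bend. -/
def half (u v : V) : Set Pt :=
  segment ℝ (R.vertex u) (R.bend τ u v) ∪ segment ℝ (R.bend τ u v) (R.middle τ u v)

lemma middle_symm {u v : V} (h : G.Adj u v) : R.middle τ u v = R.middle τ v u := by
  ext i
  have := R.meet u v (τ s(u, v)) h i
  simpa [middle, bend, vertex, Sym2.eq_swap (a := v) (b := u)] using this

lemma vertex_injective : Function.Injective R.vertex := by
  intro u v h
  have := congrArg (fun p : Pt => p 1) h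
  simp only [vertex, sitePt_apply, site, Matrix.cons_val_one, Matrix.cons_val_zero] at this
  exact R.height_injective this

/-- The drawing determined by a choice of parameters. -/
def drawing : PolylineDrawing G where
  p := R.vertex
  p_inj := R.vertex_injective
  seq u v _ := [R.vertex u, R.bend τ u v, R.middle τ u v, R.bend τ v u, R.vertex v]
  seq_head _ _ _ := rfl
  seq_last _ _ _ := rfl
  seq_symm u v h := by simp [R.middle_symm τ h]

lemma polyImage_seq {u v : V} (h : G.Adj u v) :
    polyImage ((R.drawing τ).seq u v h) = R.half τ u v ∪ R.half τ v u := by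
  simp only [drawing]
  rw [polyImage_five, half, half, R.middle_symm τ h]

lemma vertex_mem_half (u v : V) : R.vertex u ∈ R.half τ u v :=
  Or.inl (left_mem_segment ℝ _ _)

variable {τ}

lemma cases_of_mem_half (hτ : ∀ e, τ e ∈ Set.Ioo (0 : ℝ) (1 / 2)) {u v : V} (h : G.Adj u v)
    {z : Pt} (hz : z ∈ R.half τ u v) :
    (∃ a : ℝ, ∀ i, z i = site (R.height u) i + a * sg (R.dir u v i)) ∨
    (∃ m : ℝ, 0 ≤ m ∧ ∀ i, z i = site (R.height u) i +
      R.arm u v (τ s(u, v)) * sg (R.dir u v i) + m * sg (R.mid u v i)) := by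
  rcases hz with hz | hz
  · obtain ⟨a, -, rfl⟩ := exists_of_mem_segment (R.arm_pos u v _ h (hτ _)).le hz
    exact Or.inl ⟨a, fun i => by simp [vertex]⟩
  · obtain ⟨m, hm, rfl⟩ := exists_of_mem_segment (R.len_pos u v _ h (hτ _)).le hz
    exact Or.inr ⟨m, hm, fun i => by simp [vertex, bend]⟩

lemma eq_of_vertex_mem_half (hτ : ∀ e, τ e ∈ Set.Ioo (0 : ℝ) (1 / 2)) {u v w : V}
    (h : G.Adj u v) (hc : R.Clear u v (τ s(u, v))) (hw : R.vertex w ∈ R.half τ u v) :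
    w = u := by
  by_contra hne
  rcases R.cases_of_mem_half hτ h hw with ⟨a, ha⟩ | ⟨m, -, hm⟩
  · refine site_skew (fun h => hne (R.height_injective h)) (R.dir u v) (R.dir u v) 0 a
      fun i => ?_
    simpa [vertex] using ha i
  · refine hc w hne (R.dir u v) 0 m fun i => ?_
    simpa [vertex] using hm i

/-- A first segment and the second segment of another edge do not meet. -/
lemma arm_disjoint_mid (hτ : ∀ e, τ e ∈ Set.Ioo (0 : ℝ) (1 / 2)) {u v u' v' : V}
    (h : G.Adj u v) (h' : G.Adj u' v') (hne : s(u, v) ≠ s(u', v'))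
    (hc : R.Clear u' v' (τ s(u', v'))) {z : Pt} {a m : ℝ}
    (ha : ∀ i, z i = site (R.height u) i + a * sg (R.dir u v i))
    (hm : ∀ i, z i = site (R.height u') i +
      R.arm u' v' (τ s(u', v')) * sg (R.dir u' v' i) + m * sg (R.mid u' v' i)) : False := by
  by_cases hu : u = u'
  · subst hu
    have hv : v' ≠ v := by
      rintro rfl
      exact hne rfl
    refine R.not_parallel_dir h' h hv (Dir.parallel_of_dependent
      (M := R.mid u v') (α := R.arm u v' (τ s(u, v'))) (β := m) (γ := -a)
      (R.arm_pos u v' _ h' (hτ _)).ne' (fun i => ?_)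
      (Dir.not_parallel_of_flip (R.dir_flip u v')))
    linarith [ha i, hm i]
  · exact hc u hu (R.dir u v) a m fun i => by rw [← ha i, hm i]

lemma eq_of_mem_half_of_mem_half (hτ : ∀ e, τ e ∈ Set.Ioo (0 : ℝ) (1 / 2)) {u v u' v' : V}
    (h : G.Adj u v) (h' : G.Adj u' v') (hne : s(u, v) ≠ s(u', v'))
    (hc : R.Clear u v (τ s(u, v))) (hc' : R.Clear u' v' (τ s(u', v')))
    (hcl : ¬ R.Clash u v u' v' (τ s(u, v)) (τ s(u', v'))) {z : Pt}
    (hz : z ∈ R.half τ u v) (hz' : z ∈ R.half τ u' v') : u = u' ∧ z = R.vertex u := by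
  rcases R.cases_of_mem_half hτ h hz with ⟨a, ha⟩ | ⟨m, hm, hm'⟩ <;>
    rcases R.cases_of_mem_half hτ h' hz' with ⟨a', ha'⟩ | ⟨n, hn, hn'⟩
  · have hu : u = u' := by
      by_contra hu
      exact site_skew (fun h => hu (R.height_injective h)) (R.dir u v) (R.dir u' v') a a'
        fun i => by rw [← ha i, ha' i]
    subst hu
    refine ⟨rfl, ?_⟩
    have hv : v ≠ v' := by
      rintro rfl
      exact hne rfl
    have h0 : a = 0 := by
      by_contra h0
      exact R.not_parallel_dir h h' hv (Dir.parallel_of_smul_eq (β := a') h0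
        fun i => by linarith [ha i, ha' i])
    ext i
    rw [ha i, h0]
    simp [vertex]
  · exact (R.arm_disjoint_mid hτ h h' hne hc' ha hn').elim
  · exact (R.arm_disjoint_mid hτ h' h hne.symm hc ha' hm').elim
  · exact (hcl ⟨m, n, hm, hn, fun i => by rw [← hm' i, hn' i]⟩).elim

lemma bend_sub_vertex (u v : V) :
    R.bend τ u v - R.vertex u = R.arm u v (τ s(u, v)) • dvec (R.dir u v) := by
  simp [bend]

lemma middle_sub_bend (u v : V) :
    R.middle τ u v - R.bend τ u v = R.len u v (τ s(u, v)) • dvec (R.mid u v) := by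
  simp [middle]

lemma vertex_sub_bend (u v : V) :
    R.vertex u - R.bend τ u v = R.arm u v (τ s(u, v)) • dvec (R.dir u v).opp := by
  simp [bend, dvec_opp]

lemma bend_sub_middle (u v : V) :
    R.bend τ u v - R.middle τ u v = R.len u v (τ s(u, v)) • dvec (R.mid u v).opp := by
  simp [middle, dvec_opp]

lemma simplePolyline_seq (hτ : ∀ e, τ e ∈ Set.Ioo (0 : ℝ) (1 / 2)) {u v : V} (h : G.Adj u v) :
    SimplePolyline ((R.drawing τ).seq u v h) := by
  obtain ⟨f, h1, h2, h3, h4⟩ := R.mono u v h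
  let F : Pt →ₗ[ℝ] ℝ := (innerSL ℝ (WithLp.toLp 2 f : Pt)).toLinearMap
  have hF : ∀ D, F (dvec D) = ∑ i, f i * sg (D i) := by
    intro D
    simp [F, dvec, PiLp.inner_apply, mul_comm]
  have hsub : ∀ {x y : Pt} {t : ℝ} {D : Dir}, x - y = t • dvec D →
      F x = F y + t * ∑ i, f i * sg (D i) := by
    intro x y t D hxy
    rw [← hF, ← smul_eq_mul, ← map_smul, ← hxy, map_sub]
    ring
  have hne : ∀ {x y : Pt} {t : ℝ} {D : Dir}, x - y = t • dvec D → 0 < t → x ≠ y := by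
    rintro x y t D hxy ht rfl
    rw [sub_self] at hxy
    exact (smul_ne_zero ht.ne' (dvec_ne_zero D)) hxy.symm
  have a1 := R.arm_pos u v _ h (hτ s(u, v))
  have a2 := R.arm_pos v u _ h.symm (hτ s(v, u))
  have l1 := R.len_pos u v _ h (hτ s(u, v))
  have l2 := R.len_pos v u _ h.symm (hτ s(v, u))
  refine simplePolyline_of_monotone F (hne (R.bend_sub_vertex u v) a1).symm
    (hne (R.bend_sub_vertex v u) a2) ?_ ?_ ?_ ?_
  · rw [hsub (R.bend_sub_vertex u v)]
    nlinarith
  · rw [hsub (R.middle_sub_bend u v)]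
    nlinarith
  · rw [R.middle_symm τ h, hsub (R.middle_sub_bend v u)]
    nlinarith
  · rw [hsub (R.bend_sub_vertex v u)]
    nlinarith

lemma nonCrossing_drawing (hτ : ∀ e, τ e ∈ Set.Ioo (0 : ℝ) (1 / 2))
    (hc : ∀ u v, G.Adj u v → R.Clear u v (τ s(u, v)))
    (hcl : ∀ u v u' v', G.Adj u v → G.Adj u' v' → s(u, v) ≠ s(u', v') →
      ¬ R.Clash u v u' v' (τ s(u, v)) (τ s(u', v'))) : NonCrossing (R.drawing τ) := by
  refine ⟨fun u v h => R.simplePolyline_seq hτ h, ?_, ?_⟩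
  · intro u v h
    rw [polyImage_seq]
    ext z
    constructor
    · rintro ⟨hz, w, rfl⟩
      rcases hz with hz | hz
      · exact Or.inl (congrArg _ (R.eq_of_vertex_mem_half hτ h (hc u v h) hz))
      · exact Or.inr (congrArg _ (R.eq_of_vertex_mem_half hτ h.symm (hc v u h.symm) hz))
    · rintro (rfl | rfl)
      · exact ⟨Or.inl (R.vertex_mem_half τ u v), u, rfl⟩
      · exact ⟨Or.inr (R.vertex_mem_half τ v u), v, rfl⟩
  · intro u v u' v' h h' hne
    rw [polyImage_seq, polyImage_seq]
    have key : ∀ {a b a' b' : V}, G.Adj a b → G.Adj a' b' → s(a, b) ≠ s(a', b') → ∀ z,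
        z ∈ R.half τ a b → z ∈ R.half τ a' b' → a = a' ∧ z = R.vertex a :=
      fun g g' gne z hz hz' => R.eq_of_mem_half_of_mem_half hτ g g' gne (hc _ _ g) (hc _ _ g')
        (hcl _ _ _ _ g g' gne) hz hz'
    ext z
    constructor
    · rintro ⟨hz | hz, hz' | hz'⟩
      · obtain ⟨e, rfl⟩ := key h h' hne z hz hz'
        exact ⟨u, by simp [e], rfl⟩
      · obtain ⟨e, rfl⟩ := key h h'.symm (by rwa [Sym2.eq_swap (a := v')]) z hz hz'
        exact ⟨u, by simp [e], rfl⟩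
      · obtain ⟨e, rfl⟩ := key h.symm h' (by rwa [Sym2.eq_swap (a := v)]) z hz hz'
        exact ⟨v, by simp [e], rfl⟩
      · obtain ⟨e, rfl⟩ := key h.symm h'.symm
          (by rwa [Sym2.eq_swap (a := v), Sym2.eq_swap (a := v')]) z hz hz'
        exact ⟨v, by simp [e], rfl⟩
    · have hmem : ∀ a b w : V, w ∈ ({a, b} : Set V) →
          R.vertex w ∈ R.half τ a b ∪ R.half τ b a := by
        rintro a b w (rfl | rfl)
        · exact Or.inl (R.vertex_mem_half τ _ _)
        · exact Or.inr (R.vertex_mem_half τ _ _)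
      rintro ⟨w, ⟨h1, h2⟩, rfl⟩
      exact ⟨hmem _ _ _ h1, hmem _ _ _ h2⟩

lemma angularResAtLeast_drawing (hτ : ∀ e, τ e ∈ Set.Ioo (0 : ℝ) (1 / 2)) :
    AngularResAtLeast (R.drawing τ) (Real.arccos (-(1 / 3))) := by
  constructor
  · intro u v h a q b hi
    have a1 := R.arm_pos u v _ h (hτ s(u, v))
    have a2 := R.arm_pos v u _ h.symm (hτ s(v, u))
    have l1 := R.len_pos u v _ h (hτ s(u, v))
    have l2 := R.len_pos v u _ h.symm (hτ s(v, u))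
    rcases triple_infix_five hi with ⟨rfl, rfl, rfl⟩ | ⟨rfl, rfl, rfl⟩ | ⟨rfl, rfl, rfl⟩
    · rw [vertex_sub_bend, middle_sub_bend]
      exact arccos_le_angle (R.dir_flip u v).sum_opp a1 l1
    · rw [bend_sub_middle, R.middle_symm τ h, bend_sub_middle]
      exact arccos_le_angle (R.mid_flip u v h).sum_opp l1 l2
    · rw [R.middle_symm τ h, angle_comm, vertex_sub_bend, middle_sub_bend]
      exact arccos_le_angle (R.dir_flip v u).sum_opp a2 l2
  · intro v u w hu hw huw a b ha hb
    simp only [drawing, List.getElem?_cons_succ, List.getElem?_cons_zero,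
      Option.some.injEq] at ha hb
    subst ha hb
    obtain ⟨c, i, hD⟩ := R.isPort v u
    obtain ⟨c', i', hD'⟩ := R.isPort v w
    have hne := R.dir_ne v u w hu hw huw
    change _ ≤ angle (_ - R.vertex v) (_ - R.vertex v)
    rw [bend_sub_vertex, bend_sub_vertex]
    refine arccos_le_angle ?_ (R.arm_pos _ _ _ hu (hτ _)) (R.arm_pos _ _ _ hw (hτ _))
    rw [hD, hD'] at hne ⊢
    exact sum_portDir _ _ _ _ hne

/-- The box containing the drawing. -/
def box : Set Pt := {z | ∀ i, z i ∈ Set.Icc (boxLo R.bound i) (boxHi R.bound i)}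

lemma convex_box : Convex ℝ R.box := by
  intro x hx y hy a b ha hb hab i
  have := convex_Icc (boxLo R.bound i) (boxHi R.bound i) (hx i) (hy i) ha hb hab
  simpa using this

lemma drawingImage_subset_box (hτ : ∀ e, τ e ∈ Set.Ioo (0 : ℝ) (1 / 2)) :
    drawingImage (R.drawing τ) ⊆ R.box := by
  have hv : ∀ v, R.vertex v ∈ R.box := fun v i => R.site_mem_box v i
  have hb : ∀ u v, G.Adj u v → R.bend τ u v ∈ R.box := by
    intro u v h i
    simpa [bend, vertex] using R.mem_box u v _ h (hτ s(u, v)) 0 (Or.inl rfl) i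
  have hm : ∀ u v, G.Adj u v → R.middle τ u v ∈ R.box := by
    intro u v h i
    simpa [middle, bend, vertex] using R.mem_box u v _ h (hτ s(u, v)) _ (Or.inr rfl) i
  have hh : ∀ u v, G.Adj u v → R.half τ u v ⊆ R.box := by
    intro u v h
    exact Set.union_subset (R.convex_box.segment_subset (hv u) (hb u v h))
      (R.convex_box.segment_subset (hb u v h) (hm u v h))
  refine Set.union_subset ?_ ?_
  · rintro _ ⟨v, rfl⟩
    exact hv v
  · refine Set.iUnion_subset fun u => Set.iUnion_subset fun v => Set.iUnion_subset fun h => ?_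
    rw [polyImage_seq]
    exact Set.union_subset (hh u v h) (hh v u h.symm)

lemma segments_diagonal (hτ : ∀ e, τ e ∈ Set.Ioo (0 : ℝ) (1 / 2)) {u v : V} (h : G.Adj u v)
    {a b : Pt} (hab : [a, b] <:+: (R.drawing τ).seq u v h) :
    ∃ c : ℝ, c ≠ 0 ∧ ∃ d : Fin 3 → ℝ, (∀ i, d i = 1 ∨ d i = -1) ∧
      ∀ i : Fin 3, b i - a i = c * d i := by
  have key : ∀ {x y : Pt} {t : ℝ} {D : Dir}, x - y = t • dvec D → 0 < t →
      ∃ c : ℝ, c ≠ 0 ∧ ∃ d : Fin 3 → ℝ, (∀ i, d i = 1 ∨ d i = -1) ∧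
        ∀ i : Fin 3, x i - y i = c * d i := by
    intro x y t D hxy ht
    refine ⟨t, ht.ne', fun i => sg (D i), fun i => sg_eq _, fun i => ?_⟩
    have := congrArg (fun p : Pt => p i) hxy
    simpa using this
  have a1 := R.arm_pos u v _ h (hτ s(u, v))
  have a2 := R.arm_pos v u _ h.symm (hτ s(v, u))
  have l1 := R.len_pos u v _ h (hτ s(u, v))
  have l2 := R.len_pos v u _ h.symm (hτ s(v, u))
  rcases pair_infix_five hab with ⟨rfl, rfl⟩ | ⟨rfl, rfl⟩ | ⟨rfl, rfl⟩ | ⟨rfl, rfl⟩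
  · exact key (R.bend_sub_vertex u v) a1
  · exact key (R.middle_sub_bend u v) l1
  · rw [R.middle_symm τ h]
    exact key (R.bend_sub_middle v u) l2
  · exact key (R.vertex_sub_bend v u) a2

end RouteSystem

/-- Route systems from port assignments, for vertices with distinct integral heights. -/
def RouteSystem.ofPorts {V : Type} [LinearOrder V] {G : SimpleGraph V} (height : V → ℝ)
    (hlt : ∀ u v, u < v → 1 ≤ height v - height u) (K : ℝ)
    (hK : ∀ v, 0 ≤ height v ∧ height v ≤ K) (port : V → V → Bool × Bool)
    (hport : ∀ w v v', G.Adj w v → G.Adj w v' → port w v = port w v' → v = v')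
    (hcol : ∀ u v, G.Adj u v → (port u v).1 = (port v u).1)
    (hup : ∀ u v, G.Adj u v → u < v → (port u v).2 = false → (port v u).2 = false) :
    RouteSystem G where
  height := height
  height_injective u v h := by
    by_contra hne
    rcases lt_or_gt_of_ne hne with h1 | h1
    · linarith [hlt u v h1]
    · linarith [hlt v u h1]
  dir u v := portDir (port u v).1 (port u v).2
  mid u v := midDir (port u v).1 (port u v).2 (port v u).2 (decide (u < v))
  arm u v := armLen (port u v).1 (port u v).2 (port v u).2 (decide (u < v))
    |height v - height u|
  len u v := midLen (port u v).1 (port u v).2 (port v u).2 (decide (u < v))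
    |height v - height u|
  isPort u v := ⟨_, _, rfl⟩
  dir_ne u v v' h h' hv hp := hv (hport u v v' h h' (portDir_injective _ _ _ _ hp))
  dir_flip u v := flip_midDir _ _ _ _
  arm_injective u v := armLen_injective _ _ _ _ _
  arm_pos u v x h hx := by
    refine armLen_pos _ _ _ _ ?_ hx.1 hx.2
    rcases lt_or_gt_of_ne h.ne with h1 | h1
    · exact (hlt u v h1).trans (le_abs_self _)
    · rw [abs_sub_comm]
      exact (hlt v u h1).trans (le_abs_self _)
  len_pos u v x h hx := by
    refine midLen_pos _ _ _ _ ?_ hx.1 hx.2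
    rcases lt_or_gt_of_ne h.ne with h1 | h1
    · exact (hlt u v h1).trans (le_abs_self _)
    · rw [abs_sub_comm]
      exact (hlt v u h1).trans (le_abs_self _)
  meet u v x h i := by
    rcases lt_or_gt_of_ne h.ne with h1 | h1
    · have h2 := hlt u v h1
      rw [abs_sub_comm (height u), abs_of_nonneg (by linarith), decide_eq_true h1,
        decide_eq_false h1.not_gt, ← hcol u v h]
      exact halves_meet _ _ _ (hup u v h h1) _ _ x i
    · have h2 := hlt v u h1
      rw [abs_sub_comm (height v), abs_of_nonneg (by linarith), decide_eq_true h1,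
        decide_eq_false h1.not_gt, ← hcol u v h]
      exact (halves_meet _ _ _ (hup v u h.symm h1) _ _ x i).symm
  mono u v h := by
    rcases lt_or_gt_of_ne h.ne with h1 | h1
    · rw [decide_eq_true h1, decide_eq_false h1.not_gt, ← hcol u v h]
      exact exists_monotone_functional _ _ _ (hup u v h h1)
    · rw [decide_eq_true h1, decide_eq_false h1.not_gt, ← hcol u v h]
      obtain ⟨f, f1, f2, f3, f4⟩ :=
        exists_monotone_functional (port u v).1 _ _ (hup v u h.symm h1)
      refine ⟨-f, ?_⟩
      simp only [Pi.neg_apply, neg_mul, Finset.sum_neg_distrib]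
      exact ⟨by linarith, by linarith, by linarith, by linarith⟩
  mid_flip u v h := by
    rcases lt_or_gt_of_ne h.ne with h1 | h1
    · rw [decide_eq_true h1, decide_eq_false h1.not_gt, ← hcol u v h]
      exact flip_midDir_opp _ _ _ true (hup u v h h1)
    · rw [decide_eq_true h1, decide_eq_false h1.not_gt, ← hcol u v h]
      exact flip_midDir_opp _ _ _ false (hup v u h.symm h1)
  bound := K
  site_mem_box v i := by
    have := hK v
    fin_cases i <;> simp [site, boxLo, boxHi] <;> constructor <;> linarith
  mem_box u v x h hx m hm i := by
    have hu := hK u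
    have hv := hK v
    rcases lt_or_gt_of_ne h.ne with h1 | h1
    · have h2 := hlt u v h1
      rw [abs_of_nonneg (by linarith), decide_eq_true h1] at hm ⊢
      exact half_low_mem_box _ _ _ (hup u v h h1) hu.1 (by linarith) hv.2 hx.1 hx.2 hm i
    · have h2 := hlt v u h1
      rw [abs_sub_comm (height v), abs_of_nonneg (by linarith),
        decide_eq_false h1.not_gt] at hm ⊢
      exact half_high_mem_box _ _ _ (hup v u h.symm h1) hv.1 (by linarith) hu.2 hx.1 hx.2 hm i

/-- Every graph with maximum degree at most four has a non-crossing
polyline drawing in ℝ³ with integer vertex coordinates, inside a box of side lengths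
at most `16n/3 × 16n/3 × 16n`, with at most three bends per edge, all edge segments
parallel to the long diagonals `(±1, ±1, ±1)` of the grid cubes, and angular
resolution at least `arccos (-1/3) ≈ 109.5°`. -/
theorem degree_four_diamond_drawing (n : ℕ) (V : Type) [Fintype V] [DecidableEq V]
    (G : SimpleGraph V) [DecidableRel G.Adj]
    (hcard : Fintype.card V = n) (hdeg : ∀ v, G.degree v ≤ 4) :
    ∃ D : PolylineDrawing G,
      NonCrossing D ∧
      MaxBends D 3 ∧
      AngularResAtLeast D (Real.arccos (-(1/3))) ∧
      (∀ v : V, ∀ i : Fin 3, ∃ m : ℤ, D.p v i = (m : ℝ)) ∧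
      (∃ lo s : Fin 3 → ℝ,
        s 0 ≤ 16 * n / 3 ∧ s 1 ≤ 16 * n / 3 ∧ s 2 ≤ 16 * n ∧
        ∀ x ∈ drawingImage D, ∀ i : Fin 3, lo i ≤ x i ∧ x i ≤ lo i + s i) ∧
      (∀ u v : V, ∀ h : G.Adj u v, ∀ a b : Pt, [a, b] <:+: D.seq u v h →
        ∃ c : ℝ, c ≠ 0 ∧ ∃ d : Fin 3 → ℝ, (∀ i, d i = 1 ∨ d i = -1) ∧
          ∀ i : Fin 3, b i - a i = c * d i) := by
  rcases isEmpty_or_nonempty V with hV | hV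
  · have hn : n = 0 := by rw [← hcard]; exact Fintype.card_eq_zero
    refine ⟨⟨fun v => isEmptyElim v, fun v => isEmptyElim v, fun v => isEmptyElim v,
      fun v => isEmptyElim v, fun v => isEmptyElim v, fun v => isEmptyElim v⟩,
      ⟨fun v => isEmptyElim v, fun v => isEmptyElim v, fun v => isEmptyElim v⟩,
      fun v => isEmptyElim v, ⟨fun v => isEmptyElim v, fun v => isEmptyElim v⟩,
      fun v => isEmptyElim v, ⟨0, 0, by simp [hn], by simp [hn], by simp [hn], ?_⟩, fun v => isEmptyElim v⟩
    intro x hx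
    simp [drawingImage] at hx
  let q : V ≃ Fin n := Fintype.equivFinOfCardEq hcard
  let _ : LinearOrder V := LinearOrder.lift' q q.injective
  have hn : 1 ≤ n := by
    rw [← hcard]
    exact Fintype.card_pos
  obtain ⟨port, hport, hcol, hup⟩ := exists_port_assignment G hdeg
  let R : RouteSystem G := RouteSystem.ofPorts (fun v => ((q v : ℕ) : ℝ))
    (by
      intro u v huv
      have h1 : (q u : ℕ) < q v := huv
      have h2 : ((q u : ℕ) : ℝ) + 1 ≤ (q v : ℕ) := by exact_mod_cast h1
      linarith)
    ((n : ℝ) - 1)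
    (by
      intro v
      have h1 : (q v : ℕ) + 1 ≤ n := (q v).2
      have h2 : ((q v : ℕ) : ℝ) + 1 ≤ n := by exact_mod_cast h1
      exact ⟨Nat.cast_nonneg _, by linarith⟩)
    port hport hcol hup
  obtain ⟨τ, hτ, hc, hcl⟩ := R.exists_parameters
  have hn' : (1 : ℝ) ≤ n := by exact_mod_cast hn
  refine ⟨R.drawing τ, R.nonCrossing_drawing hτ hc hcl, fun u v h => by simp [RouteSystem.drawing],
    R.angularResAtLeast_drawing hτ, ?_, ?_, fun u v h a b hab => R.segments_diagonal hτ h hab⟩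
  · intro v i
    change ∃ m : ℤ, site ((q v : ℕ) : ℝ) i = m
    fin_cases i
    · exact ⟨0, by simp [site]⟩
    · exact ⟨(q v : ℕ), by simp [site]⟩
    · exact ⟨2 * (q v : ℕ), by simp [site]⟩
  · refine ⟨boxLo (n - 1), fun i => boxHi (n - 1) i - boxLo (n - 1) i, ?_, ?_, ?_, ?_⟩
    · simp [boxLo, boxHi]
      linarith
    · simp [boxLo, boxHi]
      linarith
    · simp [boxLo, boxHi]
      linarith
    · intro x hx i
      have hbox : x i ∈ Set.Icc (boxLo ((n : ℝ) - 1) i) (boxHi ((n : ℝ) - 1) i) :=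
        R.drawingImage_subset_box hτ hx i
      simpa using hbox
end
end

section
/- Every finite simple graph G with maximum degree at most 3 has a non-crossing polyline drawing in ℝ³ in which every edge is drawn with at most 2 bends and the drawing has angular resolution at least 2π/3 (120°). -/
open InnerProductGeometry

noncomputable section

variable {V : Type*} {G : SimpleGraph V}

/-- The segments of a four-point polyline. -/
theorem polyImage_four (a b c d : Pt) :
    polyImage [a, b, c, d] = segment ℝ a b ∪ segment ℝ b c ∪ segment ℝ c d := by
  simp [polyImage, Set.union_assoc]

theorem polyImage_four_reverse (a b c d : Pt) :
    polyImage [d, c, b, a] = polyImage [a, b, c, d] := by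
  rw [polyImage_four, polyImage_four, segment_symm ℝ d c, segment_symm ℝ c b, segment_symm ℝ b a]
  ext x
  simp only [Set.mem_union]
  tauto

theorem two_pi_div_three_le_angle {x y : Pt} (hx : x ≠ 0) (hy : y ≠ 0)
    (h : inner ℝ x y ≤ -(‖x‖ * ‖y‖) / 2) : 2 * Real.pi / 3 ≤ angle x y := by
  have h1 : Real.arccos (-(1 / 2)) = 2 * Real.pi / 3 := by
    rw [Real.arccos_neg, ← Real.cos_pi_div_three, Real.arccos_cos (by positivity)
      (by linarith [Real.pi_pos])]
    ring
  rw [← h1, angle]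
  apply Real.arccos_le_arccos
  have : 0 < ‖x‖ * ‖y‖ := mul_pos (norm_pos_iff.2 hx) (norm_pos_iff.2 hy)
  rw [div_le_iff₀ this]
  linarith

/-- If unit vectors `a` and `b` make an angle of at least 120° and `d` makes an angle of less
than 60° with `a`, then `d` makes an angle of more than 60° with `b`. -/
theorem inner_lt_of_inner_le_neg_half {a b d : Pt} (ha : ‖a‖ = 1) (hb : ‖b‖ = 1)
    (hab : inner ℝ a b ≤ -1 / 2) (hd : ‖d‖ / 2 < inner ℝ a d) : inner ℝ b d < ‖d‖ / 2 := by
  have ha0 : a ≠ 0 := by rintro rfl; simp at ha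
  have hb0 : b ≠ 0 := by rintro rfl; simp at hb
  have hd0 : d ≠ 0 := by rintro rfl; simp at hd
  have hd1 : 0 < ‖d‖ := norm_pos_iff.2 hd0
  have h1 := two_pi_div_three_le_angle ha0 hb0 (by rw [ha, hb]; linarith)
  have h2 := angle_le_angle_add_angle a d b
  have h3 : angle a d < Real.pi / 3 := by
    by_contra hc
    have := Real.cos_le_cos_of_nonneg_of_le_pi (by positivity) (angle_le_pi a d) (not_lt.1 hc)
    rw [cos_angle, Real.cos_pi_div_three, ha, one_mul, div_le_iff₀ hd1] at this
    linarith
  have h4 : Real.pi / 3 < angle d b := by linarith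
  have h5 := Real.cos_lt_cos_of_nonneg_of_le_pi (by positivity) (angle_le_pi d b) h4
  rw [cos_angle, Real.cos_pi_div_three, hb, mul_one, div_lt_iff₀ hd1, real_inner_comm] at h5
  linarith

/-- Points with no two equal, no three collinear and no four coplanar. -/
structure GeneralPosition {ι : Type*} (p : ι → Pt) : Prop where
  inj : Function.Injective p
  three : ∀ a b c, a ≠ b → a ≠ c → b ≠ c → ∀ r s : ℝ,
    r • (p b - p a) + s • (p c - p a) = 0 → r = 0 ∧ s = 0
  four : ∀ a b c d, a ≠ b → a ≠ c → a ≠ d → b ≠ c → b ≠ d → c ≠ d → ∀ r s t : ℝ,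
    r • (p b - p a) + s • (p c - p a) + t • (p d - p a) = 0 → r = 0 ∧ s = 0 ∧ t = 0

/-- Unit vectors `a u v`, one for each edge `uv` leaving a vertex `u`, pairwise at angles of at
least 120° around each vertex, and each within 60° of the direction of the straight edge. -/
structure Stubs (G : SimpleGraph V) (p : V → Pt) (a : V → V → Pt) : Prop where
  unit : ∀ u v, G.Adj u v → ‖a u v‖ = 1
  sep : ∀ u v w, G.Adj u v → G.Adj u w → v ≠ w → inner ℝ (a u v) (a u w) ≤ -1 / 2
  aim : ∀ u v, G.Adj u v → ‖p v - p u‖ / 2 < inner ℝ (a u v) (p v - p u)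

theorem GeneralPosition.notMem_segment {ι : Type*} {p : ι → Pt} (hp : GeneralPosition p)
    {a b c : ι} (hab : a ≠ b) (hac : a ≠ c) (hbc : b ≠ c) : p c ∉ segment ℝ (p a) (p b) := by
  rintro ⟨s, t, hs, ht, hst, h⟩
  have := hp.three a b c hab hac hbc t (-1) (by
    rw [← h, show s = 1 - t by linarith]; module)
  linarith [this.2]

theorem GeneralPosition.disjoint_segment {ι : Type*} {p : ι → Pt} (hp : GeneralPosition p)
    {a b c d : ι} (hab : a ≠ b) (hac : a ≠ c) (had : a ≠ d) (hbc : b ≠ c) (hbd : b ≠ d)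
    (hcd : c ≠ d) : Disjoint (segment ℝ (p a) (p b)) (segment ℝ (p c) (p d)) := by
  rw [Set.disjoint_left]
  rintro x ⟨s, t, hs, ht, hst, h⟩ ⟨s', t', hs', ht', hst', h'⟩
  have := hp.four a b c d hab hac had hbc hbd hcd t (-s') (-t') (by
    have e : t • p b = s' • p c + t' • p d - s • p a := by rw [h', ← h]; abel
    rw [smul_sub, e, show s' = 1 - t' by linarith, show s = 1 - t by linarith]; module)
  linarith [this.2.1, this.2.2]

theorem isCompact_segment (x y : Pt) : IsCompact (segment ℝ x y) := by
  rw [segment_eq_image_lineMap]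
  exact isCompact_Icc.image (AffineMap.lineMap_continuous)

/-- Two disjoint compact sets have disjoint small thickenings. -/
theorem eventually_disjoint_thickening {s t : Set Pt} (hs : IsCompact s) (ht : IsCompact t)
    (h : Disjoint s t) : ∀ᶠ ε in nhdsWithin (0 : ℝ) (Set.Ioi 0),
      Disjoint (Metric.cthickening ε s) (Metric.cthickening ε t) := by
  obtain ⟨δ, hδ, hd⟩ := h.exists_cthickenings hs ht.isClosed
  filter_upwards [Ioo_mem_nhdsGT hδ] with ε hε
  exact hd.mono (Metric.cthickening_mono hε.2.le _) (Metric.cthickening_mono hε.2.le _)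

/-- The polyline with short stubs stays close to the straight edge. -/
theorem polyImage_subset_cthickening {x y a b : Pt} {ε : ℝ} (hε : 0 < ε) (ha : ‖a‖ = 1)
    (hb : ‖b‖ = 1) :
    polyImage [x, x + ε • a, y + ε • b, y] ⊆ Metric.cthickening ε (segment ℝ x y) := by
  have hconv : Convex ℝ (Metric.cthickening ε (segment ℝ x y)) := (convex_segment x y).cthickening ε
  have hx : x ∈ Metric.cthickening ε (segment ℝ x y) :=
    Metric.self_subset_cthickening _ (left_mem_segment ℝ x y)
  have hy : y ∈ Metric.cthickening ε (segment ℝ x y) :=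
    Metric.self_subset_cthickening _ (right_mem_segment ℝ x y)
  have hxa : x + ε • a ∈ Metric.cthickening ε (segment ℝ x y) := by
    apply Metric.mem_cthickening_of_dist_le _ x _ _ (left_mem_segment ℝ x y)
    simp [norm_smul, ha, abs_of_pos hε]
  have hyb : y + ε • b ∈ Metric.cthickening ε (segment ℝ x y) := by
    apply Metric.mem_cthickening_of_dist_le _ y _ _ (right_mem_segment ℝ x y)
    simp [norm_smul, hb, abs_of_pos hε]
  rw [polyImage_four]
  exact Set.union_subset (Set.union_subset (hconv.segment_subset hx hxa)
    (hconv.segment_subset hxa hyb)) (hconv.segment_subset hyb hy)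

/-- The stubs `a` scaled by `ε` are short enough for the drawing with these stubs to have all the
required properties. -/
structure ShortStubs (G : SimpleGraph V) (p : V → Pt) (a : V → V → Pt) (ε : ℝ) : Prop where
  pos : 0 < ε
  ends : ∀ u v, G.Adj u v → Disjoint (Metric.cthickening ε {p u}) (Metric.cthickening ε {p v})
  vert : ∀ u v w, u ≠ v → u ≠ w → v ≠ w →
    Disjoint (Metric.cthickening ε (segment ℝ (p u) (p v))) (Metric.cthickening ε {p w})
  edge : ∀ u v w x, u ≠ v → u ≠ w → u ≠ x → v ≠ w → v ≠ x → w ≠ x →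
    Disjoint (Metric.cthickening ε (segment ℝ (p u) (p v)))
      (Metric.cthickening ε (segment ℝ (p w) (p x)))
  bend : ∀ u v, G.Adj u v → ‖p v + ε • a v u - (p u + ε • a u v)‖ / 2 <
    inner ℝ (a u v) (p v + ε • a v u - (p u + ε • a u v))
  side : ∀ u v w, G.Adj u v → G.Adj u w → v ≠ w →
    0 < inner ℝ (a u v - a u w) (p v + ε • a v u - p u)

theorem eventually_lt_of_lt_at_zero {f g : ℝ → ℝ} (hf : Continuous f) (hg : Continuous g)
    (h : f 0 < g 0) : ∀ᶠ ε in nhdsWithin (0 : ℝ) (Set.Ioi 0), f ε < g ε :=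
  (hf.continuousAt.eventually_lt hg.continuousAt h).filter_mono nhdsWithin_le_nhds

theorem Stubs.exists_shortStubs [Finite V] {p : V → Pt} {a : V → V → Pt}
    (hp : GeneralPosition p) (ha : Stubs G p a) : ∃ ε, ShortStubs G p a ε := by
  have h1 : ∀ᶠ ε in nhdsWithin (0 : ℝ) (Set.Ioi 0), 0 < ε := eventually_mem_nhdsWithin
  have h2 : ∀ᶠ ε in nhdsWithin (0 : ℝ) (Set.Ioi 0), ∀ u v, G.Adj u v →
      Disjoint (Metric.cthickening ε {p u}) (Metric.cthickening ε {p v}) := by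
    simp only [Filter.eventually_all]
    intro u v h
    apply eventually_disjoint_thickening isCompact_singleton isCompact_singleton
    simpa using hp.inj.ne h.ne
  have h3 : ∀ᶠ ε in nhdsWithin (0 : ℝ) (Set.Ioi 0), ∀ u v w, u ≠ v → u ≠ w → v ≠ w →
      Disjoint (Metric.cthickening ε (segment ℝ (p u) (p v)))
        (Metric.cthickening ε {p w}) := by
    simp only [Filter.eventually_all]
    intro u v w huv huw hvw
    apply eventually_disjoint_thickening (isCompact_segment _ _) isCompact_singleton
    simpa using hp.notMem_segment huv huw hvw
  have h4 : ∀ᶠ ε in nhdsWithin (0 : ℝ) (Set.Ioi 0), ∀ u v w x, u ≠ v → u ≠ w → u ≠ x → v ≠ w →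
      v ≠ x → w ≠ x → Disjoint (Metric.cthickening ε (segment ℝ (p u) (p v)))
        (Metric.cthickening ε (segment ℝ (p w) (p x))) := by
    simp only [Filter.eventually_all]
    intro u v w x huv huw hux hvw hvx hwx
    exact eventually_disjoint_thickening (isCompact_segment _ _) (isCompact_segment _ _)
      (hp.disjoint_segment huv huw hux hvw hvx hwx)
  have h5 : ∀ᶠ ε in nhdsWithin (0 : ℝ) (Set.Ioi 0), ∀ u v, G.Adj u v →
      ‖p v + ε • a v u - (p u + ε • a u v)‖ / 2 <
        inner ℝ (a u v) (p v + ε • a v u - (p u + ε • a u v)) := by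
    simp only [Filter.eventually_all]
    intro u v h
    apply eventually_lt_of_lt_at_zero (by fun_prop) (by fun_prop)
    simpa using ha.aim u v h
  have h6 : ∀ᶠ ε in nhdsWithin (0 : ℝ) (Set.Ioi 0), ∀ u v w, G.Adj u v → G.Adj u w → v ≠ w →
      0 < inner ℝ (a u v - a u w) (p v + ε • a v u - p u) := by
    simp only [Filter.eventually_all]
    intro u v w huv huw hvw
    apply eventually_lt_of_lt_at_zero (by fun_prop) (by fun_prop)
    have := inner_lt_of_inner_le_neg_half (ha.unit u v huv) (ha.unit u w huw)
      (ha.sep u v w huv huw hvw) (ha.aim u v huv)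
    simpa [inner_sub_left] using this.trans (ha.aim u v huv)
  obtain ⟨ε, h1, h2, h3, h4, h5, h6⟩ :=
    (h1.and (h2.and (h3.and (h4.and (h5.and h6))))).exists
  exact ⟨ε, h1, h2, h3, h4, h5, h6⟩

/-- The drawing in which every edge consists of a stub at each end and a segment joining them. -/
def stubDrawing (G : SimpleGraph V) (p : V → Pt) (hp : Function.Injective p) (a : V → V → Pt)
    (ε : ℝ) : PolylineDrawing G where
  p := p
  p_inj := hp
  seq u v _ := [p u, p u + ε • a u v, p v + ε • a v u, p v]
  seq_head _ _ _ := rfl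
  seq_last _ _ _ := rfl
  seq_symm _ _ _ := rfl

/-- Two segments `[x, y]` and `[y, z]` along both of which the inner product with `a` strictly
increases meet only in `y`. -/
theorem segment_inter_segment_eq {x y z : Pt} {a : Pt} (hxy : inner ℝ a x < inner ℝ a y)
    (hyz : inner ℝ a y < inner ℝ a z) : segment ℝ x y ∩ segment ℝ y z = {y} := by
  ext w
  simp only [Set.mem_inter_iff, Set.mem_singleton_iff]
  constructor
  · rintro ⟨⟨s, t, hs, ht, hst, rfl⟩, ⟨s', t', hs', ht', hst', h⟩⟩
    have e := congrArg (inner ℝ a) h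
    simp only [inner_add_right, inner_smul_right] at e
    have hs0 : s = 0 := by
      rw [show t = 1 - s by linarith, show s' = 1 - t' by linarith] at e
      nlinarith [mul_nonneg hs (sub_nonneg.2 hxy.le), mul_nonneg ht' (sub_nonneg.2 hyz.le)]
    rw [hs0, show t = 1 by linarith]
    simp
  · rintro rfl
    exact ⟨right_mem_segment ℝ x w, left_mem_segment ℝ w z⟩

section
variable {p : V → Pt} {a : V → V → Pt} {ε : ℝ}

theorem ShortStubs.mem_cthickening_of_mem_stub (h : ShortStubs G p a ε) (ha : Stubs G p a)
    {u v : V} (huv : G.Adj u v) {x : Pt} (hx : x ∈ segment ℝ (p u) (p u + ε • a u v)) :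
    x ∈ Metric.cthickening ε {p u} := by
  obtain ⟨s, t, hs, ht, hst, rfl⟩ := hx
  apply Metric.mem_cthickening_of_dist_le _ (p u) _ _ (Set.mem_singleton _)
  rw [show s • p u + t • (p u + ε • a u v) = p u + (t * ε) • a u v by
    rw [show s = 1 - t by linarith]; module]
  simp only [dist_self_add_left, norm_smul, ha.unit u v huv, Real.norm_eq_abs, mul_one, abs_mul,
    abs_of_nonneg ht, abs_of_pos h.pos]
  nlinarith [h.pos]

theorem ShortStubs.simplePolyline (h : ShortStubs G p a ε) (ha : Stubs G p a)
    {u v : V} (huv : G.Adj u v) :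
    SimplePolyline [p u, p u + ε • a u v, p v + ε • a v u, p v] := by
  have b1 := h.bend u v huv
  have b2 := h.bend v u huv.symm
  have i1 : inner ℝ (a u v) (p u) < inner ℝ (a u v) (p u + ε • a u v) := by
    simp [inner_add_right, inner_smul_right, ha.unit u v huv, h.pos]
  have i2 : inner ℝ (a u v) (p u + ε • a u v) < inner ℝ (a u v) (p v + ε • a v u) := by
    rw [← sub_pos, ← inner_sub_right]
    exact lt_of_le_of_lt (by positivity) b1
  have i3 : inner ℝ (a v u) (p v) < inner ℝ (a v u) (p v + ε • a v u) := by
    simp [inner_add_right, inner_smul_right, ha.unit v u huv.symm, h.pos]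
  have i4 : inner ℝ (a v u) (p v + ε • a v u) < inner ℝ (a v u) (p u + ε • a u v) := by
    rw [← sub_pos, ← inner_sub_right]
    exact lt_of_le_of_lt (by positivity) b2
  have s12 := segment_inter_segment_eq i1 i2
  have s23 := segment_inter_segment_eq i3 i4
  rw [Set.inter_comm, segment_symm ℝ (p v + ε • a v u) (p u + ε • a u v),
    segment_symm ℝ (p v) (p v + ε • a v u)] at s23
  have s13 : segment ℝ (p u) (p u + ε • a u v) ∩ segment ℝ (p v + ε • a v u) (p v) = ∅ := by
    rw [← Set.disjoint_iff_inter_eq_empty, Set.disjoint_left]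
    intro x hx hy
    rw [segment_symm] at hy
    exact Set.disjoint_left.1 (h.ends u v huv) (h.mem_cthickening_of_mem_stub ha huv hx)
      (h.mem_cthickening_of_mem_stub ha huv.symm hy)
  constructor
  · have n1 : p u ≠ p u + ε • a u v := fun e => i1.ne (congrArg _ e)
    have n2 : p u + ε • a u v ≠ p v + ε • a v u := fun e => i2.ne (congrArg _ e)
    have n3 : p v + ε • a v u ≠ p v := fun e => i3.ne' (congrArg _ e)
    change List.IsChain _ _
    simp only [List.isChain_cons_cons, List.isChain_singleton]
    exact ⟨n1, n2, n3, trivial⟩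
  · intro i j hi hj hij
    simp only [List.length_cons, List.length_nil] at hi hj
    obtain ⟨rfl, rfl⟩ | ⟨rfl, rfl⟩ | ⟨rfl, rfl⟩ :
      (i = 0 ∧ j = 1) ∨ (i = 0 ∧ j = 2) ∨ (i = 1 ∧ j = 2) := by omega
    · simpa using s12
    · simpa using s13
    · simpa using s23

theorem ShortStubs.polyImage_inter_of_common (h : ShortStubs G p a ε) (ha : Stubs G p a)
    {u v w : V} (huv : G.Adj u v) (huw : G.Adj u w) (hvw : v ≠ w) :
    polyImage [p u, p u + ε • a u v, p v + ε • a v u, p v] ∩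
      polyImage [p u, p u + ε • a u w, p w + ε • a w u, p w] = {p u} := by
  have far : ∀ v w, G.Adj u v → G.Adj u w → v ≠ w →
      ∀ x ∈ polyImage [p u, p u + ε • a u v, p v + ε • a v u, p v],
      x ∈ polyImage [p u, p u + ε • a u w, p w + ε • a w u, p w] →
      x = p u ∨ 0 < inner ℝ (a u v - a u w) (x - p u) := by
    intro v w huv huw hvw x hx hx'
    have hS := h.side u v w huv huw hvw
    have hA : 0 < inner ℝ (a u v - a u w) (p u + ε • a u v - p u) := by
      have := ha.sep u v w huv huw hvw
      rw [add_sub_cancel_left, inner_smul_right, inner_sub_left, real_inner_self_eq_norm_sq,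
        ha.unit u v huv, real_inner_comm]
      exact mul_pos h.pos (by linarith)
    rw [polyImage_four] at hx
    rcases hx with (⟨s, t, hs, ht, hst, rfl⟩ | ⟨s, t, hs, ht, hst, rfl⟩) | hx
    · rcases ht.eq_or_lt with rfl | ht
      · left; simp [show s = 1 by linarith]
      · right
        rw [show s • p u + t • (p u + ε • a u v) - p u = t • (p u + ε • a u v - p u) by
          rw [show s = 1 - t by linarith]; module, inner_smul_right]
        exact mul_pos ht hA
    · right
      rw [show s • (p u + ε • a u v) + t • (p v + ε • a v u) - p u =
          s • (p u + ε • a u v - p u) + t • (p v + ε • a v u - p u) by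
        rw [show s = 1 - t by linarith]; module, inner_add_right, inner_smul_right,
        inner_smul_right]
      rcases hs.eq_or_lt with rfl | hs
      · rw [show t = 1 by linarith]; simpa using hS
      · exact add_pos_of_pos_of_nonneg (mul_pos hs hA) (mul_nonneg ht hS.le)
    · rw [segment_symm] at hx
      exact absurd (h.mem_cthickening_of_mem_stub ha huv.symm hx)
        (Set.disjoint_left.1 (h.vert u w v huw.ne huv.ne hvw.symm)
          (polyImage_subset_cthickening h.pos (ha.unit u w huw) (ha.unit w u huw.symm) hx'))
  ext x
  simp only [Set.mem_inter_iff, Set.mem_singleton_iff]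
  constructor
  · rintro ⟨hx, hx'⟩
    rcases far v w huv huw hvw x hx hx' with h1 | h1
    · exact h1
    rcases far w v huw huv hvw.symm x hx' hx with h2 | h2
    · exact h2
    rw [← neg_sub, inner_neg_left] at h2
    linarith
  · rintro rfl
    simp only [polyImage_four]
    exact ⟨.inl (.inl (left_mem_segment ℝ _ _)), .inl (.inl (left_mem_segment ℝ _ _))⟩

theorem ShortStubs.nonCrossing (h : ShortStubs G p a ε) (hp : Function.Injective p)
    (ha : Stubs G p a) : NonCrossing (stubDrawing G p hp a ε) := by
  have sub : ∀ u v, G.Adj u v → polyImage [p u, p u + ε • a u v, p v + ε • a v u, p v] ⊆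
      Metric.cthickening ε (segment ℝ (p u) (p v)) := fun u v huv =>
    polyImage_subset_cthickening h.pos (ha.unit u v huv) (ha.unit v u huv.symm)
  refine ⟨fun u v huv => h.simplePolyline ha huv, fun u v huv => ?_, ?_⟩
  · change polyImage [p u, p u + ε • a u v, p v + ε • a v u, p v] ∩ Set.range p = {p u, p v}
    ext x
    constructor
    · rintro ⟨hx, w, rfl⟩
      by_contra hw
      have hwu : u ≠ w := by rintro rfl; simp at hw
      have hwv : v ≠ w := by rintro rfl; simp at hw
      exact Set.disjoint_left.1 (h.vert u v w huv.ne hwu hwv) (sub u v huv hx)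
        (Metric.self_subset_cthickening _ rfl)
    · rw [polyImage_four]
      rintro (rfl | rfl)
      · exact ⟨.inl (.inl (left_mem_segment ℝ _ _)), u, rfl⟩
      · exact ⟨.inr (right_mem_segment ℝ _ _), v, rfl⟩
  · intro u v u' v' huv huv' hne
    change polyImage [p u, p u + ε • a u v, p v + ε • a v u, p v] ∩
      polyImage [p u', p u' + ε • a u' v', p v' + ε • a v' u', p v'] =
      p '' (({u, v} : Set V) ∩ {u', v'})
    have flip : ∀ u v, polyImage [p u, p u + ε • a u v, p v + ε • a v u, p v] =
        polyImage [p v, p v + ε • a v u, p u + ε • a u v, p u] := fun u v =>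
      polyImage_four_reverse _ _ _ _
    have n1 := huv.ne
    have n2 := huv'.ne
    have pair : ∀ {b c d : V}, b ≠ c → b ≠ d → c ≠ d →
        p '' (({b, c} : Set V) ∩ {b, d}) = {p b} := by
      intro b c d hbc hbd hcd
      rw [← Set.insert_inter_distrib, Set.singleton_inter_eq_empty.2 (by simpa using hcd)]
      simp
    by_cases e1 : u = u'
    · subst e1
      have n3 : v ≠ v' := by rintro rfl; exact hne rfl
      rw [h.polyImage_inter_of_common ha huv huv' n3, pair n1 n2 n3]
    by_cases e2 : u = v'
    · subst e2
      have n3 : v ≠ u' := by rintro rfl; exact hne Sym2.eq_swap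
      rw [flip u' u, h.polyImage_inter_of_common ha huv huv'.symm n3, Set.pair_comm u' u,
        pair n1 n2.symm n3]
    by_cases e3 : v = u'
    · subst e3
      rw [flip u v, h.polyImage_inter_of_common ha huv.symm huv' e2, Set.pair_comm u v,
        pair n1.symm n2 e2]
    by_cases e4 : v = v'
    · subst e4
      rw [flip u v, flip u' v, h.polyImage_inter_of_common ha huv.symm huv'.symm e1,
        Set.pair_comm u v, Set.pair_comm u' v, pair n1.symm n2.symm e1]
    rw [show (({u, v} : Set V) ∩ {u', v'}) = ∅ by
      ext x
      simp only [Set.mem_inter_iff, Set.mem_insert_iff, Set.mem_singleton_iff,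
        Set.mem_empty_iff_false, iff_false]
      rintro ⟨rfl | rfl, rfl | rfl⟩ <;> contradiction, Set.image_empty,
      ← Set.disjoint_iff_inter_eq_empty]
    exact (h.edge u v u' v' n1 e1 e2 e3 e4 n2).mono (sub u v huv) (sub u' v' huv')

theorem ShortStubs.angularResAtLeast (h : ShortStubs G p a ε) (hp : Function.Injective p)
    (ha : Stubs G p a) : AngularResAtLeast (stubDrawing G p hp a ε) (2 * Real.pi / 3) := by
  have bend : ∀ u v, G.Adj u v → 2 * Real.pi / 3 ≤
      angle (p u - (p u + ε • a u v)) (p v + ε • a v u - (p u + ε • a u v)) := by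
    intro u v huv
    have hb := h.bend u v huv
    have hu := ha.unit u v huv
    rw [sub_add_cancel_left, ← smul_neg, angle_smul_left_of_pos _ _ h.pos]
    apply two_pi_div_three_le_angle
    · rw [neg_ne_zero]; rintro e; simp [e] at hu
    · intro e; rw [e] at hb; simp at hb
    · rw [norm_neg, hu, inner_neg_left]; linarith
  constructor
  · intro u v huv x q y hin
    change [x, q, y] <:+: [p u, p u + ε • a u v, p v + ε • a v u, p v] at hin
    obtain ⟨s, t, e⟩ := hin
    have hl := congrArg List.length e
    simp only [List.length_append, List.length_cons, List.length_nil] at hl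
    match s, e, hl with
    | [], e, _ =>
      simp only [List.nil_append, List.cons_append, List.cons.injEq] at e
      obtain ⟨rfl, rfl, rfl, -⟩ := e
      exact bend u v huv
    | [z], e, _ =>
      simp only [List.nil_append, List.cons_append, List.cons.injEq] at e
      obtain ⟨-, rfl, rfl, rfl, -⟩ := e
      rw [angle_comm]
      exact bend v u huv.symm
    | _ :: _ :: _, _, hl => simp at hl; omega
  · intro v u w hu hw huw x y hx hy
    change [p v, p v + ε • a v u, p u + ε • a u v, p u][1]? = some x at hx
    change [p v, p v + ε • a v w, p w + ε • a w v, p w][1]? = some y at hy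
    simp only [List.getElem?_cons_succ, List.getElem?_cons_zero, Option.some.injEq] at hx hy
    subst hx hy
    change _ ≤ angle (p v + ε • a v u - p v) (p v + ε • a v w - p v)
    rw [add_sub_cancel_left, add_sub_cancel_left, angle_smul_left_of_pos _ _ h.pos,
      angle_smul_right_of_pos _ _ h.pos]
    have h1 := ha.unit v u hu
    have h2 := ha.unit v w hw
    apply two_pi_div_three_le_angle
    · rintro e; simp [e] at h1
    · rintro e; simp [e] at h2
    · rw [h1, h2]; linarith [ha.sep v u w hu hw huw]

end

/-- Vertices in general position with suitable stubs can be completed to a drawing. -/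
theorem Stubs.exists_drawing [Finite V] {p : V → Pt} {a : V → V → Pt}
    (hp : GeneralPosition p) (ha : Stubs G p a) :
    ∃ D : PolylineDrawing G,
      NonCrossing D ∧ MaxBends D 2 ∧ AngularResAtLeast D (2 * Real.pi / 3) := by
  obtain ⟨ε, h⟩ := ha.exists_shortStubs hp
  exact ⟨stubDrawing G p hp.inj a ε, h.nonCrossing hp.inj ha, fun _ _ _ => le_rfl,
    h.angularResAtLeast hp.inj ha⟩

open Filter in
theorem eventually_eval_ne_zero {P : Polynomial ℝ} (h : P.eval 0 ≠ 0) :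
    ∀ᶠ s in atTop, P.eval s ≠ 0 :=
  Polynomial.eventually_atTop_not_isRoot P (by rintro rfl; simp at h)

/-- The vertical unit vector. -/
def vertical : Pt := !₂[0, 0, 1]

/-- Points in a drawing built at three scales: the heights `ℓ` at scale `s ^ 2`, the offsets `q` at
scale `s`, and a point of the moment curve at scale one. -/
def spread (i ℓ : V → ℝ) (q : V → Pt) (s : ℝ) (v : V) : Pt :=
  (s ^ 2 * ℓ v) • vertical + s • q v + !₂[i v, i v ^ 2, i v ^ 3]

theorem spread_apply (i ℓ : V → ℝ) (q : V → Pt) (s : ℝ) (v : V) :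
    spread i ℓ q s v 0 = s * q v 0 + i v ∧ spread i ℓ q s v 1 = s * q v 1 + i v ^ 2 ∧
      spread i ℓ q s v 2 = s ^ 2 * ℓ v + s * q v 2 + i v ^ 3 := by
  simp [spread, vertical]

open Filter Polynomial in
theorem eventually_generalPosition_spread [Finite V] {i : V → ℝ} (hi : Function.Injective i)
    (ℓ : V → ℝ) (q : V → Pt) : ∀ᶠ s in atTop, GeneralPosition (spread i ℓ q s) := by
  let x v : ℝ[X] := C (q v 0) * X + C (i v)
  let y v : ℝ[X] := C (q v 1) * X + C (i v ^ 2)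
  let z v : ℝ[X] := C (ℓ v) * X ^ 2 + C (q v 2) * X + C (i v ^ 3)
  have hx s v : spread i ℓ q s v 0 = (x v).eval s := by simp [x, spread_apply]; ring
  have hy s v : spread i ℓ q s v 1 = (y v).eval s := by simp [y, spread_apply]; ring
  have hz s v : spread i ℓ q s v 2 = (z v).eval s := by simp [z, spread_apply]; ring
  have h2 : ∀ a b, a ≠ b → ∀ᶠ s in atTop, (x a - x b).eval s ≠ 0 := fun a b hab ↦
    eventually_eval_ne_zero (by simpa [x, sub_eq_zero] using hi.ne hab)
  have h3 : ∀ a b c, a ≠ b → a ≠ c → b ≠ c → ∀ᶠ s in atTop,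
      ((x b - x a) * (y c - y a) - (x c - x a) * (y b - y a)).eval s ≠ 0 := by
    intro a b c hab hac hbc
    apply eventually_eval_ne_zero
    have := mul_ne_zero (mul_ne_zero (sub_ne_zero.2 (hi.ne hab)) (sub_ne_zero.2 (hi.ne hac)))
      (sub_ne_zero.2 (hi.ne hbc))
    convert neg_ne_zero.2 this using 1
    simp [x, y]
    ring
  have h4 : ∀ a b c d, a ≠ b → a ≠ c → a ≠ d → b ≠ c → b ≠ d → c ≠ d → ∀ᶠ s in atTop,
      ((x b - x a) * ((y c - y a) * (z d - z a) - (z c - z a) * (y d - y a))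
        - (y b - y a) * ((x c - x a) * (z d - z a) - (z c - z a) * (x d - x a))
        + (z b - z a) * ((x c - x a) * (y d - y a) - (y c - y a) * (x d - x a))).eval s ≠ 0 := by
    intro a b c d hab hac had hbc hbd hcd
    apply eventually_eval_ne_zero
    have := mul_ne_zero (mul_ne_zero (mul_ne_zero (sub_ne_zero.2 (hi.ne hab))
      (sub_ne_zero.2 (hi.ne hac))) (mul_ne_zero (sub_ne_zero.2 (hi.ne had))
      (sub_ne_zero.2 (hi.ne hbc)))) (mul_ne_zero (sub_ne_zero.2 (hi.ne hbd))
      (sub_ne_zero.2 (hi.ne hcd)))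
    convert this using 1
    simp [x, y, z]
    ring
  simp only [← eventually_all] at h2 h3 h4
  filter_upwards [h2, h3, h4] with s h2 h3 h4
  refine ⟨fun a b hab ↦ ?_, fun a b c hab hac hbc r t e ↦ ?_,
    fun a b c d hab hac had hbc hbd hcd r t u e ↦ ?_⟩
  · by_contra hne
    exact h2 a b hne (by simp [← hx, hab])
  · have e0 := congrArg (· 0) e
    have e1 := congrArg (· 1) e
    simp only [PiLp.add_apply, PiLp.smul_apply, PiLp.sub_apply, smul_eq_mul, PiLp.zero_apply,
      hx, hy] at e0 e1
    have := h3 a b c hab hac hbc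
    simp only [eval_sub, eval_mul] at this
    constructor <;> refine (mul_eq_zero_iff_left this).1 ?_
    · linear_combination ((y c).eval s - (y a).eval s) * e0 - ((x c).eval s - (x a).eval s) * e1
    · linear_combination ((x b).eval s - (x a).eval s) * e1 - ((y b).eval s - (y a).eval s) * e0
  · have e0 := congrArg (· 0) e
    have e1 := congrArg (· 1) e
    have e2 := congrArg (· 2) e
    simp only [PiLp.add_apply, PiLp.smul_apply, PiLp.sub_apply, smul_eq_mul, PiLp.zero_apply,
      hx, hy, hz] at e0 e1 e2
    have := h4 a b c d hab hac had hbc hbd hcd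
    simp only [eval_sub, eval_mul, eval_add] at this
    generalize (x b).eval s - (x a).eval s = x1 at *
    generalize (x c).eval s - (x a).eval s = x2 at *
    generalize (x d).eval s - (x a).eval s = x3 at *
    generalize (y b).eval s - (y a).eval s = y1 at *
    generalize (y c).eval s - (y a).eval s = y2 at *
    generalize (y d).eval s - (y a).eval s = y3 at *
    generalize (z b).eval s - (z a).eval s = z1 at *
    generalize (z c).eval s - (z a).eval s = z2 at *
    generalize (z d).eval s - (z a).eval s = z3 at *
    refine ⟨?_, ?_, ?_⟩ <;> refine (mul_eq_zero_iff_left this).1 ?_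
    · linear_combination (y2 * z3 - z2 * y3) * e0 - (x2 * z3 - z2 * x3) * e1
        + (x2 * y3 - y2 * x3) * e2
    · linear_combination -(y1 * z3 - z1 * y3) * e0 + (x1 * z3 - z1 * x3) * e1
        - (x1 * y3 - y1 * x3) * e2
    · linear_combination (y1 * z2 - z1 * y2) * e0 - (x1 * z2 - z1 * x2) * e1
        + (x1 * y2 - y1 * x2) * e2

/-- Unit vectors, pairwise at angle at least `2π/3`, can be assigned to the elements of `N` such
that the one assigned to `v` is at angle less than `π/3` with `d v`. -/
def Spreadable (N : Set V) (d : V → Pt) : Prop :=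
  ∃ a : V → Pt, (∀ v ∈ N, ‖a v‖ = 1 ∧ ‖d v‖ / 2 < inner ℝ (a v) (d v)) ∧
    N.Pairwise fun v w ↦ inner ℝ (a v) (a w) ≤ -1 / 2

theorem exists_stubs_of_spreadable {p : V → Pt}
    (h : ∀ u, Spreadable (G.neighborSet u) fun v ↦ p v - p u) : ∃ a, Stubs G p a := by
  choose a h1 h2 using h
  exact ⟨a, fun u v huv ↦ (h1 u v huv).1, fun u v w hv hw hvw ↦ h2 u hv hw hvw,
    fun u v huv ↦ (h1 u v huv).2⟩

theorem Spreadable.of_smul {N : Set V} {d : V → Pt} {c : V → ℝ} (hc : ∀ v ∈ N, 0 < c v)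
    (h : Spreadable N fun v ↦ c v • d v) : Spreadable N d := by
  obtain ⟨a, h1, h2⟩ := h
  refine ⟨a, fun v hv ↦ ⟨(h1 v hv).1, ?_⟩, h2⟩
  have := (h1 v hv).2
  rw [norm_smul, inner_smul_right, Real.norm_of_nonneg (hc v hv).le, mul_div_assoc] at this
  exact lt_of_mul_lt_mul_left this (hc v hv).le

open Filter Topology in
theorem Spreadable.eventually {ι : Type*} {l : Filter ι} {N : Set V} (hN : N.Finite)
    {D : V → Pt} {d : ι → V → Pt} (h : Spreadable N D)
    (hd : ∀ v ∈ N, Tendsto (fun s ↦ d s v) l (𝓝 (D v))) : ∀ᶠ s in l, Spreadable N (d s) := by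
  obtain ⟨a, h1, h2⟩ := h
  have : ∀ᶠ s in l, ∀ v ∈ N, ‖d s v‖ / 2 < inner ℝ (a v) (d s v) := by
    rw [hN.eventually_all]
    exact fun v hv ↦ ((hd v hv).norm.div_const 2).eventually_lt
      (tendsto_const_nhds.inner (hd v hv)) (h1 v hv).2
  filter_upwards [this] with s hs
  exact ⟨a, fun v hv ↦ ⟨(h1 v hv).1, hs v hv⟩, h2⟩

theorem spreadable_triple {x y z : V} (hxy : x ≠ y) (hxz : x ≠ z) (hyz : y ≠ z) {d : V → Pt}
    {a b c : Pt} (ha : ‖a‖ = 1) (hb : ‖b‖ = 1) (hc : ‖c‖ = 1) (hab : inner ℝ a b ≤ -1 / 2)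
    (hac : inner ℝ a c ≤ -1 / 2) (hbc : inner ℝ b c ≤ -1 / 2)
    (hax : ‖d x‖ / 2 < inner ℝ a (d x)) (hby : ‖d y‖ / 2 < inner ℝ b (d y))
    (hcz : ‖d z‖ / 2 < inner ℝ c (d z)) : Spreadable {x, y, z} d := by
  classical
  refine ⟨fun v ↦ if v = x then a else if v = y then b else c, ?_, ?_⟩
  · rintro v (rfl | rfl | rfl) <;> simp [*, hxy.symm, hxz.symm, hyz.symm]
  · rintro v (rfl | rfl | rfl) w (rfl | rfl | rfl) hvw <;>
      simp_all [hxy.symm, hxz.symm, hyz.symm, real_inner_comm]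

theorem exists_unit_triple {u v : Pt} (hu : ‖u‖ = 1) (hv : ‖v‖ = 1) (hadd : u + v ≠ 0)
    (hsub : u - v ≠ 0) : ∃ a b c : Pt, ‖a‖ = 1 ∧ ‖b‖ = 1 ∧ ‖c‖ = 1 ∧ inner ℝ a b ≤ -1 / 2 ∧
      inner ℝ a c ≤ -1 / 2 ∧ inner ℝ b c ≤ -1 / 2 ∧ 1 / 2 < inner ℝ b u ∧ 1 / 2 < inner ℝ c v ∧
      a = -‖u + v‖⁻¹ • (u + v) := by
  have huu : inner ℝ u u = (1 : ℝ) := by rw [real_inner_self_eq_norm_sq, hu]; norm_num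
  have hvv : inner ℝ v v = (1 : ℝ) := by rw [real_inner_self_eq_norm_sq, hv]; norm_num
  have hvu : inner ℝ v u = inner ℝ u v := real_inner_comm _ _
  have hP : 0 < ‖u + v‖ := norm_pos_iff.2 hadd
  have hM : 0 < ‖u - v‖ := norm_pos_iff.2 hsub
  have hP2 : ‖u + v‖ ^ 2 = 2 + 2 * inner ℝ u v := by rw [norm_add_sq_real, hu, hv]; ring
  have hM2 : ‖u - v‖ ^ 2 = 2 - 2 * inner ℝ u v := by rw [norm_sub_sq_real, hu, hv]; ring
  obtain ⟨n, hn⟩ : ∃ n, n = ‖u + v‖⁻¹ • (u + v) := ⟨_, rfl⟩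
  obtain ⟨e, he⟩ : ∃ e, e = ‖u - v‖⁻¹ • (u - v) := ⟨_, rfl⟩
  have hnn : inner ℝ n n = (1 : ℝ) := by
    rw [real_inner_self_eq_norm_sq, hn, norm_smul, norm_inv, norm_norm, inv_mul_cancel₀ hP.ne',
      one_pow]
  have hee : inner ℝ e e = (1 : ℝ) := by
    rw [real_inner_self_eq_norm_sq, he, norm_smul, norm_inv, norm_norm, inv_mul_cancel₀ hM.ne',
      one_pow]
  have hne : inner ℝ n e = (0 : ℝ) := by
    simp only [hn, he, real_inner_smul_left, real_inner_smul_right, inner_add_left,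
      inner_sub_right, huu, hvv, hvu]
    ring
  have hen : inner ℝ e n = (0 : ℝ) := by rw [real_inner_comm, hne]
  have hnu : inner ℝ n u = ‖u + v‖ / 2 := by
    simp only [hn, real_inner_smul_left, inner_add_left, huu, hvu]
    field_simp
    linarith
  have hnv : inner ℝ n v = ‖u + v‖ / 2 := by
    simp only [hn, real_inner_smul_left, inner_add_left, hvv]
    field_simp
    linarith
  have heu : inner ℝ e u = ‖u - v‖ / 2 := by
    simp only [he, real_inner_smul_left, inner_sub_left, huu, hvu]
    field_simp
    linarith
  have hev : inner ℝ e v = -(‖u - v‖ / 2) := by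
    simp only [he, real_inner_smul_left, inner_sub_left, hvv]
    field_simp
    linarith
  have h3 : √3 * √3 = 3 := Real.mul_self_sqrt (by norm_num)
  have h3' : 0 < √3 := by positivity
  have key : 1 < ‖u + v‖ / 2 + √3 * (‖u - v‖ / 2) := by
    apply lt_of_pow_lt_pow_left₀ 2 (by positivity)
    have : 0 < √3 * (‖u + v‖ * ‖u - v‖) := by positivity
    nlinarith
  have unit : ∀ w : Pt, inner ℝ w w = (1 : ℝ) → ‖w‖ = 1 := fun w hw ↦ by
    rw [norm_eq_sqrt_real_inner, hw, Real.sqrt_one]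
  refine ⟨-n, (1 / 2 : ℝ) • n + (√3 / 2) • e, (1 / 2 : ℝ) • n - (√3 / 2) • e, unit _ ?_, unit _ ?_,
    unit _ ?_, le_of_eq ?_, le_of_eq ?_, le_of_eq ?_, ?_, ?_, by rw [hn, neg_smul]⟩ <;>
  simp only [inner_neg_left, inner_neg_right, neg_neg, inner_add_left, inner_add_right, inner_sub_left,
    inner_sub_right, real_inner_smul_left, real_inner_smul_right, hnn, hee, hne, hen, hnu, hnv,
    heu, hev] <;> linarith

/-- Linearly independent vectors `u` and `v` are matched by two of three coplanar unit vectors at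
mutual angles of 120°; the third matches every `w` at an angle of more than 120° with both. -/
theorem exists_unit_triple_of_independent {u v : Pt}
    (h : ∀ r s : ℝ, r • u + s • v = 0 → r = 0 ∧ s = 0) :
    ∃ a b c : Pt, ‖a‖ = 1 ∧ ‖b‖ = 1 ∧ ‖c‖ = 1 ∧ inner ℝ a b ≤ -1 / 2 ∧ inner ℝ a c ≤ -1 / 2 ∧
      inner ℝ b c ≤ -1 / 2 ∧ ‖u‖ / 2 < inner ℝ b u ∧ ‖v‖ / 2 < inner ℝ c v ∧
      ∀ w, inner ℝ w u < -(‖w‖ * ‖u‖ / 2) → inner ℝ w v < -(‖w‖ * ‖v‖ / 2) →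
        ‖w‖ / 2 < inner ℝ a w := by
  have hu : 0 < ‖u‖ := norm_pos_iff.2 fun hu ↦ by simpa using h 1 0 (by simp [hu])
  have hv : 0 < ‖v‖ := norm_pos_iff.2 fun hv ↦ by simpa using h 0 1 (by simp [hv])
  have n1 : ‖(‖u‖⁻¹ • u : Pt)‖ = 1 := by rw [norm_smul, norm_inv, norm_norm, inv_mul_cancel₀ hu.ne']
  have n2 : ‖(‖v‖⁻¹ • v : Pt)‖ = 1 := by rw [norm_smul, norm_inv, norm_norm, inv_mul_cancel₀ hv.ne']
  have hadd : ‖u‖⁻¹ • u + ‖v‖⁻¹ • v ≠ 0 := fun e ↦ (inv_pos.2 hu).ne' (h _ _ e).1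
  obtain ⟨a, b, c, ha, hb, hc, hab, hac, hbc, hbu, hcv, rfl⟩ := exists_unit_triple n1 n2 hadd
    fun e ↦ (inv_pos.2 hu).ne' (h ‖u‖⁻¹ (-‖v‖⁻¹) (by rw [← e]; module)).1
  refine ⟨_, b, c, ha, hb, hc, hab, hac, hbc, ?_, ?_, fun w h1 h2 ↦ ?_⟩
  · rw [real_inner_smul_right, inv_mul_eq_div, lt_div_iff₀ hu] at hbu
    linarith
  · rw [real_inner_smul_right, inv_mul_eq_div, lt_div_iff₀ hv] at hcv
    linarith
  · have hP : 0 < ‖(‖u‖⁻¹ • u + ‖v‖⁻¹ • v : Pt)‖ := norm_pos_iff.2 hadd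
    have hP2 : ‖(‖u‖⁻¹ • u + ‖v‖⁻¹ • v : Pt)‖ ≤ 2 := (norm_add_le _ _).trans (by linarith)
    have h1' : ‖u‖⁻¹ * inner ℝ w u < -(‖w‖ / 2) := by
      rw [inv_mul_eq_div, div_lt_iff₀ hu]; linarith
    have h2' : ‖v‖⁻¹ * inner ℝ w v < -(‖w‖ / 2) := by
      rw [inv_mul_eq_div, div_lt_iff₀ hv]; linarith
    rw [real_inner_smul_left, inner_add_left, real_inner_smul_left, real_inner_smul_left,
      real_inner_comm w u, real_inner_comm w v, neg_mul, ← mul_neg, inv_mul_eq_div,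
      lt_div_iff₀ hP]
    have := mul_le_mul_of_nonneg_left hP2 (norm_nonneg w)
    linarith

theorem spreadable_of_ncard_le_two {p : V → Pt} (hp : GeneralPosition p) {u : V} {N : Set V}
    (hu : u ∉ N) (hfin : N.Finite) (hN : N.ncard ≤ 2) : Spreadable N fun v ↦ p v - p u := by
  obtain hN | hN := hN.lt_or_eq
  · refine ⟨fun v ↦ ‖p v - p u‖⁻¹ • (p v - p u), fun v hv ↦ ?_, fun v hv w hw hvw ↦
      (hvw ((Set.ncard_le_one hfin).1 (by lia) v hv w hw)).elim⟩
    have h0 : 0 < ‖p v - p u‖ :=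
      norm_pos_iff.2 (sub_ne_zero.2 (hp.inj.ne (by rintro rfl; exact hu hv)))
    constructor
    · rw [norm_smul, norm_inv, norm_norm, inv_mul_cancel₀ h0.ne']
    · rw [real_inner_smul_left, real_inner_self_eq_norm_sq]
      field_simp
      linarith
  · obtain ⟨x, y, hxy, rfl⟩ := Set.ncard_eq_two.1 hN
    simp only [Set.mem_insert_iff, Set.mem_singleton_iff, not_or] at hu
    obtain ⟨-, b, c, -, hb, hc, -, -, hbc, hbx, hcy, -⟩ :=
      exists_unit_triple_of_independent (hp.three u x y hu.1 hu.2 hxy)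
    classical
    refine ⟨fun v ↦ if v = x then b else c, ?_, ?_⟩
    · rintro v (rfl | rfl) <;> simp [*, hxy.symm]
    · rintro v (rfl | rfl) w (rfl | rfl) hvw
      · exact (hvw rfl).elim
      · simpa [hxy.symm] using hbc
      · simpa [hxy.symm, real_inner_comm] using hbc
      · exact (hvw rfl).elim

theorem spreadable_of_inner_lt {p : V → Pt} (hp : GeneralPosition p) {u x y z : V}
    (huy : u ≠ y) (huz : u ≠ z) (hxy : x ≠ y) (hxz : x ≠ z) (hyz : y ≠ z)
    (hy : inner ℝ (p x - p u) (p y - p u) < -(‖p x - p u‖ * ‖p y - p u‖ / 2))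
    (hz : inner ℝ (p x - p u) (p z - p u) < -(‖p x - p u‖ * ‖p z - p u‖ / 2)) :
    Spreadable {x, y, z} fun v ↦ p v - p u := by
  obtain ⟨a, b, c, ha, hb, hc, hab, hac, hbc, hby, hcz, h⟩ :=
    exists_unit_triple_of_independent (hp.three u y z huy huz hyz)
  exact spreadable_triple hxy hxz hyz ha hb hc hab hac hbc (h _ hy hz) hby hcz

open Classical in
/-- The direction from `u` to `v` in the limit of `spread i ℓ q s` as `s → ∞`, up to scaling. -/
def limitDir (ℓ : V → ℝ) (q : V → Pt) (u v : V) : Pt :=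
  if ℓ u = ℓ v then q v - q u else (ℓ v - ℓ u) • vertical

open Classical in
/-- The scaling factor by which `limitDir` arises as a limit. -/
def limitScale (ℓ : V → ℝ) (u v : V) (s : ℝ) : ℝ :=
  if ℓ u = ℓ v then s⁻¹ else s⁻¹ ^ 2

theorem limitScale_pos (ℓ : V → ℝ) (u v : V) {s : ℝ} (hs : 0 < s) : 0 < limitScale ℓ u v s := by
  unfold limitScale
  split_ifs <;> positivity

open Filter Topology in
theorem tendsto_limitDir (i ℓ : V → ℝ) (q : V → Pt) (u v : V) :
    Tendsto (fun s ↦ limitScale ℓ u v s • (spread i ℓ q s v - spread i ℓ q s u)) atTop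
      (𝓝 (limitDir ℓ q u v)) := by
  have h0 : Tendsto (fun s : ℝ ↦ s⁻¹) atTop (𝓝 0) := tendsto_inv_atTop_zero
  obtain ⟨m, hm⟩ : ∃ m : Pt, m = !₂[i v, i v ^ 2, i v ^ 3] - !₂[i u, i u ^ 2, i u ^ 3] := ⟨_, rfl⟩
  unfold limitDir limitScale
  split_ifs with h
  · have : Tendsto (fun s : ℝ ↦ (q v - q u) + s⁻¹ • m) atTop (𝓝 ((q v - q u) + (0 : ℝ) • m)) :=
      tendsto_const_nhds.add (h0.smul_const m)
    rw [zero_smul, add_zero] at this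
    refine this.congr' ?_
    filter_upwards [eventually_gt_atTop 0] with s hs
    rw [spread, spread, h, hm]
    match_scalars <;> field_simp
    ring
  · have : Tendsto (fun s : ℝ ↦ (ℓ v - ℓ u) • vertical + (s⁻¹ • (q v - q u) + s⁻¹ ^ 2 • m)) atTop
        (𝓝 ((ℓ v - ℓ u) • vertical + ((0 : ℝ) • (q v - q u) + (0 : ℝ) ^ 2 • m))) :=
      tendsto_const_nhds.add ((h0.smul_const _).add ((h0.pow 2).smul_const m))
    rw [zero_smul, zero_pow two_ne_zero, zero_smul, add_zero, add_zero] at this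
    refine this.congr' ?_
    filter_upwards [eventually_gt_atTop 0] with s hs
    rw [spread, spread, hm]
    match_scalars <;> field_simp

theorem inner_lt_of_smul {x y : Pt} {b c : ℝ} (hb : 0 < b) (hc : 0 < c)
    (h : inner ℝ (b • x) (c • y) < -(‖b • x‖ * ‖c • y‖ / 2)) :
    inner ℝ x y < -(‖x‖ * ‖y‖ / 2) := by
  rw [norm_smul, norm_smul, real_inner_smul_left, real_inner_smul_right, Real.norm_of_nonneg hb.le,
    Real.norm_of_nonneg hc.le] at h
  refine lt_of_mul_lt_mul_left ?_ (mul_pos hb hc).le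
  linarith

/-- A condition on the limit directions at `u` under which `spread i ℓ q s` can be drawn with
angles at least `2π/3` at `u` when `s` is large. -/
def Resolvable (G : SimpleGraph V) (ℓ : V → ℝ) (q : V → Pt) (u : V) : Prop :=
  (G.neighborSet u).ncard ≤ 2 ∨ ∃ x y z, x ≠ y ∧ x ≠ z ∧ y ≠ z ∧ G.neighborSet u = {x, y, z} ∧
    (Spreadable {x, y, z} (limitDir ℓ q u) ∨
      inner ℝ (limitDir ℓ q u x) (limitDir ℓ q u y) <
          -(‖limitDir ℓ q u x‖ * ‖limitDir ℓ q u y‖ / 2) ∧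
        inner ℝ (limitDir ℓ q u x) (limitDir ℓ q u z) <
          -(‖limitDir ℓ q u x‖ * ‖limitDir ℓ q u z‖ / 2))

open Filter in
theorem Resolvable.eventually_spreadable [Finite V] {i ℓ : V → ℝ} (hi : Function.Injective i)
    {q : V → Pt} {u : V} (h : Resolvable G ℓ q u) :
    ∀ᶠ s in atTop, Spreadable (G.neighborSet u) fun v ↦ spread i ℓ q s v - spread i ℓ q s u := by
  have hgp := eventually_generalPosition_spread hi ℓ q
  have hlim := tendsto_limitDir i ℓ q u
  obtain h | ⟨x, y, z, hxy, hxz, hyz, hN, h | ⟨hy, hz⟩⟩ := h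
  · filter_upwards [hgp] with s hs
    exact spreadable_of_ncard_le_two hs (by simp) (Set.toFinite _) h
  · rw [hN]
    filter_upwards [h.eventually (Set.toFinite _) fun v _ ↦ hlim v, eventually_gt_atTop 0]
      with s hs hs0
    exact hs.of_smul fun v _ ↦ limitScale_pos ℓ u v hs0
  · have hu : u ∉ ({x, y, z} : Set V) := by simp [← hN]
    simp only [Set.mem_insert_iff, Set.mem_singleton_iff, not_or] at hu
    rw [hN]
    have lim w := ((hlim x).inner (hlim w)).eventually_lt
      (((hlim x).norm.mul (hlim w).norm).div_const 2).neg
    filter_upwards [hgp, lim y hy, lim z hz, eventually_gt_atTop 0] with s hs hy hz hs0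
    have pos w := limitScale_pos ℓ u w hs0
    exact spreadable_of_inner_lt hs hu.2.1 hu.2.2 hxy hxz hyz
      (inner_lt_of_smul (pos x) (pos y) hy) (inner_lt_of_smul (pos x) (pos z) hz)

theorem exists_drawing_of_resolvable [Finite V] {ℓ : V → ℝ} {q : V → Pt}
    (h : ∀ u, Resolvable G ℓ q u) : ∃ D : PolylineDrawing G,
      NonCrossing D ∧ MaxBends D 2 ∧ AngularResAtLeast D (2 * Real.pi / 3) := by
  obtain ⟨n, ⟨e⟩⟩ := Finite.exists_equiv_fin V
  have hi : Function.Injective fun v ↦ ((e v : ℕ) : ℝ) := fun v w hvw ↦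
    e.injective (Fin.ext (Nat.cast_injective hvw))
  obtain ⟨s, hs, hgp⟩ := ((Filter.eventually_all.2 fun u ↦ (h u).eventually_spreadable hi).and
    (eventually_generalPosition_spread hi ℓ q)).exists
  obtain ⟨a, ha⟩ := exists_stubs_of_spreadable hs
  exact ha.exists_drawing hgp

theorem exists_eq_triple_of_mem {N : Set V} (hN : N.ncard = 3) {x : V} (hx : x ∈ N) :
    ∃ y z, x ≠ y ∧ x ≠ z ∧ y ≠ z ∧ N = {x, y, z} := by
  obtain ⟨a, b, c, hab, hac, hbc, rfl⟩ := Set.ncard_eq_three.1 hN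
  obtain rfl | rfl | rfl := hx
  · exact ⟨b, c, hab, hac, hbc, rfl⟩
  · exact ⟨a, c, hab.symm, hbc, hac, Set.insert_comm _ _ _⟩
  · exact ⟨a, b, hac.symm, hbc.symm, hab, by ext; simp; tauto⟩

theorem exists_eq_triple_of_mem_of_mem {N : Set V} (hN : N.ncard = 3) {x y : V} (hx : x ∈ N)
    (hy : y ∈ N) (hxy : x ≠ y) : ∃ z, x ≠ z ∧ y ≠ z ∧ N = {x, y, z} := by
  obtain ⟨b, c, hab, hac, hbc, rfl⟩ := exists_eq_triple_of_mem hN hx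
  obtain rfl | rfl | rfl := hy
  · exact (hxy rfl).elim
  · exact ⟨c, hac, hbc, rfl⟩
  · exact ⟨b, hab, hbc.symm, by ext; simp; tauto⟩

/-- Inside `S`, the vertex `v` has no neighbour at its own height, has a higher neighbour, and has
a lower neighbour unless its degree in `S` is less than three. -/
def Climbing (G : SimpleGraph V) (S : Set V) (ℓ : V → ℝ) (v : V) : Prop :=
  (∀ w ∈ S, G.Adj v w → ℓ w ≠ ℓ v) ∧ (∃ w ∈ S, G.Adj v w ∧ ℓ v < ℓ w) ∧
    ((G.neighborSet v ∩ S).ncard < 3 ∨ ∃ w ∈ S, G.Adj v w ∧ ℓ w < ℓ v)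

/-- A path `x, y, z` of vertices at a common height, placed as an isosceles triangle with apex `y`
pointing in the vertical direction `σ`, all other neighbours in `S` lying in direction `-σ`. -/
structure Arch (G : SimpleGraph V) (S : Set V) (ℓ : V → ℝ) (q : V → Pt) (σ : ℝ) (x y z : V) :
    Prop where
  ne : x ≠ z
  left : G.Adj x y
  right : G.Adj y z
  height_left : ℓ x = ℓ y
  height_right : ℓ z = ℓ y
  offset_left : q x = !₂[-4, 0, 0]
  offset_mid : q y = !₂[0, 0, 3 * σ]
  offset_right : q z = !₂[4, 0, 0]
  lt : ∀ t ∈ ({x, y, z} : Set V), ∀ w ∈ S, G.Adj t w → w ∉ ({x, y, z} : Set V) →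
    σ * ℓ w < σ * ℓ t

/-- The vertex `v` and its neighbours are at a common height and form a regular tetrahedron. -/
def Tetrahedral (G : SimpleGraph V) (ℓ : V → ℝ) (q : V → Pt) (v : V) : Prop :=
  ∃ x y z, x ≠ y ∧ x ≠ z ∧ y ≠ z ∧ G.neighborSet v = {x, y, z} ∧ ℓ v = ℓ x ∧ ℓ v = ℓ y ∧
    ℓ v = ℓ z ∧ ∃ r s t : ℝ, r ^ 2 = 1 ∧ s ^ 2 = 1 ∧ t ^ 2 = 1 ∧ q v = !₂[r, s, t] ∧
      q x = !₂[r, -s, -t] ∧ q y = !₂[-r, s, -t] ∧ q z = !₂[-r, -s, t]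

theorem norm_eq_sqrt_three (a b c : ℝ) : ‖(!₂[a, b, c] : Pt)‖ = √(a ^ 2 + b ^ 2 + c ^ 2) := by
  simp [EuclideanSpace.norm_eq, Fin.sum_univ_three]

theorem inner_three (a b c d e f : ℝ) :
    inner ℝ (!₂[a, b, c] : Pt) !₂[d, e, f] = a * d + b * e + c * f := by
  simp [PiLp.inner_apply, Fin.sum_univ_three]; ring

theorem sub_three (a b c d e f : ℝ) :
    (!₂[a, b, c] - !₂[d, e, f] : Pt) = !₂[a - d, b - e, c - f] := by
  ext k; fin_cases k <;> simp

theorem smul_vertical (c : ℝ) : c • vertical = !₂[0, 0, c] := by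
  ext k; fin_cases k <;> simp [vertical]

theorem norm_smul_vertical (c : ℝ) : ‖c • vertical‖ = |c| := by
  rw [smul_vertical, norm_eq_sqrt_three, ← Real.sqrt_sq_eq_abs]; simp

theorem Tetrahedral.resolvable {ℓ : V → ℝ} {q : V → Pt} {v : V} (h : Tetrahedral G ℓ q v) :
    Resolvable G ℓ q v := by
  obtain ⟨x, y, z, hxy, hxz, hyz, hN, hx, hy, hz, r, s, t, hr, hs, ht, qv, qx, qy, qz⟩ := h
  have h6 : √6 ^ 2 = 6 := Real.sq_sqrt (by norm_num)
  have h6' : 0 < √6 := by positivity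
  have h8 : √8 ^ 2 = 8 := Real.sq_sqrt (by norm_num)
  have h48 : √8 / 2 < 8 / √6 - 4 / √6 := by
    rw [← sub_div, lt_div_iff₀ h6']
    apply lt_of_pow_lt_pow_left₀ 2 (by norm_num)
    nlinarith
  have flat {w : V} (e : ℓ v = ℓ w) : limitDir ℓ q v w = q w - q v := if_pos e
  refine .inr ⟨x, y, z, hxy, hxz, hyz, hN, .inl (spreadable_triple
    (a := !₂[2 * r / √6, -s / √6, -t / √6]) (b := !₂[-r / √6, 2 * s / √6, -t / √6])
    (c := !₂[-r / √6, -s / √6, 2 * t / √6]) hxy hxz hyz ?_ ?_ ?_ ?_ ?_ ?_ ?_ ?_ ?_)⟩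
  · rw [norm_eq_sqrt_three, Real.sqrt_eq_one]
    field_simp
    linear_combination 4 * hr + hs + ht - h6
  · rw [norm_eq_sqrt_three, Real.sqrt_eq_one]
    field_simp
    linear_combination hr + 4 * hs + ht - h6
  · rw [norm_eq_sqrt_three, Real.sqrt_eq_one]
    field_simp
    linear_combination hr + hs + 4 * ht - h6
  · rw [inner_three]
    apply le_of_eq
    field_simp
    linear_combination -4 * hr - 4 * hs + 2 * ht + h6
  · rw [inner_three]
    apply le_of_eq
    field_simp
    linear_combination -4 * hr + 2 * hs - 4 * ht + h6
  · rw [inner_three]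
    apply le_of_eq
    field_simp
    linear_combination 2 * hr - 4 * hs - 4 * ht + h6
  · rw [flat hx, qx, qv, sub_three, norm_eq_sqrt_three, inner_three]
    convert h48 using 1
    · congr 2
      linear_combination 4 * hs + 4 * ht
    · field_simp
      linear_combination 2 * hs + 2 * ht
  · rw [flat hy, qy, qv, sub_three, norm_eq_sqrt_three, inner_three]
    convert h48 using 1
    · congr 2
      linear_combination 4 * hr + 4 * ht
    · field_simp
      linear_combination 2 * hr + 2 * ht
  · rw [flat hz, qz, qv, sub_three, norm_eq_sqrt_three, inner_three]
    convert h48 using 1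
    · congr 2
      linear_combination 4 * hr + 4 * hs
    · field_simp
      linear_combination 2 * hr + 2 * hs

theorem Climbing.resolvable {ℓ : V → ℝ} {q : V → Pt} {v : V} (hdeg : (G.neighborSet v).ncard ≤ 3)
    (h : Climbing G Set.univ ℓ v) : Resolvable G ℓ q v := by
  obtain hd | hd := hdeg.lt_or_eq
  · exact .inl (by lia)
  have opp : ∀ w t, G.Adj v w → G.Adj v t → (ℓ w - ℓ v) * (ℓ t - ℓ v) < 0 →
      inner ℝ (limitDir ℓ q v w) (limitDir ℓ q v t) <
        -(‖limitDir ℓ q v w‖ * ‖limitDir ℓ q v t‖ / 2) := by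
    intro w t hw ht hlt
    rw [limitDir, limitDir, if_neg (h.1 w trivial hw).symm, if_neg (h.1 t trivial ht).symm,
      norm_smul_vertical, norm_smul_vertical, smul_vertical, smul_vertical, inner_three, ← abs_mul,
      abs_of_neg hlt]
    linarith
  have hne := h.1
  obtain ⟨-, ⟨b, -, hb, hvb⟩, h | ⟨c, -, hc, hcv⟩⟩ := h
  · rw [Set.inter_univ] at h
    exact .inl (by lia)
  obtain ⟨t, hbt, hct, hN⟩ := exists_eq_triple_of_mem_of_mem hd hb hc (by rintro rfl; linarith)
  have ht : G.Adj v t := by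
    rw [← SimpleGraph.mem_neighborSet, hN]; simp
  have hbc : b ≠ c := by rintro rfl; linarith
  obtain hlt | hlt := (hne t trivial ht).lt_or_gt
  · exact .inr ⟨b, c, t, hbc, hbt, hct, hN, .inr ⟨opp _ _ hb hc (by nlinarith),
      opp _ _ hb ht (by nlinarith)⟩⟩
  · exact .inr ⟨c, b, t, hbc.symm, hct, hbt, by rw [hN, Set.insert_comm],
      .inr ⟨opp _ _ hc hb (by nlinarith), opp _ _ hc ht (by nlinarith)⟩⟩

theorem resolvable_arch_end {ℓ : V → ℝ} {q : V → Pt} {x y z : V}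
    (hdeg : (G.neighborSet x).ncard ≤ 3) {σ τ : ℝ} (hσ : σ ^ 2 = 1) (hτ : τ ^ 2 = 1)
    (hxy : G.Adj x y) (hyz : y ≠ z) (hy : limitDir ℓ q x y = !₂[4 * τ, 0, 3 * σ])
    (hz : limitDir ℓ q x z = !₂[8 * τ, 0, 0])
    (h : ∀ w, G.Adj x w → w ≠ y → w ≠ z → ∃ c > 0, limitDir ℓ q x w = !₂[0, 0, -(c * σ)]) :
    Resolvable G ℓ q x := by
  obtain hd | hd := hdeg.lt_or_eq
  · exact .inl (by lia)
  have ny : ‖limitDir ℓ q x y‖ = 5 := by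
    rw [hy, norm_eq_sqrt_three, Real.sqrt_eq_iff_mul_self_eq_of_pos (by norm_num)]
    linear_combination -16 * hτ - 9 * hσ
  have nz : ‖limitDir ℓ q x z‖ = 8 := by
    rw [hz, norm_eq_sqrt_three, Real.sqrt_eq_iff_mul_self_eq_of_pos (by norm_num)]
    linear_combination -64 * hτ
  have nw {c : ℝ} (hc : 0 < c) : ‖(!₂[0, 0, -(c * σ)] : Pt)‖ = c := by
    rw [norm_eq_sqrt_three, Real.sqrt_eq_iff_mul_self_eq_of_pos hc]
    linear_combination -c ^ 2 * hσ
  by_cases hxz : G.Adj x z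
  · obtain ⟨w, hyw, hzw, hN⟩ := exists_eq_triple_of_mem_of_mem hd hxy hxz hyz
    have hw : G.Adj x w := by rw [← SimpleGraph.mem_neighborSet, hN]; simp
    obtain ⟨c, hc, hw⟩ := h w hw hyw.symm hzw.symm
    have h3 : √3 ^ 2 = 3 := Real.sq_sqrt (by norm_num)
    have h3l : 1.7 < √3 := Real.lt_sqrt_of_sq_lt (by norm_num)
    have h3u : √3 < 1.8 := (Real.sqrt_lt' (by norm_num)).2 (by norm_num)
    refine .inr ⟨y, z, w, hyz, hyw, hzw, hN, .inl (spreadable_triple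
      (a := !₂[(8 * √3 - 15) / 34 * τ, 0, (15 * √3 + 8) / 34 * σ])
      (b := !₂[15 / 17 * τ, 0, -8 / 17 * σ])
      (c := !₂[(-8 * √3 - 15) / 34 * τ, 0, (8 - 15 * √3) / 34 * σ])
      hyz hyw hzw ?_ ?_ ?_ (le_of_eq ?_) (le_of_eq ?_) (le_of_eq ?_) ?_ ?_ ?_)⟩
    · rw [norm_eq_sqrt_three, Real.sqrt_eq_one]
      linear_combination ((8 * √3 - 15) / 34) ^ 2 * hτ + ((15 * √3 + 8) / 34) ^ 2 * hσ
        + (289 / 34 ^ 2) * h3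
    · rw [norm_eq_sqrt_three, Real.sqrt_eq_one]
      linear_combination (15 / 17) ^ 2 * hτ + (8 / 17) ^ 2 * hσ
    · rw [norm_eq_sqrt_three, Real.sqrt_eq_one]
      linear_combination ((8 * √3 + 15) / 34) ^ 2 * hτ + ((15 * √3 - 8) / 34) ^ 2 * hσ
        + (289 / 34 ^ 2) * h3
    · rw [inner_three]
      linear_combination (8 * √3 - 15) / 34 * (15 / 17) * hτ
        + (15 * √3 + 8) / 34 * (-8 / 17) * hσ
    · rw [inner_three]
      linear_combination (8 * √3 - 15) / 34 * ((-8 * √3 - 15) / 34) * hτ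
        + (15 * √3 + 8) / 34 * ((8 - 15 * √3) / 34) * hσ - (289 / 34 ^ 2) * h3
    · rw [inner_three]
      linear_combination 15 / 17 * ((-8 * √3 - 15) / 34) * hτ
        + (-8 / 17) * ((8 - 15 * √3) / 34) * hσ
    · rw [ny, hy, inner_three]
      have : (8 * √3 - 15) / 34 * τ * (4 * τ) + 0 * 0 + (15 * √3 + 8) / 34 * σ * (3 * σ) =
          (77 * √3 - 36) / 34 := by
        linear_combination (8 * √3 - 15) / 34 * 4 * hτ + (15 * √3 + 8) / 34 * 3 * hσ
      rw [this]
      linarith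
    · rw [nz, hz, inner_three]
      linarith [show 15 / 17 * τ * (8 * τ) = 120 / 17 by linear_combination 120 / 17 * hτ]
    · rw [hw, nw hc, inner_three]
      have : (-8 * √3 - 15) / 34 * τ * 0 + 0 * 0 + (8 - 15 * √3) / 34 * σ * -(c * σ) =
          c * ((15 * √3 - 8) / 34) := by
        linear_combination (15 * √3 - 8) / 34 * c * hσ
      rw [this]
      nlinarith
  · obtain ⟨w, t, hyw, hyt, hwt, hN⟩ := exists_eq_triple_of_mem hd hxy
    have key : ∀ u, G.Adj x u → y ≠ u → inner ℝ (limitDir ℓ q x y) (limitDir ℓ q x u) <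
        -(‖limitDir ℓ q x y‖ * ‖limitDir ℓ q x u‖ / 2) := by
      intro u hu hyu
      obtain ⟨c, hc, e⟩ := h u hu hyu.symm (by rintro rfl; exact hxz hu)
      rw [ny, hy, e, inner_three, nw hc]
      linarith [show 3 * σ * -(c * σ) = -(3 * c) by linear_combination -3 * c * hσ]
    refine .inr ⟨y, w, t, hyw, hyt, hwt, hN, .inr ⟨key w ?_ hyw, key t ?_ hyt⟩⟩ <;>
    · rw [← SimpleGraph.mem_neighborSet, hN]
      simp

theorem resolvable_arch_mid {ℓ : V → ℝ} {q : V → Pt} {x y z : V}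
    (hdeg : (G.neighborSet y).ncard ≤ 3) {σ : ℝ} (hσ : σ ^ 2 = 1)
    (hyx : G.Adj y x) (hyz : G.Adj y z) (hxz : x ≠ z)
    (hx : limitDir ℓ q y x = !₂[-4, 0, -(3 * σ)]) (hz : limitDir ℓ q y z = !₂[4, 0, -(3 * σ)])
    (h : ∀ w, G.Adj y w → w ≠ x → w ≠ z → ∃ c > 0, limitDir ℓ q y w = !₂[0, 0, -(c * σ)]) :
    Resolvable G ℓ q y := by
  obtain hd | hd := hdeg.lt_or_eq
  · exact .inl (by lia)
  obtain ⟨w, hxw, hzw, hN⟩ := exists_eq_triple_of_mem_of_mem hd hyx hyz hxz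
  have hw : G.Adj y w := by rw [← SimpleGraph.mem_neighborSet, hN]; simp
  obtain ⟨c, hc, hw⟩ := h w hw hxw.symm hzw.symm
  have nx : ‖limitDir ℓ q y x‖ = 5 := by
    rw [hx, norm_eq_sqrt_three, Real.sqrt_eq_iff_mul_self_eq_of_pos (by norm_num)]
    linear_combination -9 * hσ
  have nz : ‖limitDir ℓ q y z‖ = 5 := by
    rw [hz, norm_eq_sqrt_three, Real.sqrt_eq_iff_mul_self_eq_of_pos (by norm_num)]
    linear_combination -9 * hσ
  have nw : ‖limitDir ℓ q y w‖ = c := by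
    rw [hw, norm_eq_sqrt_three, Real.sqrt_eq_iff_mul_self_eq_of_pos hc]
    linear_combination -c ^ 2 * hσ
  have h3 : √3 ^ 2 = 3 := Real.sq_sqrt (by norm_num)
  have h3l : 1.72 < √3 := Real.lt_sqrt_of_sq_lt (by norm_num)
  refine .inr ⟨x, z, w, hxz, hxw, hzw, hN, .inl (spreadable_triple
    (a := !₂[-√3 / 2, -2 / 5, 3 / 10 * σ]) (b := !₂[√3 / 2, -2 / 5, 3 / 10 * σ])
    (c := !₂[0, 4 / 5, -3 / 5 * σ])
    hxz hxw hzw ?_ ?_ ?_ (le_of_eq ?_) (le_of_eq ?_) (le_of_eq ?_) ?_ ?_ ?_)⟩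
  · rw [norm_eq_sqrt_three, Real.sqrt_eq_one]
    linear_combination h3 / 4 + 9 / 100 * hσ
  · rw [norm_eq_sqrt_three, Real.sqrt_eq_one]
    linear_combination h3 / 4 + 9 / 100 * hσ
  · rw [norm_eq_sqrt_three, Real.sqrt_eq_one]
    linear_combination 9 / 25 * hσ
  · rw [inner_three]
    linear_combination -h3 / 4 + 9 / 100 * hσ
  · rw [inner_three]
    linear_combination -9 / 50 * hσ
  · rw [inner_three]
    linear_combination -9 / 50 * hσ
  · rw [nx, hx, inner_three]
    linarith [show 3 / 10 * σ * -(3 * σ) = -9 / 10 by linear_combination -9 / 10 * hσ]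
  · rw [nz, hz, inner_three]
    linarith [show 3 / 10 * σ * -(3 * σ) = -9 / 10 by linear_combination -9 / 10 * hσ]
  · rw [nw, hw, inner_three]
    linarith [show -3 / 5 * σ * -(c * σ) = 3 / 5 * c by linear_combination 3 / 5 * c * hσ]

theorem Arch.resolvable {ℓ : V → ℝ} {q : V → Pt} {σ : ℝ} (hσ : σ ^ 2 = 1) {x y z v : V}
    (h : Arch G Set.univ ℓ q σ x y z) (hdeg : (G.neighborSet v).ncard ≤ 3)
    (hv : v ∈ ({x, y, z} : Set V)) : Resolvable G ℓ q v := by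
  have down : ∀ t ∈ ({x, y, z} : Set V), ∀ w, G.Adj t w → w ∉ ({x, y, z} : Set V) →
      ∃ c > 0, limitDir ℓ q t w = !₂[0, 0, -(c * σ)] := by
    intro t ht w htw hw
    have := h.lt t ht w trivial htw hw
    refine ⟨σ * (ℓ t - ℓ w), by linarith, ?_⟩
    rw [limitDir, if_neg (by intro e; rw [e] at this; exact this.false), smul_vertical]
    congr
    linear_combination (ℓ t - ℓ w) * hσ
  have flat {t w : V} (e : ℓ t = ℓ w) : limitDir ℓ q t w = q w - q t := if_pos e
  obtain rfl | rfl | rfl := hv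
  · refine resolvable_arch_end hdeg hσ (τ := 1) (by norm_num) h.left h.right.ne ?_ ?_
      fun w hw h1 h2 ↦ down _ (by simp) _ hw (by simp [hw.ne', h1, h2])
    · rw [flat h.height_left, h.offset_mid, h.offset_left, sub_three]; norm_num
    · rw [flat (h.height_left.trans h.height_right.symm), h.offset_right, h.offset_left,
        sub_three]; norm_num
  · refine resolvable_arch_mid hdeg hσ h.left.symm h.right h.ne ?_ ?_
      fun w hw h1 h2 ↦ down _ (by simp) _ hw (by simp [hw.ne', h1, h2])
    · rw [flat h.height_left.symm, h.offset_mid, h.offset_left, sub_three]; norm_num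
    · rw [flat h.height_right.symm, h.offset_mid, h.offset_right, sub_three]; norm_num
  · refine resolvable_arch_end hdeg hσ (τ := -1) (by norm_num) h.right.symm h.left.ne' ?_ ?_
      fun w hw h1 h2 ↦ down _ (by simp) _ hw (by simp [hw.ne', h1, h2])
    · rw [flat h.height_right, h.offset_mid, h.offset_right, sub_three]; norm_num
    · rw [flat (h.height_right.trans h.height_left.symm), h.offset_right, h.offset_left,
        sub_three]; norm_num

/-- The set `K ⊆ S` is a union of connected components of the subgraph induced on `S`. -/
def ClosedIn (G : SimpleGraph V) (S K : Set V) : Prop :=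
  K ⊆ S ∧ ∀ v ∈ K, ∀ w ∈ S, G.Adj v w → w ∈ K

theorem ClosedIn.refl (G : SimpleGraph V) (S : Set V) : ClosedIn G S S :=
  ⟨subset_rfl, fun _ _ _ hw _ ↦ hw⟩

theorem ClosedIn.diff {S K : Set V} (h : ClosedIn G S K) : ClosedIn G S (S \ K) :=
  ⟨Set.sdiff_subset, fun v hv w hw hvw ↦ ⟨hw, fun hwK ↦ hv.2 (h.2 w hwK v hv.1 hvw.symm)⟩⟩

theorem ClosedIn.trans {S K L : Set V} (h : ClosedIn G S K) (h' : ClosedIn G K L) :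
    ClosedIn G S L :=
  ⟨h'.1.trans h.1, fun v hv w hw hvw ↦ h'.2 v hv w (h.2 v (h'.1 hv) w hw hvw) hvw⟩

theorem ClosedIn.inter {S T K : Set V} (h : ClosedIn G S K) (hT : T ⊆ S) :
    ClosedIn G T (K ∩ T) :=
  ⟨Set.inter_subset_right, fun v hv w hw hvw ↦ ⟨h.2 v hv.1 w (hT hw) hvw, hw⟩⟩

/-- The subgraph induced on `B` is connected or empty. -/
def Linked (G : SimpleGraph V) (B : Set V) : Prop :=
  ∀ L, ClosedIn G B L → L.Nonempty → L = B

theorem exists_linked_closedIn [Finite V] {S : Set V} (hS : S.Nonempty) :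
    ∃ L, ClosedIn G S L ∧ L.Nonempty ∧ Linked G L := by
  obtain ⟨L, ⟨hL, hne⟩, hmin⟩ := Set.exists_min_image {L | ClosedIn G S L ∧ L.Nonempty} Set.ncard
    (Set.toFinite _) ⟨S, ClosedIn.refl G S, hS⟩
  exact ⟨L, hL, hne, fun M hM hMne ↦ Set.eq_of_subset_of_ncard_le hM.1
    (hmin M ⟨hL.trans hM, hMne⟩)⟩

theorem ClosedIn.or_closedIn_insert {S K : Set V} {r : V} (h : ClosedIn G (S \ {r}) K)
    (hr : r ∈ S) (hall : ∀ s ∈ K, G.Adj r s → ∀ t ∈ S, G.Adj r t → t ∈ K) :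
    ClosedIn G S K ∨ ClosedIn G S (insert r K) := by
  by_cases hs : ∃ s ∈ K, G.Adj r s
  · obtain ⟨s, hsK, hrs⟩ := hs
    refine .inr ⟨Set.insert_subset hr (h.1.trans Set.sdiff_subset), ?_⟩
    rintro v (rfl | hv) w hw hvw
    · exact .inr (hall s hsK hrs w hw hvw)
    · obtain rfl | hwr := eq_or_ne w r
      · exact .inl rfl
      · exact .inr (h.2 v hv w ⟨hw, hwr⟩ hvw)
  · refine .inl ⟨h.1.trans Set.sdiff_subset, fun v hv w hw hvw ↦ h.2 v hv w ⟨hw, ?_⟩ hvw⟩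
    rintro rfl
    exact hs ⟨v, hv, hvw.symm⟩

/-- If deleting `v` splits off at most two vertices, then some vertex among those can be deleted
without splitting anything. -/
theorem exists_removable [Finite V] {S K : Set V} {v : V} (hv : v ∈ S)
    (hS : ∀ L, ClosedIn G S L → L.Nonempty → 3 ≤ L.ncard) (hK : ClosedIn G (S \ {v}) K)
    (hne : K.Nonempty) (hcard : K.ncard ≤ 2) :
    ∃ r ∈ K, (G.neighborSet r ∩ S).ncard ≤ 2 ∧ ∀ L, ClosedIn G (S \ {r}) L →
      ClosedIn G S L ∨ ClosedIn G S (insert r L) := by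
  have single : ∀ w ∈ K, (∀ t ∈ S, G.Adj w t → t = v) →
      ∃ r ∈ K, (G.neighborSet r ∩ S).ncard ≤ 2 ∧ ∀ L, ClosedIn G (S \ {r}) L →
        ClosedIn G S L ∨ ClosedIn G S (insert r L) := by
    refine fun w hw h ↦ ⟨w, hw, ?_, fun L hL ↦ hL.or_closedIn_insert (hK.1 hw).1
      fun s hs hws t ht hwt ↦ ?_⟩
    · have : G.neighborSet w ∩ S ⊆ {v} := fun t ht ↦ h t ht.2 ht.1
      have := Set.ncard_le_ncard this
      rw [Set.ncard_singleton] at this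
      lia
    · rwa [h t ht hwt, ← h s (hL.1 hs).1 hws]
  have out : ∀ w ∈ K, ∀ t ∈ S, G.Adj w t → t = v ∨ t ∈ K := fun w hw t ht hwt ↦ by
    by_cases htv : t = v
    · exact .inl htv
    · exact .inr (hK.2 w hw t ⟨ht, htv⟩ hwt)
  have pair : ∀ o r, o ≠ r → K = {o, r} → G.Adj o v →
      ∃ r ∈ K, (G.neighborSet r ∩ S).ncard ≤ 2 ∧ ∀ L, ClosedIn G (S \ {r}) L →
        ClosedIn G S L ∨ ClosedIn G S (insert r L) := by
    intro o r hor hKe hov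
    have hoK : o ∈ K := by simp [hKe]
    have hrK : r ∈ K := by simp [hKe]
    have hrN : ∀ t ∈ S, G.Adj r t → t = v ∨ t = o := fun t ht hrt ↦ by
      obtain h | h := out r hrK t ht hrt
      · exact .inl h
      · rw [hKe] at h
        obtain h | h := h
        · exact .inr h
        · exact (hrt.ne h.symm).elim
    refine ⟨r, hrK, ?_, fun L hL ↦ hL.or_closedIn_insert (hK.1 hrK).1
      fun s hs hrs t ht hrt ↦ ?_⟩
    · have : G.neighborSet r ∩ S ⊆ {v, o} := fun t ht ↦ hrN t ht.2 ht.1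
      have := (Set.ncard_le_ncard this).trans (Set.ncard_insert_le v {o})
      rwa [Set.ncard_singleton] at this
    · have hv' : v ∈ S \ {r} := ⟨hv, fun e ↦ (hK.1 hrK).2 e.symm⟩
      have ho' : o ∈ S \ {r} := ⟨(hK.1 hoK).1, hor⟩
      obtain rfl | rfl := hrN s (hL.1 hs).1 hrs <;> obtain rfl | rfl := hrN t ht hrt
      · exact hs
      · exact hL.2 _ hs _ ho' hov.symm
      · exact hL.2 _ hs _ hv' hov
      · exact hs
  have hnot : ¬ ClosedIn G S K := fun h ↦ by have := hS K h hne; lia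
  have : ∃ o ∈ K, G.Adj o v := by
    by_contra! h
    exact hnot ⟨hK.1.trans Set.sdiff_subset, fun w hw t ht hwt ↦ (out w hw t ht hwt).resolve_left
      (by rintro rfl; exact h w hw hwt)⟩
  obtain ⟨o, ho, hov⟩ := this
  obtain hlt | heq := hcard.lt_or_eq
  · refine single o ho fun t ht hot ↦ (out o ho t ht hot).resolve_right fun htK ↦ hot.ne ?_
    exact (Set.ncard_le_one (Set.toFinite _)).1 (by lia) o ho t htK
  · obtain ⟨a, b, hab, rfl⟩ := Set.ncard_eq_two.1 heq
    obtain rfl | rfl := ho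
    · exact pair _ _ hab rfl hov
    · exact pair _ _ hab.symm (Set.pair_comm _ _) hov

theorem exists_path_of_ncard_eq_three [Finite V] {S K : Set V}
    (hS : ∀ L, ClosedIn G S L → L.Nonempty → 3 ≤ L.ncard) (hK : ClosedIn G S K)
    (hcard : K.ncard = 3) : ∃ x y z, x ≠ z ∧ G.Adj x y ∧ G.Adj y z ∧ K = {x, y, z} := by
  have nbr : ∀ v ∈ K, ∃ w ∈ K, G.Adj v w := by
    intro v hv
    by_contra! h
    have := hS {v} (hK.trans ⟨by simpa, by rintro _ rfl w hw hvw; exact (h w hw hvw).elim⟩)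
      (Set.singleton_nonempty v)
    simp at this
  obtain ⟨a, ha⟩ : K.Nonempty := Set.nonempty_of_ncard_ne_zero (by lia)
  obtain ⟨b, hb, hab⟩ := nbr a ha
  obtain ⟨c, hac, hbc, rfl⟩ := exists_eq_triple_of_mem_of_mem hcard ha hb hab.ne
  obtain ⟨d, rfl | rfl | rfl, hcd⟩ := nbr c (by simp)
  · exact ⟨c, d, b, hbc.symm, hcd, hab, by ext; simp; tauto⟩
  · exact ⟨a, d, c, hac, hab, hcd.symm, rfl⟩
  · exact (hcd.ne rfl).elim

/-- Every vertex of `S` can be resolved by looking at its neighbours in `S` only. -/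
def Labelled (G : SimpleGraph V) (S : Set V) (ℓ : V → ℝ) (q : V → Pt) : Prop :=
  ∀ v ∈ S, Climbing G S ℓ v ∨
    ∃ x y z, v ∈ ({x, y, z} : Set V) ∧ ({x, y, z} : Set V) ⊆ S ∧ Arch G S ℓ q 1 x y z

theorem Arch.extend {K S : Set V} {ℓ ℓ' : V → ℝ} {q q' : V → Pt} {σ : ℝ} {x y z : V}
    (h : Arch G K ℓ q σ x y z) (hK : ({x, y, z} : Set V) ⊆ K) (hℓ : Set.EqOn ℓ' ℓ K)
    (hq : Set.EqOn q' q K)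
    (hlow : ∀ t ∈ ({x, y, z} : Set V), ∀ w ∈ S \ K, G.Adj t w → σ * ℓ' w < σ * ℓ' t) :
    Arch G S ℓ' q' σ x y z := by
  have hx : x ∈ K := hK (by simp)
  have hy : y ∈ K := hK (by simp)
  have hz : z ∈ K := hK (by simp)
  refine ⟨h.ne, h.left, h.right, ?_, ?_, ?_, ?_, ?_, fun t ht w hw htw hw' ↦ ?_⟩
  · rw [hℓ hx, hℓ hy, h.height_left]
  · rw [hℓ hz, hℓ hy, h.height_right]
  · rw [hq hx, h.offset_left]
  · rw [hq hy, h.offset_mid]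
  · rw [hq hz, h.offset_right]
  · by_cases hwK : w ∈ K
    · rw [hℓ hwK, hℓ (hK ht)]
      exact h.lt t ht w hwK htw hw'
    · exact hlow t ht w ⟨hw, hwK⟩ htw

theorem Climbing.extend {K S : Set V} {ℓ ℓ' : V → ℝ} {v : V} (h : Climbing G K ℓ v) (hv : v ∈ K)
    (hKS : K ⊆ S) (hℓ : Set.EqOn ℓ' ℓ K)
    (hlow : ∀ w ∈ S \ K, G.Adj v w → ℓ' w < ℓ' v) : Climbing G S ℓ' v := by
  obtain ⟨hne, ⟨w, hw, hvw, hlt⟩, h⟩ := h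
  refine ⟨fun t ht hvt ↦ ?_, ⟨w, hKS hw, hvw, by rwa [hℓ hw, hℓ hv]⟩, ?_⟩
  · by_cases htK : t ∈ K
    · rw [hℓ htK, hℓ hv]
      exact hne t htK hvt
    · exact (hlow t ⟨ht, htK⟩ hvt).ne
  · by_cases hout : ∃ t ∈ S \ K, G.Adj v t
    · obtain ⟨t, ht, hvt⟩ := hout
      exact .inr ⟨t, ht.1, hvt, hlow t ht hvt⟩
    · push Not at hout
      obtain h | ⟨t, ht, hvt, htl⟩ := h
      · left
        rwa [show G.neighborSet v ∩ S = G.neighborSet v ∩ K from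
          Set.Subset.antisymm (fun t ht ↦ ⟨ht.1, by_contra fun htK ↦ hout t ⟨ht.2, htK⟩ ht.1⟩)
            (Set.inter_subset_inter_right _ hKS)]
      · exact .inr ⟨t, hKS ht, hvt, by rwa [hℓ ht, hℓ hv]⟩

theorem Labelled.extend {K S : Set V} {ℓ ℓ' : V → ℝ} {q q' : V → Pt} (h : Labelled G K ℓ q)
    (hKS : K ⊆ S) (hℓ : Set.EqOn ℓ' ℓ K) (hq : Set.EqOn q' q K)
    (hlow : ∀ v ∈ K, ∀ w ∈ S \ K, G.Adj v w → ℓ' w < ℓ' v) {v : V} (hv : v ∈ K) :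
    Climbing G S ℓ' v ∨
      ∃ x y z, v ∈ ({x, y, z} : Set V) ∧ ({x, y, z} : Set V) ⊆ S ∧ Arch G S ℓ' q' 1 x y z := by
  obtain h | ⟨x, y, z, hv', hK, h⟩ := h v hv
  · exact .inl (h.extend hv hKS hℓ (hlow v hv))
  · exact .inr ⟨x, y, z, hv', hK.trans hKS, h.extend hK hℓ hq fun t ht w hw htw ↦ by
      simpa using hlow t (hK ht) w hw htw⟩

open Classical in
/-- The assignment `q` modified on the path `x, y, z` to have the shape of an `Arch`. -/
def archOffset (q : V → Pt) (σ : ℝ) (x y z v : V) : Pt :=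
  if v = x then !₂[-4, 0, 0] else if v = y then !₂[0, 0, 3 * σ] else
    if v = z then !₂[4, 0, 0] else q v

open Classical in
theorem arch_piecewise {S : Set V} {σ c : ℝ} {ℓ : V → ℝ} {q : V → Pt} {x y z : V} (hxz : x ≠ z)
    (hxy : G.Adj x y) (hyz : G.Adj y z)
    (h : ∀ t ∈ ({x, y, z} : Set V), ∀ w ∈ S, G.Adj t w → w ∉ ({x, y, z} : Set V) →
      σ * ℓ w < σ * c) :
    Arch G S (Set.piecewise {x, y, z} (fun _ ↦ c) ℓ) (archOffset q σ x y z) σ x y z := by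
  refine ⟨hxz, hxy, hyz, by simp, by simp, by simp [archOffset], by simp [archOffset, hxy.ne'],
    by simp [archOffset, hxz.symm, hyz.ne'], fun t ht w hw htw hw' ↦ ?_⟩
  rw [Set.piecewise_eq_of_mem _ _ _ ht, Set.piecewise_eq_of_notMem _ _ _ hw']
  exact h t ht w hw htw hw'

open Classical in
theorem eqOn_piecewise_path {K : Set V} {c : ℝ} {ℓ : V → ℝ} {x y z : V}
    (hK : Disjoint K {x, y, z}) : Set.EqOn (Set.piecewise {x, y, z} (fun _ ↦ c) ℓ) ℓ K :=
  fun _ hv ↦ Set.piecewise_eq_of_notMem _ _ _ (Set.disjoint_left.1 hK hv)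

theorem eqOn_archOffset {K : Set V} {q : V → Pt} {σ : ℝ} {x y z : V}
    (hK : Disjoint K {x, y, z}) : Set.EqOn (archOffset q σ x y z) q K := by
  intro v hv
  have := Set.disjoint_left.1 hK hv
  simp only [Set.mem_insert_iff, Set.mem_singleton_iff, not_or] at this
  simp [archOffset, this]

theorem exists_lt_all [Finite V] (ℓ : V → ℝ) : ∃ c, ∀ v, c < ℓ v := by
  obtain ⟨c, hc⟩ := (Set.finite_range ℓ).bddBelow
  exact ⟨c - 1, fun v ↦ by linarith [hc ⟨v, rfl⟩]⟩

/-- All components of the subgraph induced on `S` have at least three vertices, and one of degree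
less than three. -/
def Erodible (G : SimpleGraph V) (S : Set V) : Prop :=
  ∀ K, ClosedIn G S K → K.Nonempty → 3 ≤ K.ncard ∧ ∃ v ∈ K, (G.neighborSet v ∩ S).ncard < 3

theorem Erodible.exists_labelled [Finite V] (hdeg : ∀ v, (G.neighborSet v).ncard ≤ 3) {S : Set V}
    (hS : Erodible G S) : ∃ ℓ q, Labelled G S ℓ q := by
  induction hn : S.ncard using Nat.strong_induction_on generalizing S with
  | _ n ih =>
  obtain rfl | hne := S.eq_empty_or_nonempty
  · exact ⟨0, 0, fun v hv ↦ hv.elim⟩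
  have hS3 K (hK : ClosedIn G S K) (hne : K.Nonempty) := (hS K hK hne).1
  by_cases hsmall : ∃ K, ClosedIn G S K ∧ K.ncard = 3
  · obtain ⟨K, hK, hcard⟩ := hsmall
    obtain ⟨x, y, z, hxz, hxy, hyz, rfl⟩ := exists_path_of_ncard_eq_three hS3 hK hcard
    have hlt : (S \ {x, y, z}).ncard < n := hn ▸ Set.ncard_lt_ncard
      ⟨Set.sdiff_subset, fun h ↦ (h (hK.1 (Set.mem_insert x _))).2 (Set.mem_insert x _)⟩
    obtain ⟨ℓ, q, h⟩ := ih _ hlt (S := S \ {x, y, z}) (fun L hL hLne ↦ by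
      obtain ⟨h1, v, hv, h2⟩ := hS L (hK.diff.trans hL) hLne
      exact ⟨h1, v, hv, (Set.ncard_le_ncard
        (Set.inter_subset_inter_right _ Set.sdiff_subset)).trans_lt h2⟩) rfl
    classical
    refine ⟨Set.piecewise {x, y, z} (fun _ ↦ 0) ℓ, archOffset q 1 x y z, fun v hv ↦ ?_⟩
    by_cases hvK : v ∈ ({x, y, z} : Set V)
    · exact .inr ⟨x, y, z, hvK, hK.1, arch_piecewise hxz hxy hyz fun t ht w hw htw hw' ↦
        (hw' (hK.2 t ht w hw htw)).elim⟩
    · refine h.extend Set.sdiff_subset (eqOn_piecewise_path disjoint_sdiff_self_left)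
        (eqOn_archOffset disjoint_sdiff_self_left) (fun t ht w hw htw ↦ ?_) ⟨hv, hvK⟩
      exact (hw.2 (hK.diff.2 t ht w hw.1 htw)).elim
  · have hS4 K (hK : ClosedIn G S K) (hne : K.Nonempty) : 4 ≤ K.ncard :=
      (Nat.lt_or_eq_of_le (hS3 K hK hne)).resolve_right fun e ↦ hsmall ⟨K, hK, e.symm⟩
    obtain ⟨r, hr, hrdeg, hrS⟩ : ∃ r ∈ S, (G.neighborSet r ∩ S).ncard < 3 ∧
        ∀ K, ClosedIn G (S \ {r}) K → K.Nonempty → 3 ≤ K.ncard := by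
      obtain ⟨-, v, hv, hvdeg⟩ := hS S (ClosedIn.refl G S) hne
      by_cases hbad : ∃ K, ClosedIn G (S \ {v}) K ∧ K.Nonempty ∧ K.ncard ≤ 2
      · obtain ⟨K, hK, hKne, hK2⟩ := hbad
        obtain ⟨r, hr, hr2, h⟩ := exists_removable hv hS3 hK hKne hK2
        refine ⟨r, (hK.1 hr).1, by lia, fun L hL hLne ↦ ?_⟩
        obtain h | h := h L hL
        · exact hS3 L h hLne
        · have := hS4 _ h (Set.insert_nonempty r L)
          have := Set.ncard_insert_le r L
          lia
      · push Not at hbad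
        exact ⟨v, hv, hvdeg, hbad⟩
    have hlt : (S \ {r}).ncard < n := hn ▸ Set.ncard_sdiff_singleton_lt_of_mem hr
    obtain ⟨ℓ, q, h⟩ := ih _ hlt (S := S \ {r}) (fun L hL hLne ↦ by
      refine ⟨hrS L hL hLne, ?_⟩
      by_cases hadj : ∃ v ∈ L, G.Adj v r
      · obtain ⟨v, hv, hvr⟩ := hadj
        refine ⟨v, hv, (Set.ncard_lt_ncard ⟨?_, fun h ↦ ?_⟩).trans_le (hdeg v)⟩
        · exact Set.inter_subset_left
        · exact (h hvr).2.2 rfl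
      · push Not at hadj
        have hL' : ClosedIn G S L := ⟨hL.1.trans Set.sdiff_subset, fun v hv w hw hvw ↦
          hL.2 v hv w ⟨hw, fun e ↦ hadj v hv (e ▸ hvw)⟩ hvw⟩
        obtain ⟨-, v, hv, h2⟩ := hS L hL' hLne
        exact ⟨v, hv, (Set.ncard_le_ncard
          (Set.inter_subset_inter_right _ Set.sdiff_subset)).trans_lt h2⟩) rfl
    obtain ⟨c, hc⟩ := exists_lt_all ℓ
    classical
    have hℓ {v} (hv : v ≠ r) : Function.update ℓ r c v = ℓ v := Function.update_of_ne hv _ _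
    have hrc : Function.update ℓ r c r = c := Function.update_self _ _ _
    refine ⟨Function.update ℓ r c, q, fun v hv ↦ ?_⟩
    obtain rfl | hvr := eq_or_ne v r
    · refine .inl ⟨fun w hw hvw ↦ ?_, ?_, .inl hrdeg⟩
      · rw [hℓ hvw.ne', hrc]
        exact (hc w).ne'
      · by_contra! hno
        have := hS4 {v} ⟨by simpa, by
          rintro _ rfl w hw hvw
          have := hno w hw hvw
          rw [hℓ hvw.ne', hrc] at this
          exact ((hc w).not_ge this).elim⟩ (Set.singleton_nonempty v)
        simp at this
    · refine h.extend Set.sdiff_subset (fun w hw ↦ hℓ hw.2) (fun _ _ ↦ rfl)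
        (fun t ht w hw htw ↦ ?_) ⟨hv, hvr⟩
      obtain rfl : w = r := by simpa [hw.1] using hw.2
      rw [hrc, hℓ ht.2]
      exact hc t

theorem Linked.eq_empty_or_eq {B L : Set V} (h : Linked G B) (hL : ClosedIn G B L) :
    L = ∅ ∨ L = B :=
  L.eq_empty_or_nonempty.imp_right (h L hL)

theorem Linked.exists_adj {K B : Set V} (hK : Linked G K) (hBK : B ⊆ K) (hB : B.Nonempty)
    (hne : B ≠ K) : ∃ b ∈ B, ∃ c ∈ K \ B, G.Adj b c := by
  by_contra! h
  exact hne (hK B ⟨hBK, fun v hv w hw hvw ↦ by_contra fun hwB ↦ h v hv w ⟨hw, hwB⟩ hvw⟩ hB)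

/-- In a cubic component, a smallest connected set of at least three vertices with connected
complement has exactly three vertices. -/
theorem exists_linked_ncard_eq_three [Finite V] {K : Set V} (hK : Linked G K)
    (h3 : 3 ≤ K.ncard) (hcubic : ∀ v ∈ K, (G.neighborSet v ∩ K).ncard = 3) :
    ∃ B ⊆ K, Linked G B ∧ Linked G (K \ B) ∧ B.ncard = 3 := by
  have hempty : Linked G (∅ : Set V) := fun L hL hne ↦ (hne.mono hL.1).ne_empty.elim rfl
  obtain ⟨B, ⟨hBK, hB, hBc, hB3⟩, hmin⟩ := Set.exists_min_image
    {B | B ⊆ K ∧ Linked G B ∧ Linked G (K \ B) ∧ 3 ≤ B.ncard} Set.ncard (Set.toFinite _)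
    ⟨K, subset_rfl, hK, by rwa [Set.sdiff_self], h3⟩
  refine ⟨B, hBK, hB, hBc, hB3.antisymm' (not_lt.1 fun h4 ↦ ?_)⟩
  have hBne : B.Nonempty := Set.nonempty_of_ncard_ne_zero (by lia)
  obtain ⟨b, hb, hbadj⟩ : ∃ b ∈ B, B ≠ K → ∃ c ∈ K \ B, G.Adj b c := by
    by_cases hBe : B = K
    · obtain ⟨b, hb⟩ := hBne
      exact ⟨b, hb, fun h ↦ (h hBe).elim⟩
    · obtain ⟨b, hb, h⟩ := hK.exists_adj hBK hBne hBe
      exact ⟨b, hb, fun _ ↦ h⟩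
  have hBb : (B \ {b}).Nonempty := by
    apply Set.nonempty_of_ncard_ne_zero
    rw [Set.ncard_sdiff_singleton_of_mem hb]
    lia
  obtain ⟨L, hL, hLne, hLl⟩ := exists_linked_closedIn (G := G) hBb
  have hLB : L ⊆ B := hL.1.trans Set.sdiff_subset
  have hbL : b ∉ L := fun h ↦ (hL.1 h).2 rfl
  have hLc : Linked G (K \ L) := by
    have mem : ∀ M, ClosedIn G (K \ L) M → M.Nonempty → b ∈ M := by
      intro M hM hMne
      by_contra hbM
      have hMB : M ⊆ B := by
        have hcl := hM.inter (Set.sdiff_subset_sdiff_right hLB)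
        obtain h | h := hBc.eq_empty_or_eq hcl
        · intro v hv
          by_contra hvB
          exact (h ▸ ⟨hv, (hM.1 hv).1, hvB⟩ : v ∈ (∅ : Set V))
        · by_cases hBe : B = K
          · exact hBe ▸ hM.1.trans Set.sdiff_subset
          · obtain ⟨c, hc, hbc⟩ := hbadj hBe
            rw [← h] at hc
            exact (hbM (hM.2 c hc.1 b ⟨hBK hb, hbL⟩ hbc.symm)).elim
      have : M = B := hB M ⟨hMB, fun v hv w hw hvw ↦ hM.2 v hv w ⟨hBK hw, fun hwL ↦
        (hM.1 hv).2 (hL.2 w hwL v ⟨hMB hv, by rintro rfl; exact hbM hv⟩ hvw.symm)⟩ hvw⟩ hMne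
      exact hbM (this ▸ hb)
    intro M hM hMne
    by_contra hne
    obtain ⟨v, hv⟩ : ((K \ L) \ M).Nonempty := by
      rw [Set.sdiff_nonempty]
      exact fun h ↦ hne (hM.1.antisymm h)
    exact (mem _ hM.diff ⟨v, hv⟩).2 (mem M hM hMne)
  have hL2 : L.ncard ≤ 2 := by
    by_contra! h
    have := hmin L ⟨hLB.trans hBK, hLl, hLc, h⟩
    exact this.not_gt (Set.ncard_lt_ncard ⟨hLB, fun h ↦ hbL (h hb)⟩)
  obtain ⟨r, hr, hr2, hrem⟩ := exists_removable hb
    (fun M hM hMne ↦ by rwa [hB M hM hMne]) hL hLne hL2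
  have hrB : r ∈ B := hLB hr
  obtain ⟨d, hd, hrd⟩ : ∃ d ∈ K \ B, G.Adj r d := by
    by_contra! h
    have hsub : G.neighborSet r ∩ K ⊆ G.neighborSet r ∩ B := fun d hd ↦
      ⟨hd.1, by_contra fun hdB ↦ h d ⟨hd.2, hdB⟩ hd.1⟩
    have := Set.ncard_le_ncard hsub
    rw [hcubic r (hBK hrB)] at this
    lia
  have hBr : Linked G (B \ {r}) := by
    intro M hM hMne
    obtain h | h := hrem M hM
    · have := hB M h hMne
      exact ((hM.1 (this ▸ hrB : r ∈ M)).2 rfl).elim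
    · rw [← hB _ h (Set.insert_nonempty r M), Set.insert_sdiff_self_of_notMem]
      exact fun h ↦ (hM.1 h).2 rfl
  have hcompl : K \ (B \ {r}) = insert r (K \ B) := by
    ext v
    by_cases hvr : v = r
    · simp [hvr, hBK hrB]
    · simp [hvr]
  have hBrc : Linked G (K \ (B \ {r})) := by
    rw [hcompl]
    intro M hM hMne
    have hall : r ∈ M → K \ B ⊆ M := by
      intro hrM
      have hdM := hM.2 r hrM d (.inr hd) hrd
      obtain h | h := hBc.eq_empty_or_eq (hM.inter (Set.subset_insert r _))
      · exact (h ▸ ⟨hdM, hd⟩ : d ∈ (∅ : Set V)).elim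
      · exact h ▸ Set.inter_subset_left
    have hrM : r ∈ M := by
      by_contra hrM
      obtain ⟨v, hv⟩ := hMne
      obtain h | h := hBc.eq_empty_or_eq (hM.inter (Set.subset_insert r _))
      · exact (h ▸ ⟨hv, (hM.1 hv).resolve_left (by rintro rfl; exact hrM hv)⟩ : v ∈ (∅ : Set V))
      · exact hrM (hM.2 d (h.symm.subset hd).1 r (.inl rfl) hrd.symm)
    exact hM.1.antisymm (Set.insert_subset hrM (hall hrM))
  have := hmin (B \ {r}) ⟨Set.sdiff_subset.trans hBK, hBr, hBrc, by
    rw [Set.ncard_sdiff_singleton_of_mem hrB]; lia⟩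
  exact this.not_gt (Set.ncard_sdiff_singleton_lt_of_mem hrB)

theorem even_ncard_of_cubic [Finite V] {K : Set V}
    (hcubic : ∀ v ∈ K, (G.neighborSet v ∩ K).ncard = 3) : Even K.ncard := by
  classical
  have := Fintype.ofFinite K
  have hdeg : ∀ v : K, (G.induce K).degree v = 3 := by
    intro v
    rw [← hcubic v v.2, ← SimpleGraph.card_neighborSet_eq_degree, ← Nat.card_eq_fintype_card,
      Nat.card_coe_set_eq, ← Set.ncard_image_of_injective _ Subtype.val_injective]
    congr 1
    ext w
    simp [and_comm]
  have := (G.induce K).sum_degrees_eq_twice_card_edges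
  simp only [hdeg, Finset.sum_const, Finset.card_univ, smul_eq_mul] at this
  rw [← Nat.card_coe_set_eq, Nat.card_eq_fintype_card]
  exact ⟨(G.induce K).edgeFinset.card - Fintype.card K, by lia⟩

theorem exists_tetrahedral [Finite V] {K : Set V} (hcard : K.ncard = 4)
    (hK : ∀ v ∈ K, G.neighborSet v ⊆ K) (hcubic : ∀ v ∈ K, (G.neighborSet v).ncard = 3) :
    ∃ ℓ q, ∀ v ∈ K, Tetrahedral G ℓ q v := by
  classical
  have hN : ∀ v ∈ K, G.neighborSet v = K \ {v} := fun v hv ↦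
    Set.eq_of_subset_of_ncard_le (fun w hw ↦ ⟨hK v hv hw, (G.ne_of_adj hw).symm⟩)
      (by rw [Set.ncard_sdiff_singleton_of_mem hv, hcubic v hv, hcard])
  obtain ⟨a, ha⟩ : K.Nonempty := Set.nonempty_of_ncard_ne_zero (by lia)
  obtain ⟨x, y, z, hxy, hxz, hyz, hax⟩ := Set.ncard_eq_three.1 (hcubic a ha)
  have hKe : K = {a, x, y, z} := by
    rw [← hax, hN a ha, Set.insert_sdiff_singleton, Set.insert_eq_of_mem ha]
  have hna : a ∉ ({x, y, z} : Set V) := by simp [← hax]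
  simp only [Set.mem_insert_iff, Set.mem_singleton_iff, not_or] at hna
  obtain ⟨ax, ay, az⟩ := hna
  let q : V → Pt := fun v ↦ if v = a then !₂[1, 1, 1] else if v = x then !₂[1, -1, -1] else
    if v = y then !₂[-1, 1, -1] else !₂[-1, -1, 1]
  have qa : q a = !₂[1, 1, 1] := by simp [q]
  have qx : q x = !₂[1, -1, -1] := by simp [q, Ne.symm ax]
  have qy : q y = !₂[-1, 1, -1] := by simp [q, Ne.symm ay, hxy.symm]
  have qz : q z = !₂[-1, -1, 1] := by simp [q, Ne.symm az, hxz.symm, hyz.symm]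
  refine ⟨0, q, fun v hv ↦ ?_⟩
  have hv' := hN v hv
  rw [hKe] at hv hv'
  obtain rfl | rfl | rfl | rfl := hv
  · exact ⟨x, y, z, hxy, hxz, hyz, hax, rfl, rfl, rfl, 1, 1, 1, by simp [*]⟩
  · exact ⟨a, z, y, az, ay, hyz.symm, by rw [hv']; grind, rfl, rfl, rfl, 1, -1, -1, by simp [*]⟩
  · exact ⟨z, a, x, Ne.symm az, hxz.symm, ax, by rw [hv']; grind, rfl, rfl, rfl, -1, 1, -1,
      by simp [*]⟩
  · exact ⟨y, x, a, hxy.symm, Ne.symm ay, Ne.symm ax, by rw [hv']; grind, rfl, rfl, rfl,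
      -1, -1, 1, by simp [*]⟩

theorem Labelled.resolvable {K : Set V} (hK : ClosedIn G Set.univ K)
    (hdeg : ∀ v, (G.neighborSet v).ncard ≤ 3) {ℓ : V → ℝ} {q : V → Pt} (h : Labelled G K ℓ q)
    {v : V} (hv : v ∈ K) : Resolvable G ℓ q v := by
  obtain h | ⟨x, y, z, hv', -, h⟩ := h.extend (Set.subset_univ K) (fun _ _ ↦ rfl) (fun _ _ ↦ rfl)
    (fun t ht w hw htw ↦ (hw.2 (hK.2 t ht w trivial htw)).elim) hv
  · exact h.resolvable (hdeg v)
  · exact h.resolvable (by norm_num) (hdeg v) hv'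

theorem exists_resolvable_of_cubic [Finite V] {K : Set V} (hK : ClosedIn G Set.univ K)
    (hdeg : ∀ v, (G.neighborSet v).ncard ≤ 3) (hKl : Linked G K) (hcard : 4 ≤ K.ncard)
    (hcubic : ∀ v ∈ K, (G.neighborSet v ∩ K).ncard = 3) :
    ∃ ℓ q, ∀ v ∈ K, Resolvable G ℓ q v := by
  have hsub : ∀ v ∈ K, G.neighborSet v ⊆ K := fun v hv w hvw ↦ hK.2 v hv w trivial hvw
  obtain h4 | h4 := hcard.eq_or_lt'
  · obtain ⟨ℓ, q, h⟩ := exists_tetrahedral h4 hsub fun v hv ↦ by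
      rw [← hcubic v hv, Set.inter_eq_left.2 (hsub v hv)]
    exact ⟨ℓ, q, fun v hv ↦ (h v hv).resolvable⟩
  have h6 : 6 ≤ K.ncard := by
    obtain ⟨k, hk⟩ := even_ncard_of_cubic hcubic
    lia
  obtain ⟨B, hBK, hB, hBc, hB3⟩ := exists_linked_ncard_eq_three hKl (by lia) hcubic
  have hBne : B.Nonempty := Set.nonempty_of_ncard_ne_zero (by lia)
  have hc3 : 3 ≤ (K \ B).ncard := by
    rw [Set.ncard_sdiff' hBK]
    lia
  obtain ⟨b, hb, c, hc, hbc⟩ := hKl.exists_adj hBK hBne (by rintro rfl; lia)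
  obtain ⟨ℓ, q, h⟩ := Erodible.exists_labelled hdeg (S := K \ B) fun L hL hLne ↦ by
    obtain rfl := hBc L hL hLne
    refine ⟨hc3, c, hc, hcubic c hc.1 ▸ Set.ncard_lt_ncard
      ⟨Set.inter_subset_inter_right _ Set.sdiff_subset, fun h ↦ ?_⟩⟩
    exact (h ⟨hbc.symm, hBK hb⟩).2.2 hb
  obtain ⟨x, y, z, hxz, hxy, hyz, rfl⟩ := exists_path_of_ncard_eq_three (S := B)
    (fun L hL hLne ↦ by rw [hB L hL hLne, hB3]) (ClosedIn.refl G B) hB3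
  obtain ⟨m, hm⟩ := exists_lt_all ℓ
  classical
  have harch : Arch G K (Set.piecewise {x, y, z} (fun _ ↦ m) ℓ) (archOffset q (-1) x y z) (-1)
      x y z := arch_piecewise hxz hxy hyz fun t ht w hw htw hw' ↦ by linarith [hm w]
  have hℓ : Set.EqOn (Set.piecewise {x, y, z} (fun _ ↦ m) ℓ) ℓ (K \ {x, y, z}) :=
    eqOn_piecewise_path disjoint_sdiff_self_left
  refine ⟨Set.piecewise {x, y, z} (fun _ ↦ m) ℓ, archOffset q (-1) x y z, fun v hv ↦ ?_⟩
  by_cases hvB : v ∈ ({x, y, z} : Set V)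
  · exact (harch.extend (S := Set.univ) hBK (fun _ _ ↦ rfl) (fun _ _ ↦ rfl) fun t ht w hw htw ↦
      (hw.2 (hK.2 t (hBK ht) w trivial htw)).elim).resolvable (by norm_num) (hdeg v) hvB
  · obtain h | ⟨x', y', z', hv', -, h⟩ := h.extend (S := Set.univ) (Set.subset_univ _) hℓ
      (eqOn_archOffset disjoint_sdiff_self_left) (fun t ht w hw htw ↦ by
        have hwB : w ∈ ({x, y, z} : Set V) :=
          by_contra fun hwB ↦ hw.2 ⟨hK.2 t ht.1 w trivial htw, hwB⟩
        rw [Set.piecewise_eq_of_mem _ _ _ hwB, hℓ ht]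
        exact hm t) ⟨hv, hvB⟩
    · exact h.resolvable (hdeg v)
    · exact h.resolvable (by norm_num) (hdeg v) hv'

theorem exists_resolvable [Finite V] {K : Set V} (hK : ClosedIn G Set.univ K)
    (hdeg : ∀ v, (G.neighborSet v).ncard ≤ 3) (hKl : Linked G K) :
    ∃ ℓ q, ∀ v ∈ K, Resolvable G ℓ q v := by
  by_cases h2 : ∀ v ∈ K, (G.neighborSet v).ncard ≤ 2
  · exact ⟨0, 0, fun v hv ↦ .inl (h2 v hv)⟩
  push Not at h2
  obtain ⟨u, hu, hu2⟩ := h2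
  have hsub : ∀ v ∈ K, G.neighborSet v ⊆ K := fun v hv w hvw ↦ hK.2 v hv w trivial hvw
  have hcard : 4 ≤ K.ncard := by
    have := Set.ncard_le_ncard (Set.insert_subset hu (hsub u hu))
    rw [Set.ncard_insert_of_notMem (by simp)] at this
    lia
  by_cases hcubic : ∀ v ∈ K, (G.neighborSet v ∩ K).ncard = 3
  · exact exists_resolvable_of_cubic hK hdeg hKl hcard hcubic
  · push Not at hcubic
    obtain ⟨v, hv, hv3⟩ := hcubic
    obtain ⟨ℓ, q, h⟩ := Erodible.exists_labelled hdeg (S := K) fun L hL hLne ↦ by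
      obtain rfl := hKl L hL hLne
      have : (G.neighborSet v ∩ L).ncard ≤ 3 :=
        (Set.ncard_le_ncard Set.inter_subset_left).trans (hdeg v)
      exact ⟨by lia, v, hv, lt_of_le_of_ne this hv3⟩
    exact ⟨ℓ, q, fun v hv ↦ h.resolvable hK hdeg hv⟩

theorem Spreadable.congr {N : Set V} {d d' : V → Pt} (h : Spreadable N d) (hd : Set.EqOn d' d N) :
    Spreadable N d' :=
  let ⟨a, h1, h2⟩ := h
  ⟨a, fun v hv ↦ hd hv ▸ h1 v hv, h2⟩

theorem Resolvable.congr {ℓ ℓ' : V → ℝ} {q q' : V → Pt} {K : Set V} {v : V}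
    (h : Resolvable G ℓ q v) (hv : v ∈ K) (hN : G.neighborSet v ⊆ K) (hℓ : Set.EqOn ℓ' ℓ K)
    (hq : Set.EqOn q' q K) : Resolvable G ℓ' q' v := by
  have hd : Set.EqOn (limitDir ℓ' q' v) (limitDir ℓ q v) (G.neighborSet v) := fun w hw ↦ by
    simp only [limitDir, hℓ hv, hq hv, hℓ (hN hw), hq (hN hw)]
  refine h.imp_right fun ⟨x, y, z, hxy, hxz, hyz, hN, h⟩ ↦ ⟨x, y, z, hxy, hxz, hyz, hN, ?_⟩
  rw [hN] at hd
  rw [hd (by simp : x ∈ _), hd (by simp : y ∈ _), hd (by simp : z ∈ _)]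
  exact h.imp_left fun h ↦ h.congr hd

theorem linked_supp (c : G.ConnectedComponent) : Linked G c.supp := by
  rintro L hL ⟨v, hv⟩
  refine hL.1.antisymm fun w hw ↦ by_contra fun hwL ↦ ?_
  obtain ⟨p⟩ := SimpleGraph.ConnectedComponent.exact ((hL.1 hv).trans hw.symm)
  obtain ⟨d, -, h1, h2⟩ := p.exists_boundary_dart L hv hwL
  exact h2 (hL.2 _ h1 _ ((c.mem_supp_congr_adj d.adj).1 (hL.1 h1)) d.adj)

theorem exists_forall_resolvable [Finite V] (hdeg : ∀ v, (G.neighborSet v).ncard ≤ 3) :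
    ∃ ℓ q, ∀ v, Resolvable G ℓ q v := by
  have hcl (c : G.ConnectedComponent) : ClosedIn G Set.univ c.supp :=
    ⟨Set.subset_univ _, fun v hv w _ hvw ↦ (c.mem_supp_congr_adj hvw).1 hv⟩
  choose ℓ q h using fun c : G.ConnectedComponent ↦ exists_resolvable (hcl c) hdeg (linked_supp c)
  refine ⟨fun v ↦ ℓ (G.connectedComponentMk v) v, fun v ↦ q (G.connectedComponentMk v) v,
    fun v ↦ (h (G.connectedComponentMk v) v rfl).congr (K := (G.connectedComponentMk v).supp) rfl
      (fun w hw ↦ (hcl _).2 v rfl w trivial hw) (fun w hw ↦ ?_) fun w hw ↦ ?_⟩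
  · rw [show G.connectedComponentMk w = _ from hw]
  · rw [show G.connectedComponentMk w = _ from hw]

/-- Every graph with maximum degree at most three has a non-crossing
polyline drawing in ℝ³ with at most two bends per edge and angular resolution at
least `2π/3` (120°). -/
theorem degree_three_two_bend_drawing (V : Type) [Fintype V] [DecidableEq V]
    (G : SimpleGraph V) [DecidableRel G.Adj]
    (hdeg : ∀ v, G.degree v ≤ 3) :
    ∃ D : PolylineDrawing G,
      NonCrossing D ∧ MaxBends D 2 ∧ AngularResAtLeast D (2 * Real.pi / 3) := by
  have hdeg' (v : V) : (G.neighborSet v).ncard ≤ 3 := by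
    rw [← Nat.card_coe_set_eq, Nat.card_eq_fintype_card, SimpleGraph.card_neighborSet_eq_degree]
    exact hdeg v
  obtain ⟨ℓ, q, h⟩ := exists_forall_resolvable hdeg'
  exact exists_drawing_of_resolvable h
end
end
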